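/- arXiv:2008.09888 — 4 statements merged into one kernel-verified Lean document; each statement's English description precedes it below -/
import Mathlib

section
/- For every orientation F of a cactus graph, mader_χ⃗(F) = v(F); that is, every digraph with dichromatic number at least v(F) contains a subdivision of F. -/
/-- A digraph on a vertex type `V`: a set of arcs given by an adjacency relation. -/
structure Digraph' (V : Type) where
  Adj : V → V → Prop

namespace Digraph'

variable {V : Type}

/-- A digraph is loopless if it has no arc from a vertex to itself. -/
def Loopless (D : Digraph' V) : Prop := ∀ v, ¬ D.Adj v v

/-- A set `S` of vertices is acyclic in `D` if the subdigraph induced by `S`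
contains no directed cycle (equivalently, no vertex can reach itself by a
nontrivial directed walk staying inside `S`). -/
def AcyclicOn (D : Digraph' V) (S : Set V) : Prop :=
  ∀ v, ¬ Relation.TransGen (fun x y => x ∈ S ∧ y ∈ S ∧ D.Adj x y) v v

/-- An acyclic coloring of `D` with `k` colors: every color class induces an
acyclic subdigraph. -/
def IsAcyclicColoring (D : Digraph' V) {k : ℕ} (c : V → Fin k) : Prop :=
  ∀ i : Fin k, D.AcyclicOn {v | c v = i}

/-- The dichromatic number of `D`: the least `k` such that `D` admits an
acyclic coloring with `k` colors. -/
noncomputable def dichromaticNumber (D : Digraph' V) : ℕ :=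
  sInf {k : ℕ | ∃ c : V → Fin k, D.IsAcyclicColoring c}

/-- `D.IsDipath u l v`: the list `u :: l ++ [v]` is a directed path in `D`
from `u` to `v`, with (pairwise distinct) internal vertices `l`. -/
def IsDipath (D : Digraph' V) (u : V) (l : List V) (v : V) : Prop :=
  (u :: l ++ [v]).Chain' D.Adj ∧ (u :: l ++ [v]).Nodup

/-- `D.ContainsSubdivision F`: some subdigraph of `D` is a subdivision of `F`.
Concretely, there is an injective map `β` of the vertices of `F` into `D`
(the branch vertices), and for every arc `(a,b)` of `F` a directed path in
`D` from `β a` to `β b`, such that the internal vertices of these paths avoid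
all branch vertices and the paths of distinct arcs are internally disjoint. -/
def ContainsSubdivision {α : Type} (D : Digraph' V) (F : Digraph' α) : Prop :=
  ∃ (β : α → V) (p : ∀ a b, F.Adj a b → List V),
    Function.Injective β ∧
    (∀ a b (h : F.Adj a b), D.IsDipath (β a) (p a b h) (β b)) ∧
    (∀ a b (h : F.Adj a b) (x : V), x ∈ p a b h → x ∉ Set.range β) ∧
    (∀ a b (h : F.Adj a b) (a' b' : α) (h' : F.Adj a' b'),
      (a, b) ≠ (a', b') → ∀ x, x ∈ p a b h → x ∉ p a' b' h')

/-- `MaderBound F k`: every (finite, loopless) digraph with dichromatic number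
at least `k` contains a subdivision of `F`. -/
def MaderBound {α : Type} (F : Digraph' α) (k : ℕ) : Prop :=
  ∀ (n : ℕ) (D : Digraph' (Fin n)), D.Loopless →
    k ≤ D.dichromaticNumber → D.ContainsSubdivision F

/-- The dichromatic Mader number of `F`: the smallest integer `k ≥ 1` such that
every digraph with dichromatic number at least `k` contains a subdivision of `F`. -/
noncomputable def mader {α : Type} (F : Digraph' α) : ℕ :=
  sInf {k : ℕ | 1 ≤ k ∧ MaderBound F k}

/-- A digraph is strongly connected if every vertex can reach every other
vertex by a directed path. -/
def StronglyConnected (D : Digraph' V) : Prop :=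
  ∀ x y : V, Relation.ReflTransGen D.Adj x y

/-- The subdigraph of `D` induced by a set `S` of vertices. -/
def induce (D : Digraph' V) (S : Set V) : Digraph' S :=
  ⟨fun a b => D.Adj a.1 b.1⟩

end Digraph'

/-- `D` is an orientation of the undirected simple graph `G`: the arcs of `D`
are obtained by choosing exactly one direction for each edge of `G`. -/
def IsOrientationOf {γ : Type} (D : Digraph' γ) (G : SimpleGraph γ) : Prop :=
  (∀ a b, D.Adj a b → G.Adj a b) ∧
  (∀ a b, G.Adj a b → ((D.Adj a b ∨ D.Adj b a) ∧ ¬ (D.Adj a b ∧ D.Adj b a)))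


/-- A cactus: an undirected graph in which no two cycles share two or more
vertices (any two cycles sharing two distinct vertices have the same edge set). -/
def IsCactus {γ : Type} [DecidableEq γ] (G : SimpleGraph γ) : Prop :=
  ∀ (u v : γ) (c₁ : G.Walk u u) (c₂ : G.Walk v v), c₁.IsCycle → c₂.IsCycle →
    ∀ x y, x ≠ y → x ∈ c₁.support → x ∈ c₂.support → y ∈ c₁.support → y ∈ c₂.support →
      c₁.edges.toFinset = c₂.edges.toFinset

namespace CM

open Relation

variable {V : Type}

/-- Arcs inside a vertex set. -/
def InR (r : V → V → Prop) (S : Set V) : V → V → Prop := fun x y => x ∈ S ∧ y ∈ S ∧ r x y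

/-- `S` induces an acyclic subdigraph. -/
def Acy (r : V → V → Prop) (S : Set V) : Prop := ∀ v, ¬ TransGen (InR r S) v v

/-- `S` induces a strong subdigraph. -/
def Str (r : V → V → Prop) (S : Set V) : Prop :=
  ∀ x ∈ S, ∀ y ∈ S, ReflTransGen (InR r S) x y

/-- Arc with a direction sign. -/
def Arc (r : V → V → Prop) : Bool → V → V → Prop
  | true => r
  | false => fun u v => r v u

/-- Subdivided oriented path with sign pattern; `X` is the set of vertices after the start. -/
inductive SP (r : V → V → Prop) : List Bool → V → Set V → V → Prop
  | nil (u : V) : SP r [] u ∅ u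
  | new {b : Bool} {σ : List Bool} {u w v : V} {X : Set V} :
      Arc r b u w → w ∉ X → SP r σ w X v → SP r (b :: σ) u (insert w X) v
  | ext {b : Bool} {σ : List Bool} {u w v : V} {X : Set V} :
      Arc r b u w → w ∉ X → SP r (b :: σ) w X v → SP r (b :: σ) u (insert w X) v

variable {r : V → V → Prop}

theorem Acy.mono {S T : Set V} (h : Acy r T) (hST : S ⊆ T) : Acy r S := by
  intro v hv
  exact h v (TransGen.mono (fun x y hxy => ⟨hST hxy.1, hST hxy.2.1, hxy.2.2⟩) v v hv)

theorem acy_empty : Acy r (∅ : Set V) := by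
  intro v hv
  obtain ⟨b, h, _⟩ := TransGen.tail'_iff.1 hv
  rcases h.cases_head with h | ⟨c, h, _⟩
  · subst h; rename_i h2; exact h2.1
  · exact h.1

theorem acy_singleton (hl : ∀ v, ¬ r v v) (a : V) : Acy r ({a} : Set V) := by
  intro v hv
  obtain ⟨b, h, _⟩ := TransGen.head'_iff.1 hv
  have h1 : v = a := h.1
  have h2 : b = a := h.2.1
  have := h.2.2
  rw [h1, h2] at this
  exact hl a this

/-- splitting: no arcs from `X ∩ P` to `X \ P`. -/
theorem acy_split1 {X : Set V} (P : Set V) (h1 : Acy r (X ∩ P)) (h2 : Acy r (X \ P))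
    (h : ∀ x ∈ X, x ∈ P → ∀ y ∈ X, y ∉ P → ¬ r x y) : Acy r X := by
  have A : ∀ a b, a ∈ P → TransGen (InR r X) a b → b ∈ P ∧ TransGen (InR r (X ∩ P)) a b := by
    intro a b ha hab
    induction hab with
    | @single b hab =>
      have : b ∈ P := by
        by_contra hb; exact h _ hab.1 ha _ hab.2.1 hb hab.2.2
      exact ⟨this, TransGen.single ⟨⟨hab.1, ha⟩, ⟨hab.2.1, this⟩, hab.2.2⟩⟩
    | @tail b c _ hbc ih =>
      have : c ∈ P := by
        by_contra hb; exact h _ hbc.1 ih.1 _ hbc.2.1 hb hbc.2.2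
      exact ⟨this, ih.2.tail ⟨⟨hbc.1, ih.1⟩, ⟨hbc.2.1, this⟩, hbc.2.2⟩⟩
  have B : ∀ a b, b ∉ P → TransGen (InR r X) a b → a ∉ P ∧ TransGen (InR r (X \ P)) a b := by
    intro a b hb hab
    induction hab using TransGen.head_induction_on with
    | @single a hab =>
      have : a ∉ P := by
        intro ha; exact h _ hab.1 ha _ hab.2.1 hb hab.2.2
      exact ⟨this, TransGen.single ⟨⟨hab.1, this⟩, ⟨hab.2.1, hb⟩, hab.2.2⟩⟩
    | @head a c hac _ ih =>
      have : a ∉ P := by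
        intro ha; exact h _ hac.1 ha _ hac.2.1 ih.1 hac.2.2
      exact ⟨this, ih.2.head ⟨⟨hac.1, this⟩, ⟨hac.2.1, ih.1⟩, hac.2.2⟩⟩
  intro v hv
  by_cases hvP : v ∈ P
  · exact h1 v (A v v hvP hv).2
  · exact h2 v (B v v hvP hv).2

theorem acy_split2 {X : Set V} (P : Set V) (h1 : Acy r (X ∩ P)) (h2 : Acy r (X \ P))
    (h : ∀ x ∈ X, x ∈ P → ∀ y ∈ X, y ∉ P → ¬ r y x) : Acy r X := by
  apply acy_split1 Pᶜ
  · exact h2.mono (fun x hx => ⟨hx.1, hx.2⟩)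
  · exact h1.mono (fun x hx => ⟨hx.1, by simpa using hx.2⟩)
  · intro x hx hxP y hy hyP
    exact h y hy (by simpa using hyP) x hx hxP

theorem acy_split_arc {X : Set V} (b : Bool) (P : Set V) (h1 : Acy r (X ∩ P))
    (h2 : Acy r (X \ P))
    (h : (∀ x ∈ X, x ∈ P → ∀ y ∈ X, y ∉ P → ¬ Arc r b x y) ∨
      (∀ x ∈ X, x ∈ P → ∀ y ∈ X, y ∉ P → ¬ Arc r b y x)) : Acy r X := by
  cases b
  · rcases h with h | h
    · exact acy_split2 P h1 h2 h
    · exact acy_split1 P h1 h2 h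
  · rcases h with h | h
    · exact acy_split1 P h1 h2 h
    · exact acy_split2 P h1 h2 h


theorem sp_nil {u v : V} {X : Set V} (h : SP r [] u X v) : u = v ∧ X = ∅ := by
  cases h; exact ⟨rfl, rfl⟩

theorem SP.append {σ τ : List Bool} {u v w : V} {X Y : Set V} (h : SP r σ u X v)
    (h' : SP r τ v Y w) (hd : Disjoint X Y) : SP r (σ ++ τ) u (X ∪ Y) w := by
  induction h with
  | nil u => simpa using h'
  | new ha hw _ ih =>
    rw [Set.insert_union]
    rw [Set.disjoint_insert_left] at hd
    exact SP.new ha (by simp [hw, hd.1]) (ih h' hd.2)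
  | ext ha hw _ ih =>
    rw [Set.insert_union]
    rw [Set.disjoint_insert_left] at hd
    exact SP.ext ha (by simp [hw, hd.1]) (ih h' hd.2)

theorem SP.merge {σ : List Bool} {b : Bool} {u v : V} {X : Set V}
    (h : SP r (b :: b :: σ) u X v) : SP r (b :: σ) u X v := by
  generalize hl : b :: b :: σ = l at h
  induction h with
  | nil u => cases hl
  | new ha hw h ih =>
    cases hl
    exact SP.ext ha hw h
  | ext ha hw h ih =>
    cases hl
    exact SP.ext ha hw (ih rfl)

theorem SP.rep {σ : List Bool} {b : Bool} {u v : V} {X : Set V} (j : ℕ)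
    (h : SP r (b :: (List.replicate j b ++ σ)) u X v) : SP r (b :: σ) u X v := by
  induction j with
  | zero => simpa using h
  | succ j ih =>
    apply ih
    rw [List.replicate_succ, List.cons_append] at h
    exact h.merge

theorem sp_suffix {b : Bool} {x z y : V} {X : Set V} (h : SP r [b] z X y) (hx : x ∈ X) :
    x = y ∨ ∃ X', X' ⊆ X ∧ x ∉ X' ∧ SP r [b] x X' y := by
  generalize hl : [b] = l at h
  induction h with
  | nil u => cases hl
  | new ha hw h ih =>
    cases hl
    obtain ⟨rfl, rfl⟩ := sp_nil h
    left; simpa using hx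
  | ext ha hw h ih =>
    cases hl
    rcases hx with rfl | hx
    · right; exact ⟨_, Set.subset_insert _ _, hw, h⟩
    · rcases ih hx rfl with h | ⟨X', h1, h2, h3⟩
      · exact Or.inl h
      · right; exact ⟨X', h1.trans (Set.subset_insert _ _), h2, h3⟩

theorem dp {b : Bool} {T : Set V} {x y : V} (h : ReflTransGen (InR (Arc r b) T) x y)
    (hxy : x ≠ y) : ∃ X, X ⊆ T ∧ x ∉ X ∧ SP r [b] x X y := by
  induction h using ReflTransGen.head_induction_on with
  | refl => exact absurd rfl hxy
  | @head x z hxz _ ih =>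
    by_cases hzy : z = y
    · subst hzy
      refine ⟨insert z ∅, ?_, ?_, SP.new hxz.2.2 (by simp) (SP.nil z)⟩
      · intro t ht
        have : t = z := by simpa using ht
        rw [this]; exact hxz.2.1
      · simpa using hxy
    · obtain ⟨X, hX, hzX, hsp⟩ := ih hzy
      by_cases hxX : x ∈ X
      · rcases sp_suffix hsp hxX with h | ⟨X', h1, h2, h3⟩
        · exact absurd h hxy
        · exact ⟨X', h1.trans hX, h2, h3⟩
      · by_cases hxz' : x = z
        · subst hxz'; exact ⟨X, hX, hzX, hsp⟩
        · refine ⟨insert z X, ?_, ?_, SP.ext hxz.2.2 hzX hsp⟩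
          · intro t ht
            rcases ht with rfl | ht
            · exact hxz.2.1
            · exact hX ht
          · simp [hxz', hxX]

theorem rtg_flip {T : Set V} {x y : V} {b : Bool}
    (h : ReflTransGen (InR (Arc r b) T) x y) : ReflTransGen (InR (Arc r (!b)) T) y x := by
  induction h with
  | refl => exact ReflTransGen.refl
  | tail _ hbc ih =>
    refine ReflTransGen.head ⟨hbc.2.1, hbc.1, ?_⟩ ih
    have := hbc.2.2
    cases b <;> exact this

theorem str_arc {S : Set V} (h : Str r S) (b : Bool) {x y : V} (hx : x ∈ S) (hy : y ∈ S) :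
    ReflTransGen (InR (Arc r b) S) x y := by
  cases b
  · have := h y hy x hx
    exact rtg_flip (b := true) this
  · exact h x hx y hy


def Val {C : Type} (r : V → V → Prop) (S : Set V) (φ : V → C) : Prop :=
  ∀ i, Acy r {v | v ∈ S ∧ φ v = i}

def Col (r : V → V → Prop) (c : ℕ) (S : Set V) : Prop :=
  ∃ φ : V → ℕ, (∀ v ∈ S, φ v < c) ∧ Val r S φ

theorem col_insert (hl : ∀ v, ¬ r v v) {S : Set V} {φ : V → ℕ} (h : Val r S φ) {y : V}
    (hy : y ∉ S) (i : ℕ) (τ : Bool) (hi : ∀ m ∈ S, φ m = i → ¬ Arc r τ m y) {c : ℕ}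
    (hc : ∀ v ∈ S, φ v < c) (hic : i < c) : Col r c (insert y S) := by
  classical
  have hupd : ∀ v ∈ S, Function.update φ y i v = φ v := by
    intro v hv
    rw [Function.update_of_ne]
    rintro rfl; exact hy hv
  refine ⟨Function.update φ y i, ?_, ?_⟩
  · rintro v (rfl | hv)
    · simpa using hic
    · rw [hupd v hv]; exact hc v hv
  · intro j
    apply acy_split_arc τ {y}
    · exact (acy_singleton hl y).mono (fun x hx => hx.2)
    · apply (h j).mono
      rintro x ⟨⟨hx | hx, hxj⟩, hx2⟩
      · exact absurd hx hx2
      · rw [hupd x hx] at hxj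
        exact ⟨hx, hxj⟩
    · right
      rintro x ⟨hx, hxj⟩ hxy z ⟨hz, hzj⟩ hzy
      have hxy : x = y := hxy
      subst hxy
      rcases hz with hz | hz
      · exact absurd hz hzy
      · rw [hupd z hz] at hzj
        rw [Function.update_self] at hxj
        exact hi z hz (hzj.trans hxj.symm)


theorem pass2 (hl : ∀ v, ¬ r v v) {S : Set V} (hS : Str r S) (hcol : Col r 2 S) {x y : V}
    (hy : y ∉ S) (hn : ¬ Col r 2 (insert y S)) (hx : x ∈ S) (b τ : Bool) :
    ∃ m ∈ S, Arc r τ m y ∧ ∃ X, X ⊆ S ∧ x ∉ X ∧ SP r [b] x X m := by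
  by_cases hm : ∃ m ∈ S, m ≠ x ∧ Arc r τ m y
  · obtain ⟨m, hm, hmx, ha⟩ := hm
    exact ⟨m, hm, ha, dp (str_arc hS b hx hm) (Ne.symm hmx)⟩
  · exfalso
    push Not at hm
    obtain ⟨φ, hφ, hv⟩ := hcol
    apply hn
    apply col_insert hl hv hy (if φ x = 0 then 1 else 0) τ _ hφ
    · split_ifs <;> omega
    · intro m hmS hmi
      apply hm m hmS
      rintro rfl
      split_ifs at hmi <;> omega

/-- vertices reachable from `x` inside `S` avoiding `m` -/
def Rx (e : V → V → Prop) (S : Set V) (x m : V) : Set V :=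
  {v | ReflTransGen (InR e (S \ {m})) x v}

theorem rx_sub {e : V → V → Prop} {S : Set V} {x m v : V} (hx : x ∈ S) (hxm : x ≠ m)
    (h : v ∈ Rx e S x m) : v ∈ S ∧ v ≠ m := by
  induction h with
  | refl => exact ⟨hx, hxm⟩
  | tail _ hbc _ => exact hbc.2.1

theorem rx_in {e : V → V → Prop} {S : Set V} {x m v : V}
    (h : v ∈ Rx e S x m) : ReflTransGen (InR e (Rx e S x m)) x v := by
  induction h with
  | refl => exact ReflTransGen.refl
  | tail hab hbc ih => exact ih.tail ⟨hab, hab.tail hbc, hbc.2.2⟩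

theorem rx_arc {e : V → V → Prop} {S : Set V} {x m u v : V} (hx : x ∈ S) (hxm : x ≠ m)
    (hu : u ∈ Rx e S x m) (hv : v ∈ S) (hv' : v ∉ Rx e S x m) (he : e u v) : v = m := by
  by_contra hvm
  exact hv' (ReflTransGen.tail hu ⟨rx_sub hx hxm hu, ⟨hv, hvm⟩, he⟩)

theorem rx_mono {e : V → V → Prop} {S : Set V} {x m m' : V} (hx : x ∈ S) (hxm : x ≠ m)
    (hm' : m' ∉ Rx e S x m) : Rx e S x m ⊆ Rx e S x m' := by
  intro v hv
  refine ReflTransGen.mono (fun a b hab => ⟨⟨(rx_sub hx hxm hab.1).1, ?_⟩,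
    ⟨(rx_sub hx hxm hab.2.1).1, ?_⟩, hab.2.2⟩) _ _ (rx_in hv)
  · rintro rfl; exact hm' hab.1
  · rintro rfl; exact hm' hab.2.1

theorem rx_dom {e : V → V → Prop} {S : Set V} {x m v : V} (hx : x ∈ S) (hxm : x ≠ m)
    (h : ReflTransGen (InR e S) x v) (hv : v ∉ Rx e S x m) :
    ReflTransGen (InR e (S \ Rx e S x m)) m v := by
  induction h with
  | refl => exact absurd ReflTransGen.refl hv
  | @tail b c _ hbc ih =>
    by_cases hb : b ∈ Rx e S x m
    · rw [rx_arc hx hxm hb hbc.2.1 hv hbc.2.2]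
    · exact (ih hb).tail ⟨⟨hbc.1, hb⟩, ⟨hbc.2.1, hv⟩, hbc.2.2⟩

theorem rx_enter {e : V → V → Prop} {S : Set V} {x m v : V} (hx : x ∈ S) (hxm : x ≠ m)
    (h : ReflTransGen (InR e S) x v) : v ∈ Rx e S x m ∨ ∃ u ∈ Rx e S x m, e u m := by
  induction h with
  | refl => exact Or.inl ReflTransGen.refl
  | @tail b c _ hbc ih =>
    rcases ih with hb | h
    · by_cases hc : c ∈ Rx e S x m
      · exact Or.inl hc
      · right
        refine ⟨b, hb, ?_⟩
        have := rx_arc hx hxm hb hbc.2.1 hc hbc.2.2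
        rw [← this]; exact hbc.2.2
    · exact Or.inr h

theorem rx_other {e : V → V → Prop} {S : Set V} {x m m' : V} (hx : x ∈ S) (hxm : x ≠ m)
    (hm : m ∈ S) (hr : ReflTransGen (InR e S) x m)
    (hm' : m' ∉ Rx e S x m) (hne : m ≠ m') (hxm' : x ≠ m') : m ∈ Rx e S x m' := by
  rcases rx_enter hx hxm hr with h | ⟨u, hu, he⟩
  · exact absurd rfl (rx_sub hx hxm h).2
  · have := rx_mono hx hxm hm' hu
    exact ReflTransGen.tail this ⟨rx_sub hx hxm' this, ⟨hm, hne⟩, he⟩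

theorem pass3_recol {S : Set V} (hS : Str r S) {x m : V}
    (hx : x ∈ S) (hm : m ∈ S) (hxm : x ≠ m) (b1 b2 : Bool)
    (H : ∀ X, X ⊆ S → x ∉ X → ¬ SP r [b1, b2] x X m)
    {φ : V → ℕ} (h3 : ∀ v ∈ S, φ v < 3) (hv : Val r S φ) (hφx : φ x = 0) :
    ∃ φ' : V → ℕ, (∀ v ∈ S, φ' v < 3) ∧ Val r S φ' ∧ φ' x = 0 ∧ φ' m = 1 ∧
      ∀ v ∈ Rx (Arc r b1) S x m, φ' v = φ v := by
  classical
  set R := Rx (Arc r b1) S x m with hR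
  have hxR : x ∈ R := ReflTransGen.refl
  have hmR : m ∉ R := fun h => (rx_sub hx hxm h).2 rfl
  refine ⟨fun v => if v ∈ R then φ v else Equiv.swap (φ m) 1 (φ v), ?_, ?_, ?_, ?_, ?_⟩
  · intro v hv
    have h1 := h3 v hv
    have h2 := h3 m hm
    dsimp only
    split_ifs
    · exact h1
    · rw [Equiv.swap_apply_def]; split_ifs <;> omega
  · intro j
    apply acy_split_arc b1 R
    · apply (hv j).mono
      rintro v ⟨⟨hvS, hvj⟩, hvR⟩
      simp only [hvR, if_true] at hvj
      exact ⟨hvS, hvj⟩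
    · apply (hv (Equiv.swap (φ m) 1 j)).mono
      rintro v ⟨⟨hvS, hvj⟩, hvR⟩
      simp only [hvR, if_false] at hvj
      refine ⟨hvS, ?_⟩
      rw [← hvj, Equiv.swap_apply_self]
    · by_cases hj : j = 1
      · subst hj
        by_cases hb : b2 = b1
        · subst hb
          left
          rintro u ⟨huS, huj⟩ huR v ⟨hvS, hvj⟩ hvR ha
          have hvm := rx_arc hx hxm huR hvS hvR ha
          subst hvm
          by_cases hux : u = x
          · subst hux
            simp only [huR, if_true] at huj
            omega
          · obtain ⟨X, hX, hxX, hsp⟩ := dp huR (Ne.symm hux)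
            refine H (X ∪ {v}) ?_ ?_ (SP.append hsp (τ := [b2]) (Y := {v}) ?_ ?_)
            · rintro w (hw | hw)
              · exact (hX hw).1
              · rw [hw]; exact hm
            · simp [hxX, hxm]
            · have := SP.new ha (Set.notMem_empty v) (SP.nil v)
              simpa using this
            · rw [Set.disjoint_singleton_right]
              exact fun h => (hX h).2 rfl
        · have hb : b2 = !b1 := by cases b1 <;> cases b2 <;> simp_all
          right
          rintro u ⟨huS, huj⟩ huR v ⟨hvS, hvj⟩ hvR ha
          have hux : u ≠ x := by
            rintro rfl
            simp only [huR, if_true] at huj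
            omega
          obtain ⟨X, hX, hxX, hsp⟩ := dp (rx_in huR) (Ne.symm hux)
          have hmv := rtg_flip (rx_dom hx hxm (str_arc hS b1 hx hvS) hvR)
          rw [← hb] at hmv
          have ha' : Arc r b2 u v := by
            rw [hb]; cases b1 <;> exact ha
          have hum : ReflTransGen (InR (Arc r b2) (insert u (S \ R))) u m := by
            refine ReflTransGen.head ⟨Set.mem_insert _ _, Set.mem_insert_of_mem _ ⟨hvS, hvR⟩, ha'⟩ ?_
            exact ReflTransGen.mono (fun a b h => ⟨Set.mem_insert_of_mem _ h.1,
              Set.mem_insert_of_mem _ h.2.1, h.2.2⟩) _ _ hmv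
          obtain ⟨Y, hY, huY, hsp'⟩ := dp hum (rx_sub hx hxm huR).2
          have hYD : ∀ w ∈ Y, w ∈ S ∧ w ∉ R := by
            intro w hw
            rcases hY hw with h | h
            · subst h; exact absurd hw huY
            · exact h
          refine H (X ∪ Y) ?_ ?_ (SP.append hsp hsp' ?_)
          · rintro w (hw | hw)
            · exact (rx_sub hx hxm (hX hw)).1
            · exact (hYD w hw).1
          · rintro (h | h)
            · exact hxX h
            · exact (hYD x h).2 hxR
          · rw [Set.disjoint_left]
            intro w hw hw'
            exact (hYD w hw').2 (hX hw)
      · left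
        rintro u ⟨huS, huj⟩ huR v ⟨hvS, hvj⟩ hvR ha
        have hvm := rx_arc hx hxm huR hvS hvR ha
        subst hvm
        simp only [hvR, if_false, Equiv.swap_apply_left] at hvj
        exact hj hvj.symm
  · simp only [hxR, if_true]; exact hφx
  · simp only [hmR, if_false, Equiv.swap_apply_left]
  · intro v hv
    simp only [hv, if_true]

theorem pass3 [Finite V] (hl : ∀ v, ¬ r v v) {S : Set V} (hS : Str r S) (hcol : Col r 3 S)
    {x y : V} (hy : y ∉ S) (hn : ¬ Col r 3 (insert y S)) (hx : x ∈ S) (b1 b2 τ : Bool) :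
    ∃ m ∈ S, Arc r τ m y ∧ ∃ X, X ⊆ S ∧ x ∉ X ∧ SP r [b1, b2] x X m := by
  classical
  by_contra hcon
  push Not at hcon
  let B : (V → ℕ) → Set V := fun φ => {m | m ∈ S ∧ Arc r τ m y ∧ m ≠ x ∧ φ m ≠ 1}
  let D : V → Set V := fun m => S \ Rx (Arc r b1) S x m
  let T : (V → ℕ) → Set V := fun φ => {v | ∃ m ∈ B φ, v ∈ D m}
  have key : ∀ n : ℕ, ∀ φ : V → ℕ, (∀ v ∈ S, φ v < 3) → Val r S φ → φ x = 0 →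
      (T φ).ncard = n → ∃ φ : V → ℕ, (∀ v ∈ S, φ v < 3) ∧ Val r S φ ∧ φ x = 0 ∧ B φ = ∅ := by
    intro n
    induction n using Nat.strong_induction_on with
    | _ n ih =>
    intro φ h3 hv hφx hT
    by_cases hB : B φ = ∅
    · exact ⟨φ, h3, hv, hφx, hB⟩
    obtain ⟨m, hmB, hmax⟩ := Set.exists_max_image (B φ) (fun m => (D m).ncard)
      (Set.toFinite _) (Set.nonempty_iff_ne_empty.2 hB)
    obtain ⟨hm, hma, hmx, hm1⟩ := hmB
    obtain ⟨φ', h3', hv', hφx', hφm', hag⟩ := pass3_recol hS hx hm (Ne.symm hmx) b1 b2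
      (hcon m hm hma) h3 hv hφx
    have hxm : x ≠ m := Ne.symm hmx
    have hmR : m ∉ Rx (Arc r b1) S x m := fun h => (rx_sub hx hxm h).2 rfl
    have hmT : m ∈ T φ := ⟨m, ⟨hm, hma, hmx, hm1⟩, hm, hmR⟩
    refine ih _ ?_ φ' h3' hv' hφx' rfl
    rw [← hT]
    apply Set.ncard_lt_ncard _ (Set.toFinite _)
    have hsub : ∀ v ∈ T φ', v ∈ T φ ∧ v ≠ m := by
      rintro v ⟨m', ⟨hm', hma', hmx', hm1'⟩, hvD⟩
      have hmm' : m ≠ m' := by rintro rfl; exact hm1' hφm'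
      by_cases hR : m' ∈ Rx (Arc r b1) S x m
      · have hb : m' ∈ B φ := ⟨hm', hma', hmx', by rw [← hag m' hR]; exact hm1'⟩
        refine ⟨⟨m', hb, hvD⟩, ?_⟩
        rintro rfl
        have h1 : D v ⊂ D m' := by
          refine Set.ssubset_iff_subset_ne.2 ⟨?_, ?_⟩
          · intro w hw
            exact ⟨hw.1, fun h => hw.2 (rx_mono hx (Ne.symm hmx') hvD.2 h)⟩
          · intro h
            have : m' ∈ D m' := ⟨hm', fun h => (rx_sub hx (Ne.symm hmx') h).2 rfl⟩
            rw [← h] at this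
            exact this.2 hR
        have := Set.ncard_lt_ncard h1 (Set.toFinite _)
        have := hmax m' hb
        omega
      · refine ⟨⟨m, ⟨hm, hma, hmx, hm1⟩, hvD.1, fun h => hvD.2 (rx_mono hx hxm hR h)⟩, ?_⟩
        rintro rfl
        exact hvD.2 (rx_other hx hxm hm (str_arc hS b1 hx hm) hR hmm' (Ne.symm hmx'))
    refine Set.ssubset_iff_subset_ne.2 ⟨fun v hv => (hsub v hv).1, ?_⟩
    intro h
    rw [← h] at hmT
    exact (hsub m hmT).2 rfl
  obtain ⟨φ0, h30, hv0⟩ := hcol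
  have hsw : ∃ φ : V → ℕ, (∀ v ∈ S, φ v < 3) ∧ Val r S φ ∧ φ x = 0 := by
    refine ⟨fun v => Equiv.swap (φ0 x) 0 (φ0 v), ?_, ?_, ?_⟩
    · intro v hv
      have h1 := h30 v hv
      have h2 := h30 x hx
      dsimp only
      rw [Equiv.swap_apply_def]; split_ifs <;> omega
    · intro j
      apply (hv0 (Equiv.swap (φ0 x) 0 j)).mono
      rintro v ⟨hvS, hvj⟩
      refine ⟨hvS, ?_⟩
      rw [← hvj, Equiv.swap_apply_self]
    · simp
  obtain ⟨φ1, h31, hv1, hx1⟩ := hsw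
  obtain ⟨φ, h3, hv, hφx, hB⟩ := key _ φ1 h31 hv1 hx1 rfl
  apply hn
  apply col_insert hl hv hy 2 τ _ h3 (by norm_num)
  intro m hm hm2 ha
  have : m ∈ B φ := by
    refine ⟨hm, ha, ?_, by omega⟩
    rintro rfl; omega
  rw [hB] at this
  exact this

theorem pass [Finite V] (hl : ∀ v, ¬ r v v) {S : Set V} {c : ℕ} (hc : c = 2 ∨ c = 3)
    (hS : Str r S) (hcol : Col r c S)
    {x y : V} (hy : y ∉ S) (hn : ¬ Col r c (insert y S)) (hx : x ∈ S) (σ : List Bool)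
    (hσ : σ.length + 1 = c) (τ : Bool) :
    ∃ m ∈ S, Arc r τ m y ∧ ∃ X, X ⊆ S ∧ x ∉ X ∧ SP r σ x X m := by
  rcases hc with rfl | rfl
  · obtain ⟨b, rfl⟩ : ∃ b, σ = [b] := List.length_eq_one_iff.1 (by omega)
    exact pass2 hl hS hcol hy hn hx b τ
  · obtain ⟨b, b', rfl⟩ : ∃ b b', σ = [b, b'] := List.length_eq_two.1 (by omega)
    exact pass3 hl hS hcol hy hn hx b b' τ


def BA (r : V → V → Prop) (y : V) (S : Set V) : Prop := (∃ s ∈ S, r y s) ∧ (∃ s ∈ S, r s y)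

theorem BA.to {y : V} {S : Set V} (h : BA r y S) (b : Bool) : ∃ s ∈ S, Arc r b y s := by
  cases b
  · exact h.2
  · exact h.1

theorem BA.from {y : V} {S : Set V} (h : BA r y S) (b : Bool) : ∃ s ∈ S, Arc r b s y := by
  cases b
  · exact h.1
  · exact h.2

def Root (r : V → V → Prop) (σ : List Bool) (y : V) (B : Set V) : Prop :=
  ∃ X, X ⊆ insert y B ∧ SP r σ y X y

theorem Root.mono {σ : List Bool} {y : V} {B B' : Set V} (h : Root r σ y B) (hB : B ⊆ B') :
    Root r σ y B' := by
  obtain ⟨X, h1, h2⟩ := h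
  exact ⟨X, h1.trans (Set.insert_subset_insert hB), h2⟩

/-- union of the clusters of a stack -/
def UU : List (Set V × V) → Set V
  | [] => ∅
  | a :: t => a.1 ∪ UU t

/-- `y` is linked to the top cluster. -/
def Lk (r : V → V → Prop) (c : ℕ → ℕ) (y : V) : List (Set V × V) → Prop
  | [] => True
  | a :: t => ¬ Col r (c t.length) (insert y a.1)

def WF (r : V → V → Prop) (c : ℕ → ℕ) : List (Set V × V) → Prop
  | [] => True
  | a :: t => a.2 ∈ a.1 ∧ Str r a.1 ∧ Col r (c t.length) a.1 ∧ Disjoint a.1 (UU t) ∧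
      Lk r c a.2 t ∧ WF r c t

def At : List (Set V × V) → ℕ → Set V → Prop
  | [], _, _ => False
  | a :: t, i, T => (i = t.length ∧ T = a.1) ∨ At t i T

theorem at_lt {st : List (Set V × V)} {i : ℕ} {T : Set V} (h : At st i T) : i < st.length := by
  induction st with
  | nil => exact h.elim
  | cons a t ih =>
    rcases h with h | h
    · simp [h.1]
    · have := ih h
      simp; omega

theorem at_sub {st : List (Set V × V)} {i : ℕ} {T : Set V} (h : At st i T) : T ⊆ UU st := by
  induction st with
  | nil => exact h.elim
  | cons a t ih =>
    rcases h with h | h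
    · rw [h.2]; exact Set.subset_union_left
    · exact (ih h).trans Set.subset_union_right

theorem sp_one {b : Bool} {u v : V} (h : Arc r b u v) : SP r [b] u {v} v := by
  have := SP.new h (Set.notMem_empty v) (SP.nil v)
  simpa using this

theorem top_pass [Finite V] (hl : ∀ v, ¬ r v v) {S : Set V} {c : ℕ} (hc : c = 2 ∨ c = 3)
    (hS : Str r S) (hcol : Col r c S)
    {x y : V} (hy : y ∉ S) (hn : ¬ Col r c (insert y S)) (hx : x ∈ S) (σ : List Bool)
    (hσ : σ.length = c) : ∃ X, X ⊆ insert y S ∧ x ∉ X ∧ SP r σ x X y := by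
  rcases List.eq_nil_or_concat σ with rfl | ⟨σ0, τ, rfl⟩
  · simp at hσ; omega
  simp only [List.concat_eq_append, List.length_append, List.length_singleton] at hσ ⊢
  obtain ⟨m, hm, ha, X, hX, hxX, hsp⟩ := pass hl hc hS hcol hy hn hx σ0 hσ τ
  refine ⟨X ∪ {y}, ?_, ?_, hsp.append (sp_one ha) ?_⟩
  · rintro v (hv | hv)
    · exact Or.inr (hX hv)
    · exact Or.inl hv
  · rintro (hv | hv)
    · exact hxX hv
    · rw [Set.mem_singleton_iff] at hv
      subst hv; exact hy hx
  · rw [Set.disjoint_singleton_right]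
    exact fun h => hy (hX h)

theorem up [Finite V] (hl : ∀ v, ¬ r v v) {c : ℕ → ℕ} (hc : ∀ p, c p = 2 ∨ c p = 3)
    (st : List (Set V × V)) : WF r c st → ∀ (i : ℕ) (S : Set V) (x y : V) (σ : List Bool),
    At st i S → x ∈ S → y ∉ UU st → Lk r c y st →
    σ.length = ∑ j ∈ Finset.Ico i st.length, c j →
    ∃ X, X ⊆ insert y (UU st) ∧ x ∉ X ∧ SP r σ x X y := by
  induction st with
  | nil => intro _ i S x y σ h; exact h.elim
  | cons a t ih =>
    obtain ⟨T, w⟩ := a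
    rintro ⟨hw, hS, hcol, hdis, hlk, hwf⟩ i S x y σ hat hx hy hly hlen
    have hyT : y ∉ T := fun h => hy (Or.inl h)
    simp only [List.length_cons] at hlen
    rcases hat with ⟨rfl, rfl⟩ | hat
    · rw [Finset.sum_Ico_succ_top le_rfl, Finset.Ico_self, Finset.sum_empty, zero_add] at hlen
      obtain ⟨X, hX, hxX, hsp⟩ := top_pass hl (hc _) hS hcol hyT hly hx σ hlen
      refine ⟨X, hX.trans (Set.insert_subset_insert Set.subset_union_left), hxX, hsp⟩
    · have hit := at_lt hat
      rw [Finset.sum_Ico_succ_top hit.le] at hlen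
      set n := ∑ j ∈ Finset.Ico i t.length, c j with hn
      have e : σ = σ.take n ++ σ.drop n := (List.take_append_drop n σ).symm
      have hwU : w ∉ UU t := fun h => Set.disjoint_left.1 hdis hw h
      obtain ⟨X1, hX1, hxX1, hsp1⟩ := ih hwf i S x w (σ.take n) hat hx hwU hlk
        (by rw [List.length_take]; omega)
      obtain ⟨X2, hX2, hwX2, hsp2⟩ := top_pass hl (hc _) hS hcol hyT hly hw (σ.drop n)
        (by rw [List.length_drop]; omega)
      have hxU : x ∈ UU t := at_sub hat hx
      rw [e]
      refine ⟨X1 ∪ X2, ?_, ?_, hsp1.append hsp2 ?_⟩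
      · rintro v (hv | hv)
        · rcases hX1 hv with h | h
          · rw [h]; exact Or.inr (Or.inl hw)
          · exact Or.inr (Or.inr h)
        · rcases hX2 hv with h | h
          · exact Or.inl h
          · exact Or.inr (Or.inl h)
      · rintro (hv | hv)
        · exact hxX1 hv
        · rcases hX2 hv with h | h
          · subst h; exact hy (Or.inr hxU)
          · exact Set.disjoint_left.1 hdis h hxU
      · rw [Set.disjoint_left]
        intro v hv hv2
        rcases hX1 hv with h | h
        · subst h; exact hwX2 hv2
        · rcases hX2 hv2 with h' | h'
          · subst h'; exact hy (Or.inr h)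
          · exact Set.disjoint_left.1 hdis h' h

theorem root_tight [Finite V] (hl : ∀ v, ¬ r v v) {c : ℕ → ℕ} (hc : ∀ p, c p = 2 ∨ c p = 3)
    {st : List (Set V × V)} (hwf : WF r c st) {i : ℕ} {S : Set V} {y : V} {σ : List Bool}
    (hat : At st i S) (hba : BA r y S) (hy : y ∉ UU st) (hly : Lk r c y st) {k : ℕ}
    (hσ : σ.length = k + 1) (hk : k ≤ ∑ j ∈ Finset.Ico i st.length, c j) :
    Root r σ y (UU st) := by
  cases σ with
  | nil => simp at hσ
  | cons s σ' =>
    obtain ⟨x, hx, ha⟩ := hba.to s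
    obtain ⟨X, hX, hxX, hsp⟩ := up hl hc st hwf i S x y
      (List.replicate (∑ j ∈ Finset.Ico i st.length, c j - k) s ++ σ') hat hx hy hly
      (by simp at hσ ⊢; omega)
    refine ⟨insert x X, ?_, SP.rep _ (SP.new ha hxX hsp)⟩
    rintro v (rfl | hv)
    · exact Or.inr (at_sub hat hx)
    · exact hX hv

theorem root_nontight [Finite V] (hl : ∀ v, ¬ r v v) {c : ℕ → ℕ}
    (hc : ∀ p, c p = 2 ∨ c p = 3) {T : Set V} {w : V}
    {st : List (Set V × V)} (hwf : WF r c ((T, w) :: st)) {i : ℕ} {S : Set V} {y : V}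
    {σ : List Bool} (hat : At st i S) (hba : BA r y S) (hy : y ∉ UU ((T, w) :: st))
    (hbT : BA r y T) {k : ℕ} (hk1 : 1 ≤ k)
    (hσ : σ.length = k + 1) (hk : k ≤ ∑ j ∈ Finset.Ico i st.length, c j) :
    Root r σ y (UU ((T, w) :: st)) := by
  obtain ⟨hw, hS, hcol, hdis, hlk, hwf⟩ := hwf
  dsimp only at hw hS hcol hdis hlk
  have hyT : y ∉ T := fun h => hy (Or.inl h)
  cases σ with
  | nil => simp at hσ
  | cons s σ' =>
    rcases List.eq_nil_or_concat σ' with rfl | ⟨σ0, τ, rfl⟩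
    · simp at hσ; omega
    simp only [List.concat_eq_append, List.length_append,
      List.length_cons] at hσ ⊢
    obtain ⟨x, hx, ha⟩ := hba.to s
    have hwU : w ∉ UU st := fun h => Set.disjoint_left.1 hdis hw h
    obtain ⟨X, hX, hxX, hsp⟩ := up hl hc st hwf i S x w
      (List.replicate (∑ j ∈ Finset.Ico i st.length, c j - (k - 1)) s ++ σ0) hat hx hwU hlk
      (by simp at hσ ⊢; omega)
    have hY : ∃ Y, Y ⊆ insert y T ∧ w ∉ Y ∧ SP r [τ] w Y y := by
      obtain ⟨u, hu, hau⟩ := hbT.from τ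
      have hwy : w ≠ y := by rintro rfl; exact hyT hw
      by_cases huw : u = w
      · subst huw
        exact ⟨{y}, by simp, by simpa using hwy, sp_one hau⟩
      · obtain ⟨Y, hY, hwY, hsY⟩ := dp (str_arc hS τ hw hu) (Ne.symm huw)
        refine ⟨Y ∪ {y}, ?_, ?_, SP.merge (hsY.append (sp_one hau) ?_)⟩
        · rintro v (hv | hv)
          · exact Or.inr (hY hv)
          · exact Or.inl hv
        · simp [hwY, hwy]
        · rw [Set.disjoint_singleton_right]
          exact fun h => hyT (hY h)
    obtain ⟨Y, hY, hwY, hsY⟩ := hY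
    have hxU : x ∈ UU st := at_sub hat hx
    refine ⟨insert x (X ∪ Y), ?_, SP.rep (∑ j ∈ Finset.Ico i st.length, c j - (k - 1)) ?_⟩
    · rintro v (rfl | hv | hv)
      · exact Or.inr (Or.inr hxU)
      · rcases hX hv with h | h
        · rw [h]; exact Or.inr (Or.inl hw)
        · exact Or.inr (Or.inr h)
      · rcases hY hv with h | h
        · exact Or.inl h
        · exact Or.inr (Or.inl h)
    · rw [← List.append_assoc]
      refine SP.new ha ?_ (hsp.append hsY ?_)
      · rintro (h | h)
        · exact hxX h
        · rcases hY h with h | h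
          · subst h; exact hy (Or.inr hxU)
          · exact Set.disjoint_left.1 hdis h hxU
      · rw [Set.disjoint_left]
        intro v hv hv2
        rcases hX hv with h | h
        · subst h; exact hwY hv2
        · rcases hY hv2 with h' | h'
          · subst h'; exact hy (Or.inr h)
          · exact Set.disjoint_left.1 hdis h' h


def cc (k p : ℕ) : ℕ := if k % 2 = 1 ∧ p % (k / 2) = 0 then 3 else 2

theorem cc23 (k p : ℕ) : cc k p = 2 ∨ cc k p = 3 := by
  unfold cc; split_ifs <;> simp

theorem cc_mod (k p : ℕ) : cc k (p % (k / 2)) = cc k p := by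
  unfold cc; rw [Nat.mod_mod]

theorem cc_window (k : ℕ) (hk : 2 ≤ k) (i : ℕ) :
    ∑ j ∈ Finset.Ico i (i + k / 2), cc k j = k := by
  have hq : 1 ≤ k / 2 := by omega
  induction i with
  | zero =>
    obtain ⟨t, ht⟩ : ∃ t, k / 2 = t + 1 := ⟨k / 2 - 1, by omega⟩
    rw [zero_add, Nat.Ico_zero_eq_range]
    have h0 : cc k 0 = 2 + k % 2 := by
      unfold cc
      rw [Nat.zero_mod]
      rcases Nat.mod_two_eq_zero_or_one k with h | h <;> simp [h]
    have h1 : ∀ j ∈ Finset.range t, cc k (j + 1) = 2 := by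
      intro j hj
      unfold cc
      rw [Finset.mem_range] at hj
      rw [Nat.mod_eq_of_lt (by omega : j + 1 < k / 2)]
      simp
    rw [ht, Finset.sum_range_succ', Finset.sum_congr rfl h1, h0]
    simp
    omega
  | succ i ih =>
    have h1 : cc k (i + k / 2) = cc k i := by
      unfold cc; rw [Nat.add_mod_right]
    have h2 := Finset.sum_Ico_succ_top (show i ≤ i + k / 2 by omega) (cc k)
    have h3 := Finset.sum_eq_sum_Ico_succ_bot (show i < i + k / 2 + 1 by omega) (cc k)
    have h4 : i + 1 + k / 2 = i + k / 2 + 1 := by omega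
    rw [h4]
    omega

theorem cc_big (k : ℕ) (hk : 2 ≤ k) {i d : ℕ} (hid : i < d) (hm : i % (k / 2) = d % (k / 2)) :
    k ≤ ∑ j ∈ Finset.Ico i d, cc k j := by
  have h1 : i + k / 2 ≤ d := by
    have hdvd : k / 2 ∣ d - i := (Nat.modEq_iff_dvd' hid.le).1 hm
    have := Nat.le_of_dvd (by omega) hdvd
    omega
  calc k = ∑ j ∈ Finset.Ico i (i + k / 2), cc k j := (cc_window k hk i).symm
    _ ≤ _ := Finset.sum_le_sum_of_subset (Finset.Ico_subset_Ico le_rfl h1)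


def Cl (r : V → V → Prop) (c : ℕ) (M : Set V) (w : V) (S : Set V) : Prop :=
  S ⊆ M ∧ w ∈ S ∧ Str r S ∧ Col r c S

theorem cl_exists [Finite V] (hl : ∀ v, ¬ r v v) {c : ℕ} (hc : 1 ≤ c) {M : Set V} {w : V}
    (hw : w ∈ M) : ∃ S, Cl r c M w S ∧ ∀ S', Cl r c M w S' → S ⊆ S' → S' ⊆ S := by
  have h0 : Cl r c M w {w} := by
    refine ⟨by simpa using hw, by simp, ?_, fun _ => 0, fun _ _ => hc, ?_⟩
    · intro x hx y hy
      rw [Set.mem_singleton_iff] at hx hy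
      rw [hx, hy]
    · intro i
      exact (acy_singleton hl w).mono (fun v hv => hv.1)
  obtain ⟨S, hS, hmax⟩ := Set.exists_max_image {S | Cl r c M w S} Set.ncard (Set.toFinite _)
    ⟨_, h0⟩
  refine ⟨S, hS, fun S' hS' hsub => ?_⟩
  exact (Set.eq_of_subset_of_ncard_le hsub (hmax S' hS') (Set.toFinite _)).symm.subset

theorem str_ext {S T : Set V} (hS : Str r S) (hST : S ⊆ T)
    (h : ∀ t ∈ T, (∃ s ∈ S, ReflTransGen (InR r T) s t) ∧
      ∃ s ∈ S, ReflTransGen (InR r T) t s) : Str r T := by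
  intro x hx y hy
  obtain ⟨_, s, hs, h1⟩ := h x hx
  obtain ⟨⟨s', hs', h2⟩, _⟩ := h y hy
  refine (h1.trans ?_).trans h2
  exact ReflTransGen.mono (fun a b h => ⟨hST h.1, hST h.2.1, h.2.2⟩) _ _ (hS s hs s' hs')

theorem cl_E1 {c : ℕ} {M : Set V} {w : V} {S : Set V} (hS : Cl r c M w S)
    (hmax : ∀ S', Cl r c M w S' → S ⊆ S' → S' ⊆ S) {y : V} (hyM : y ∈ M) (hyS : y ∉ S)
    (hba : BA r y S) : ¬ Col r c (insert y S) := by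
  intro hcol
  obtain ⟨h1, h2, h3, h4⟩ := hS
  refine hyS (hmax (insert y S) ⟨?_, Or.inr h2, ?_, hcol⟩ (Set.subset_insert _ _)
    (Set.mem_insert _ _))
  · exact Set.insert_subset hyM h1
  · apply str_ext h3 (Set.subset_insert _ _)
    rintro t (rfl | ht)
    · obtain ⟨⟨s, hs, ha⟩, ⟨s', hs', ha'⟩⟩ := hba
      exact ⟨⟨s', hs', ReflTransGen.single ⟨Or.inr hs', Or.inl rfl, ha'⟩⟩,
        ⟨s, hs, ReflTransGen.single ⟨Or.inl rfl, Or.inr hs, ha⟩⟩⟩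
    · exact ⟨⟨t, ht, ReflTransGen.refl⟩, ⟨t, ht, ReflTransGen.refl⟩⟩

theorem cl_E2 {c : ℕ} (hc : 2 ≤ c) {M : Set V} {w : V} {S : Set V} (hS : Cl r c M w S)
    (hmax : ∀ S', Cl r c M w S' → S ⊆ S' → S' ⊆ S) {X : Set V} (hXM : X ⊆ M)
    (hXS : ∀ y ∈ X, y ∉ S) (hX : Acy r X) (hba : ∀ y ∈ X, ¬ BA r y S)
    {C : Type} {ψ : V → C} (hψ : Val r S ψ) (γ : C) : Acy r ({v | v ∈ S ∧ ψ v = γ} ∪ X) := by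
  classical
  obtain ⟨h1, h2, h3, h4⟩ := hS
  let X1 : Set V := {y | y ∈ X ∧ ∃ s ∈ S, ∃ x ∈ X, r s x ∧ ReflTransGen (InR r X) x y}
  let X2 : Set V := {y | y ∈ X ∧ ∃ s ∈ S, ∃ x ∈ X, r x s ∧ ReflTransGen (InR r X) y x}
  have hstep1 : ∀ a b, a ∈ X1 → InR r X a b → b ∈ X1 := by
    rintro a b ⟨ha, s, hs, x, hx, hsx, hxa⟩ hab
    exact ⟨hab.2.1, s, hs, x, hx, hsx, hxa.tail hab⟩
  have hstep2 : ∀ a b, b ∈ X2 → InR r X a b → a ∈ X2 := by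
    rintro a b ⟨ha, s, hs, x, hx, hsx, hxa⟩ hab
    exact ⟨hab.1, s, hs, x, hx, hsx, hxa.head hab⟩
  have hP : ∀ y, y ∈ X1 → y ∈ X2 → False := by
    let P : Set V := {y | y ∈ X1 ∧ y ∈ X2}
    have hin : ∀ x y, ReflTransGen (InR r X) x y → x ∈ X1 → y ∈ X2 →
        ReflTransGen (InR r (S ∪ P)) x y ∧ x ∈ X2 ∧ y ∈ X1 := by
      intro x y hxy hx hy
      induction hxy using ReflTransGen.head_induction_on with
      | refl => exact ⟨ReflTransGen.refl, hy, hx⟩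
      | @head a b hab _ ih =>
        have hb1 := hstep1 a b hx hab
        obtain ⟨i1, i2, i3⟩ := ih hb1
        have ha2 := hstep2 a b i2 hab
        exact ⟨ReflTransGen.head ⟨Or.inr ⟨hx, ha2⟩, Or.inr ⟨hb1, i2⟩, hab.2.2⟩ i1, ha2, i3⟩
    have hcl : Cl r c M w (S ∪ P) := by
      refine ⟨?_, Or.inl h2, ?_, ?_⟩
      · rintro v (hv | hv)
        · exact h1 hv
        · exact hXM hv.1.1
      · apply str_ext h3 Set.subset_union_left
        rintro t (ht | ht)
        · exact ⟨⟨t, ht, ReflTransGen.refl⟩, ⟨t, ht, ReflTransGen.refl⟩⟩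
        · obtain ⟨ht1, ht2⟩ := ht
          refine ⟨?_, ?_⟩
          · obtain ⟨_, s, hs, x, hx, hsx, hxt⟩ := ht1
            have hx1 : x ∈ X1 := ⟨hx, s, hs, x, hx, hsx, ReflTransGen.refl⟩
            obtain ⟨i1, i2, i3⟩ := hin x t hxt hx1 ht2
            exact ⟨s, hs, ReflTransGen.head ⟨Or.inl hs, Or.inr ⟨hx1, i2⟩, hsx⟩ i1⟩
          · obtain ⟨_, s, hs, x, hx, hxs, htx⟩ := ht2
            have hx2 : x ∈ X2 := ⟨hx, s, hs, x, hx, hxs, ReflTransGen.refl⟩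
            obtain ⟨i1, i2, i3⟩ := hin t x htx ht1 hx2
            exact ⟨s, hs, ReflTransGen.tail i1 ⟨Or.inr ⟨i3, hx2⟩, Or.inl hs, hxs⟩⟩
      · obtain ⟨φ, hφ, hv⟩ := h4
        refine ⟨fun v => if v ∈ S then φ v else if ∃ s ∈ S, r s v then 0 else 1, ?_, ?_⟩
        · intro v _
          dsimp only
          split_ifs with h5
          · exact hφ v h5
          · omega
          · omega
        · intro j
          have a1 : Acy r ({v | v ∈ S ∪ P ∧ (if v ∈ S then φ v else
              if ∃ s ∈ S, r s v then 0 else 1) = j} ∩ S) := by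
            apply (hv j).mono
            rintro v ⟨⟨_, hj⟩, hvS⟩
            rw [if_pos hvS] at hj
            exact ⟨hvS, hj⟩
          have a2 : Acy r ({v | v ∈ S ∪ P ∧ (if v ∈ S then φ v else
              if ∃ s ∈ S, r s v then 0 else 1) = j} \ S) := by
            apply hX.mono
            rintro v ⟨⟨hv | hv, hj⟩, hvS⟩
            · exact absurd hv hvS
            · exact hv.1.1
          by_cases hj0 : j = 0
          · refine acy_split2 S a1 a2 ?_
            rintro x hx hxS y ⟨hy, hyj⟩ hyS hyx
            dsimp only at hyj
            rw [if_neg hyS, hj0] at hyj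
            split_ifs at hyj with h5
            rcases hy with hy | hy
            · exact hyS hy
            · exact hba y hy.1.1 ⟨⟨x, hxS, hyx⟩, h5⟩
          · refine acy_split1 S a1 a2 ?_
            rintro x hx hxS y ⟨hy, hyj⟩ hyS hxy
            dsimp only at hyj
            rw [if_neg hyS, if_pos ⟨x, hxS, hxy⟩] at hyj
            exact hj0 hyj.symm
    intro y hy1 hy2
    exact hXS y hy1.1 (hmax _ hcl Set.subset_union_left (Or.inr ⟨hy1, hy2⟩))
  apply acy_split1 X1
  · exact hX.mono (fun v hv => hv.2.1)
  · apply acy_split1 S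
    · apply (hψ γ).mono
      rintro v ⟨⟨hv | hv, _⟩, hvS⟩
      · exact hv
      · exact absurd hvS (hXS v hv)
    · apply hX.mono
      rintro v ⟨⟨hv | hv, _⟩, hvS⟩
      · exact absurd hv.1 hvS
      · exact hv
    · rintro x ⟨_, _⟩ hxS y ⟨hy, hy1⟩ hyS hxy
      rcases hy with hy | hy
      · exact hyS hy.1
      · exact hy1 ⟨hy, x, hxS, y, hy, hxy, ReflTransGen.refl⟩
  · rintro x _ hx1 y (hy | hy) hy1 hxy
    · exact hP x hx1 ⟨hx1.1, y, hy.1, x, hx1.1, hxy, ReflTransGen.refl⟩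
    · exact hy1 (hstep1 x y hx1 ⟨hx1.1, hy, hxy⟩)

def RecG (r : V → V → Prop) (σ : List Bool) (k : ℕ) (K : Set V) (st : List (Set V × V)) : Prop :=
    ∃ A, A ⊆ K ∧ ∃ φ : V → ℕ × ℕ, (∀ a ∈ A, Root r σ a ((K \ A) ∪ UU st)) ∧
      Val r (K \ A) φ ∧
      (∀ y ∈ K \ A, ∀ i S, At st i S → BA r y S → (φ y).1 ≠ i % (k / 2)) ∧
      (∀ y ∈ K \ A, (φ y).1 < k / 2 ∧ (φ y).2 < cc k (φ y).1)

def Link (r : V → V → Prop) (σ : List Bool) (k : ℕ) (K : Set V) (st : List (Set V × V)) : Prop :=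
  ∀ y ∈ K, Root r σ y (UU st) ∨
      ∀ i S, At st i S → BA r y S → ¬ Col r (cc k i) (insert y S)

theorem rec_empty {k : ℕ} {σ : List Bool} {st : List (Set V × V)} : RecG r σ k ∅ st := by
  refine ⟨∅, Set.Subset.rfl, fun _ => (0, 0), by simp, ?_, by simp, by simp⟩
  intro i
  exact acy_empty.mono (fun v hv => by simpa using hv.1)

theorem rec_root {k : ℕ} {σ : List Bool} {st : List (Set V × V)} {K : Set V} {y : V}
    (hy : y ∈ K) (hr : Root r σ y (UU st)) (h : RecG r σ k (K \ {y}) st) : RecG r σ k K st := by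
  obtain ⟨A, hA, φ, h1, h2, h3, h4⟩ := h
  have e : K \ insert y A = (K \ {y}) \ A := by
    ext v; simp only [Set.mem_sdiff, Set.mem_insert_iff, Set.mem_singleton_iff]; tauto
  refine ⟨insert y A, ?_, φ, ?_, ?_, ?_, ?_⟩
  · exact Set.insert_subset hy (hA.trans Set.sdiff_subset)
  · rw [e]
    rintro a (rfl | ha)
    · exact hr.mono Set.subset_union_right
    · exact h1 a ha
  · rw [e]; exact h2
  · rw [e]; exact h3
  · rw [e]; exact h4

theorem rec_pop {k : ℕ} {σ : List Bool} {a : Set V × V} {t : List (Set V × V)} {K : Set V}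
    (hno : ∀ y ∈ K, ¬ BA r y a.1) (h : RecG r σ k K t) : RecG r σ k K (a :: t) := by
  obtain ⟨A, hA, φ, h1, h2, h3, h4⟩ := h
  refine ⟨A, hA, φ, ?_, h2, ?_, h4⟩
  · intro v hv
    exact (h1 v hv).mono (Set.union_subset_union_right _ Set.subset_union_right)
  · rintro y hy i S (⟨hi, rfl⟩ | hat) hba
    · exact absurd hba (hno y hy.1)
    · exact h3 y hy i S hat hba

theorem rec_push [Finite V] (hl : ∀ v, ¬ r v v) {k : ℕ} (hk : 2 ≤ k) {σ : List Bool}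
    (hσ : σ.length = k + 1) {K : Set V} {st : List (Set V × V)} (hwf : WF r (cc k) st)
    (hdis : Disjoint K (UU st)) (hnr : ∀ y ∈ K, ¬ Root r σ y (UU st))
    (hlink : Link r σ k K st) {w : V} (hw : w ∈ K) (hlw : Lk r (cc k) w st)
    (ih : ∀ K', K'.ncard < K.ncard → ∀ st', WF r (cc k) st' → Disjoint K' (UU st') →
      Link r σ k K' st' → RecG r σ k K' st') : RecG r σ k K st := by
  classical
  set d := st.length with hd
  let Z : Set V := {y | ∃ i S, At st i S ∧ BA r y S ∧ i % (k / 2) = d % (k / 2)}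
  have hKU : ∀ y ∈ K, y ∉ UU st := fun y hy => Set.disjoint_left.1 hdis hy
  have hwZ : w ∉ Z := by
    rintro ⟨i, S, hat, hba, hi⟩
    exact hnr w hw (root_tight hl (cc23 k) hwf hat hba (hKU w hw) hlw hσ
      (cc_big k hk (at_lt hat) hi))
  have hc2 : 2 ≤ cc k d := by rcases cc23 k d with h | h <;> omega
  obtain ⟨S, hS, hmax⟩ := cl_exists (r := r) hl (c := cc k d) (by omega) (M := K \ Z) ⟨hw, hwZ⟩
  obtain ⟨hSM, hwS, hStr, ψ, hψc, hψ⟩ := id hS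
  have hSK : S ⊆ K := hSM.trans Set.sdiff_subset
  have hwf' : WF r (cc k) ((S, w) :: st) :=
    ⟨hwS, hStr, hS.2.2.2, hdis.mono_left hSK, hlw, hwf⟩
  have hdis' : Disjoint (K \ S) (UU ((S, w) :: st)) := by
    rw [Set.disjoint_left]
    rintro v ⟨hv, hvS⟩ (h | h)
    · exact hvS h
    · exact hKU v hv h
  have hlink' : Link r σ k (K \ S) ((S, w) :: st) := by
    rintro y ⟨hy, hyS⟩
    by_cases hr : Root r σ y (UU ((S, w) :: st))
    · exact Or.inl hr
    · right
      rintro i T (⟨hi, hT⟩ | hat) hba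
      · dsimp only at hT
        subst hT
        rw [hi]
        by_cases hyZ : y ∈ Z
        · exfalso
          obtain ⟨i', S', hat', hba', hi'⟩ := hyZ
          exact hr (root_nontight hl (cc23 k) hwf' hat' hba'
            (Set.disjoint_left.1 hdis' ⟨hy, hyS⟩) hba (by omega) hσ
            (cc_big k hk (at_lt hat') hi'))
        · exact cl_E1 hS hmax ⟨hy, hyZ⟩ hyS hba
      · rcases hlink y hy with h | h
        · exact absurd h (hnr y hy)
        · exact h i T hat hba
  have hcard : (K \ S).ncard < K.ncard := by
    apply Set.ncard_lt_ncard _ (Set.toFinite _)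
    refine Set.ssubset_iff_subset_ne.2 ⟨Set.sdiff_subset, ?_⟩
    intro h
    have : w ∈ K \ S := by rw [h]; exact hw
    exact this.2 hwS
  obtain ⟨A, hA, φ, h1, h2, h3, h4⟩ := ih _ hcard _ hwf' hdis' hlink'
  refine ⟨A, hA.trans Set.sdiff_subset, fun v => if v ∈ S then (d % (k / 2), ψ v) else φ v,
    ?_, ?_, ?_, ?_⟩
  · intro a ha
    apply (h1 a ha).mono
    rintro v (hv | hv | hv)
    · exact Or.inl ⟨hv.1.1, hv.2⟩
    · exact Or.inl ⟨hSK hv, fun h => (hA h).2 hv⟩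
    · exact Or.inr hv
  · rintro ⟨p, b⟩
    by_cases hp : p = d % (k / 2)
    · let X : Set V := {v | v ∈ (K \ S) \ A ∧ φ v = (p, b)}
      have hX : Acy r ({v | v ∈ S ∧ ψ v = b} ∪ X) := by
        apply cl_E2 hc2 hS hmax _ _ (h2 (p, b)) _ hψ b
        · rintro v ⟨hv, hvp⟩
          refine ⟨hv.1.1, ?_⟩
          rintro ⟨i, S', hat, hba, hi⟩
          apply h3 v hv i S' (Or.inr hat) hba
          rw [hvp, hi]; exact hp
        · rintro v ⟨hv, hvp⟩
          exact hv.1.2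
        · rintro v ⟨hv, hvp⟩ hba
          apply h3 v hv d S (Or.inl ⟨rfl, rfl⟩) hba
          rw [hvp]; exact hp
      apply hX.mono
      rintro v ⟨⟨hvK, hvA⟩, hv⟩
      dsimp only at hv
      split_ifs at hv with h
      · exact Or.inl ⟨h, (Prod.mk.inj hv).2⟩
      · exact Or.inr ⟨⟨⟨hvK, h⟩, hvA⟩, hv⟩
    · apply (h2 (p, b)).mono
      rintro v ⟨⟨hvK, hvA⟩, hv⟩
      dsimp only at hv
      split_ifs at hv with h
      · exact absurd (Prod.mk.inj hv).1.symm hp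
      · exact ⟨⟨⟨hvK, h⟩, hvA⟩, hv⟩
  · rintro y ⟨hyK, hyA⟩ i S' hat hba
    dsimp only
    split_ifs with h
    · intro h5
      exact (hSM h).2 ⟨i, S', hat, hba, h5.symm⟩
    · exact h3 y ⟨⟨hyK, h⟩, hyA⟩ i S' (Or.inr hat) hba
  · rintro y ⟨hyK, hyA⟩
    dsimp only
    split_ifs with h
    · refine ⟨Nat.mod_lt _ (by omega), ?_⟩
      dsimp only
      rw [cc_mod]; exact hψc y h
    · exact h4 y ⟨⟨hyK, h⟩, hyA⟩

theorem rec_lemma [Finite V] (hl : ∀ v, ¬ r v v) {k : ℕ} (hk : 2 ≤ k) {σ : List Bool}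
    (hσ : σ.length = k + 1) : ∀ (n : ℕ) (K : Set V), K.ncard = n →
    ∀ st : List (Set V × V), WF r (cc k) st → Disjoint K (UU st) →
    Link r σ k K st → RecG r σ k K st := by
  intro n
  induction n using Nat.strong_induction_on with
  | _ n ihn =>
  intro K hKn
  have ih : ∀ K', K'.ncard < K.ncard → ∀ st', WF r (cc k) st' → Disjoint K' (UU st') →
      Link r σ k K' st' → RecG r σ k K' st' := by
    intro K' hK' st' h1 h2 h3
    exact ihn _ (by omega) K' rfl st' h1 h2 h3
  have hroot : ∀ st, WF r (cc k) st → Disjoint K (UU st) →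
      Link r σ k K st → ∀ y ∈ K, Root r σ y (UU st) → RecG r σ k K st := by
    intro st h1 h2 h3 y hy hr
    refine rec_root hy hr (ih _ ?_ st h1 (h2.mono_left Set.sdiff_subset)
      (fun z hz => h3 z hz.1))
    exact Set.ncard_sdiff_singleton_lt_of_mem hy (Set.toFinite _)
  intro st
  by_cases hK : K = ∅
  · intro _ _ _
    rw [hK]; exact rec_empty
  induction st with
  | nil =>
    intro hwf hdis hlink
    obtain ⟨w, hw⟩ := Set.nonempty_iff_ne_empty.2 hK
    by_cases hr : ∃ y ∈ K, Root r σ y (UU ([] : List (Set V × V)))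
    · obtain ⟨y, hy, hr⟩ := hr
      exact hroot _ hwf hdis hlink y hy hr
    · push Not at hr
      exact rec_push hl hk hσ hwf hdis hr hlink hw trivial ih
  | cons a t iht =>
    intro hwf hdis hlink
    by_cases hr : ∃ y ∈ K, Root r σ y (UU (a :: t))
    · obtain ⟨y, hy, hr⟩ := hr
      exact hroot _ hwf hdis hlink y hy hr
    push Not at hr
    by_cases hb : ∃ w ∈ K, BA r w a.1
    · obtain ⟨w, hw, hba⟩ := hb
      refine rec_push hl hk hσ hwf hdis hr hlink hw ?_ ih
      rcases hlink w hw with h | h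
      · exact absurd h (hr w hw)
      · exact h _ _ (Or.inl ⟨rfl, rfl⟩) hba
    · push Not at hb
      apply rec_pop hb
      apply iht hwf.2.2.2.2.2 (hdis.mono_right Set.subset_union_right)
      intro y hy
      rcases hlink y hy with h | h
      · exact absurd h (hr y hy)
      · right
        intro i S hat
        exact h i S (Or.inr hat)

/-- The main theorem on rooted oriented cycles. -/
theorem theoremR [Finite V] (hl : ∀ v, ¬ r v v) {k : ℕ} (hk : 2 ≤ k) {σ : List Bool}
    (hσ : σ.length = k + 1) (K : Set V) :
    ∃ A, A ⊆ K ∧ Col r k (K \ A) ∧ ∀ a ∈ A, Root r σ a (K \ A) := by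
  obtain ⟨A, hA, φ, h1, h2, h3, h4⟩ := rec_lemma hl hk hσ _ K rfl [] trivial
    (by simp [UU]) (fun y hy => Or.inr (fun i S h => h.elim))
  refine ⟨A, hA, ⟨fun v => if (φ v).2 = 2 then 2 * (k / 2) else 2 * (φ v).1 + (φ v).2,
    ?_, ?_⟩, ?_⟩
  · intro v hv
    obtain ⟨h5, h6⟩ := h4 v hv
    unfold cc at h6
    dsimp only
    split_ifs at h6 ⊢ <;> omega
  · intro j
    by_cases hj : ∃ v ∈ K \ A, (if (φ v).2 = 2 then 2 * (k / 2) else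
        2 * (φ v).1 + (φ v).2) = j
    · obtain ⟨v, hv, hvj⟩ := hj
      apply (h2 (φ v)).mono
      rintro u ⟨hu, huj⟩
      refine ⟨hu, ?_⟩
      dsimp only at huj
      rw [← hvj] at huj
      obtain ⟨h5, h6⟩ := h4 v hv
      obtain ⟨h7, h8⟩ := h4 u hu
      unfold cc at h6 h8
      rw [Nat.mod_eq_of_lt h5] at h6
      rw [Nat.mod_eq_of_lt h7] at h8
      apply Prod.ext
      · split_ifs at huj h6 h8 <;> omega
      · split_ifs at huj h6 h8 <;> omega
    · push Not at hj
      apply acy_empty.mono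
      rintro v ⟨hv, hvj⟩
      exact absurd hvj (hj v hv)
  · intro a ha
    simpa [UU] using h1 a ha


theorem sp_conv {σ : List Bool} {u v : V} {X : Set V} (h : SP r σ u X v) :
    ∃ (b : ℕ → V) (l : ℕ → List V), b 0 = u ∧ b σ.length = v ∧
      (∀ i s, σ[i]? = some s → (b i :: (l i ++ [b (i + 1)])).IsChain (Arc r s) ∧
        (l i ++ [b (i + 1)]).Nodup ∧ ∀ x ∈ l i ++ [b (i + 1)], x ∈ X) ∧
      (∀ i j, i < j → j < σ.length → ∀ x ∈ l i ++ [b (i + 1)], x ∉ l j ++ [b (j + 1)]) := by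
  induction h with
  | nil u => exact ⟨fun _ => u, fun _ => [], rfl, rfl, by simp, by simp⟩
  | @new s0 σ u w v X ha hw _ ih =>
    obtain ⟨b, l, h0, h1, h2, h3⟩ := ih
    refine ⟨fun i => match i with | 0 => u | i + 1 => b i,
      fun i => match i with | 0 => [] | i + 1 => l i, rfl, h1, ?_, ?_⟩
    · intro i s hs
      cases i with
      | zero =>
        simp only [List.getElem?_cons_zero, Option.some.injEq] at hs
        subst hs
        simp [h0, ha]
      | succ i =>
        simp only [List.getElem?_cons_succ] at hs
        obtain ⟨a1, a2, a3⟩ := h2 i s hs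
        exact ⟨a1, a2, fun x hx => Or.inr (a3 x hx)⟩
    · intro i j hij hj
      cases j with
      | zero => omega
      | succ j =>
        simp only [List.length_cons] at hj
        cases i with
        | zero =>
          intro x hx hx'
          have hxw : x = w := by simpa [h0] using hx
          subst hxw
          have hj' : j < σ.length := by omega
          exact hw ((h2 j σ[j] (by simp [hj'])).2.2 x hx')
        | succ i => exact h3 i j (by omega) (by omega)
  | @ext s0 σ u w v X ha hw _ ih =>
    obtain ⟨b, l, h0, h1, h2, h3⟩ := ih
    refine ⟨fun i => match i with | 0 => u | i + 1 => b (i + 1),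
      fun i => match i with | 0 => w :: l 0 | i + 1 => l (i + 1), rfl, h1, ?_, ?_⟩
    · intro i s hs
      cases i with
      | zero =>
        obtain ⟨a1, a2, a3⟩ := h2 0 s hs
        simp only [List.getElem?_cons_zero, Option.some.injEq] at hs
        subst hs
        rw [h0] at a1
        refine ⟨?_, ?_, ?_⟩
        · exact List.IsChain.cons_cons ha a1
        · exact List.nodup_cons.2 ⟨fun h => hw (a3 w h), a2⟩
        · intro x hx
          rcases List.mem_cons.1 hx with rfl | hx
          · exact Or.inl rfl
          · exact Or.inr (a3 x hx)
      | succ i =>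
        obtain ⟨a1, a2, a3⟩ := h2 (i + 1) s hs
        exact ⟨a1, a2, fun x hx => Or.inr (a3 x hx)⟩
    · intro i j hij hj
      cases j with
      | zero => omega
      | succ j =>
        cases i with
        | zero =>
          intro x hx hx'
          rcases List.mem_cons.1 hx with rfl | hx
          · refine hw ((h2 (j + 1) (s0 :: σ)[j + 1] ?_).2.2 x hx')
            exact List.getElem?_eq_getElem hj
          · exact h3 0 (j + 1) hij hj x hx hx'
        | succ i => exact h3 (i + 1) (j + 1) hij hj


def DPath (r : V → V → Prop) (u : V) (l : List V) (v : V) : Prop :=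
  (u :: (l ++ [v])).IsChain r ∧ (u :: (l ++ [v])).Nodup

theorem dpath_rev {u v : V} {l : List V} (h : DPath (Arc r false) u l v) :
    DPath r v l.reverse u := by
  have e : v :: (l.reverse ++ [u]) = (u :: (l ++ [v])).reverse := by simp
  unfold DPath
  rw [e]
  refine ⟨?_, List.nodup_reverse.2 h.2⟩
  rw [List.isChain_reverse]
  exact h.1

variable {α : Type}

/-- `β, p` is a subdivision of `F[Y]` with all vertices in `B`. -/
structure Sub (r : V → V → Prop) (F : α → α → Prop) (Y : Set α) (β : α → V)
    (p : α → α → List V) (B : Set V) : Prop where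
  inj : Set.InjOn β Y
  mem : ∀ a ∈ Y, β a ∈ B
  path : ∀ a ∈ Y, ∀ b ∈ Y, F a b → DPath r (β a) (p a b) (β b)
  pmem : ∀ a ∈ Y, ∀ b ∈ Y, F a b → ∀ x ∈ p a b, x ∈ B
  pint : ∀ a ∈ Y, ∀ b ∈ Y, F a b → ∀ x ∈ p a b, ∀ c ∈ Y, x ≠ β c
  dis : ∀ a ∈ Y, ∀ b ∈ Y, F a b → ∀ a' ∈ Y, ∀ b' ∈ Y, F a' b' → (a, b) ≠ (a', b') →
    ∀ x ∈ p a b, x ∉ p a' b'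

def RP (F : α → α → Prop) (Y : Set α) (v : α) (k : ℕ) : Prop :=
  ∀ (V : Type) [Finite V] (r : V → V → Prop), (∀ v, ¬ r v v) → ∀ K : Set V,
    ∃ A, A ⊆ K ∧ Col r k (K \ A) ∧ ∀ a ∈ A, ∃ β p, β v = a ∧ Sub r F Y β p (insert a (K \ A))

theorem rp_single {F : α → α → Prop} (hF : ∀ a b, F a b → ¬ F b a) (v : α) :
    RP F {v} v 0 := by
  intro V _ r hl K
  have hno : ∀ a ∈ ({v} : Set α), ∀ b ∈ ({v} : Set α), ¬ F a b := by
    intro a ha b hb hab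
    rw [Set.mem_singleton_iff] at ha hb
    rw [ha, hb] at hab
    exact hF _ _ hab hab
  refine ⟨K, Set.Subset.rfl, ⟨fun _ => 0, by simp, ?_⟩, ?_⟩
  · intro i
    exact acy_empty.mono (fun v hv => by simpa using hv.1)
  · intro a ha
    refine ⟨fun _ => a, fun _ _ => [], rfl, ?_, ?_, ?_, ?_, ?_, ?_⟩
    · simp
    · intro _ _; exact Or.inl rfl
    all_goals
      intro a ha b hb hab
      exact absurd hab (hno a ha b hb)

theorem rp_pair {F : α → α → Prop} (hF : ∀ a b, F a b → ¬ F b a) (v w : α) (hvw : v ≠ w) :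
    RP F {v, w} v 1 := by
  classical
  intro V _ r hl K
  obtain ⟨B, ⟨hBK, hB⟩, hmax⟩ := Set.exists_max_image {B : Set V | B ⊆ K ∧ Acy r B} Set.ncard
    (Set.toFinite _) ⟨∅, Set.empty_subset _, acy_empty⟩
  have hKB : K \ (K \ B) = B := by
    ext x; constructor
    · rintro ⟨h1, h2⟩
      by_contra h; exact h2 ⟨h1, h⟩
    · intro h; exact ⟨hBK h, fun h' => h'.2 h⟩
  refine ⟨K \ B, Set.sdiff_subset, ?_, ?_⟩
  · rw [hKB]
    exact ⟨fun _ => 0, by simp, fun i => hB.mono (fun v hv => hv.1)⟩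
  · rw [hKB]
    rintro a ⟨haK, haB⟩
    have harc : ∀ τ, ∃ s ∈ B, Arc r τ a s := by
      intro τ
      by_contra hcon
      push Not at hcon
      have : Acy r (insert a B) := by
        apply acy_split_arc τ {a}
        · exact (acy_singleton hl a).mono (fun x hx => hx.2)
        · apply hB.mono
          rintro x ⟨hx | hx, hxa⟩
          · exact absurd hx hxa
          · exact hx
        · left
          rintro x _ hx y hy hya
          rw [Set.mem_singleton_iff] at hx
          subst hx
          rcases hy with hy | hy
          · exact absurd hy hya
          · exact hcon y hy
      have h1 := hmax (insert a B) ⟨Set.insert_subset haK hBK, this⟩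
      have h2 := Set.ncard_insert_of_notMem haB (Set.toFinite _)
      omega
    obtain ⟨s, hs, ha⟩ := harc (decide (F v w))
    have has : a ≠ s := by rintro rfl; exact haB hs
    obtain ⟨β, hbv, hbw⟩ : ∃ β : α → V, β v = a ∧ β w = s :=
      ⟨fun x => if x = v then a else s, by simp, by simp [Ne.symm hvw]⟩
    have hcases : ∀ x ∈ ({v, w} : Set α), ∀ y ∈ ({v, w} : Set α), F x y →
        (x = v ∧ y = w) ∨ (x = w ∧ y = v) := by
      rintro x (rfl | hx) y (rfl | hy) hxy
      · exact absurd hxy (hF _ _ hxy)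
      · exact Or.inl ⟨rfl, hy⟩
      · exact Or.inr ⟨hx, rfl⟩
      · rw [Set.mem_singleton_iff] at hx hy
        subst hx; subst hy
        exact absurd hxy (hF _ _ hxy)
    refine ⟨β, fun _ _ => [], hbv, ?_, ?_, ?_, by simp, by simp, by simp⟩
    · rintro x (rfl | hx) y (rfl | hy) hxy
      · rfl
      · rw [Set.mem_singleton_iff] at hy
        subst hy
        rw [hbv, hbw] at hxy
        exact absurd hxy has
      · rw [Set.mem_singleton_iff] at hx
        subst hx
        rw [hbv, hbw] at hxy
        exact absurd hxy.symm has
      · rw [Set.mem_singleton_iff] at hx hy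
        rw [hx, hy]
    · rintro x (hx | hx)
      · rw [hx, hbv]; exact Or.inl rfl
      · rw [hx, hbw]; exact Or.inr hs
    · intro x hx y hy hxy
      rcases hcases x hx y hy hxy with ⟨rfl, rfl⟩ | ⟨rfl, rfl⟩
      · rw [hbv, hbw]
        rw [decide_eq_true hxy] at ha
        have ha : r a s := ha
        refine ⟨by simpa using ha, by simpa using has⟩
      · rw [hbv, hbw]
        rw [decide_eq_false (hF _ _ hxy)] at ha
        have ha : r s a := ha
        refine ⟨by simpa using ha, by simpa using has.symm⟩

theorem col_union {k1 k2 : ℕ} {S T : Set V} (h1 : Col r k1 S) (h2 : Col r k2 T) :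
    Col r (k1 + k2) (S ∪ T) := by
  classical
  obtain ⟨φ, hφ, hv⟩ := h1
  obtain ⟨ψ, hψ, hw⟩ := h2
  refine ⟨fun v => if v ∈ S then φ v else k1 + ψ v, ?_, ?_⟩
  · intro v hvS
    dsimp only
    split_ifs with h
    · have := hφ v h; omega
    · rcases hvS with h' | h'
      · exact absurd h' h
      · have := hψ v h'; omega
  · intro j
    by_cases hj : j < k1
    · apply (hv j).mono
      rintro v ⟨hvS, hvj⟩
      dsimp only at hvj
      split_ifs at hvj with h
      · exact ⟨h, hvj⟩
      · omega
    · apply (hw (j - k1)).mono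
      rintro v ⟨hvS, hvj⟩
      dsimp only at hvj
      split_ifs at hvj with h
      · have := hφ v h; omega
      · rcases hvS with h' | h'
        · exact absurd h' h
        · exact ⟨h', by omega⟩

theorem rp_glue {F : α → α → Prop} (hF : ∀ a b, F a b → ¬ F b a) {Y1 Y2 : Set α} {v u : α}
    {k1 k2 : ℕ} (hu1 : u ∈ Y1) (hu2 : u ∈ Y2) (h12 : ∀ x ∈ Y1, x ∈ Y2 → x = u)
    (hv : v ∈ Y1)
    (harc : ∀ a ∈ Y1 ∪ Y2, ∀ b ∈ Y1 ∪ Y2, F a b → (a ∈ Y1 ∧ b ∈ Y1) ∨ (a ∈ Y2 ∧ b ∈ Y2))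
    (H1 : RP F Y1 v k1) (H2 : RP F Y2 u k2) : RP F (Y1 ∪ Y2) v (k1 + k2) := by
  classical
  intro V _ r hl K
  obtain ⟨A2, hA2, hc2, hs2⟩ := H2 V r hl K
  obtain ⟨A1, hA1, hc1, hs1⟩ := H1 V r hl A2
  have hK : K \ A1 = (A2 \ A1) ∪ (K \ A2) := by
    ext x
    simp only [Set.mem_union, Set.mem_sdiff]
    have := @hA2 x
    have := @hA1 x
    tauto
  refine ⟨A1, hA1.trans hA2, ?_, ?_⟩
  · rw [hK]; exact col_union hc1 hc2
  intro a ha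
  obtain ⟨β1, p1, hβ1, s1⟩ := hs1 a ha
  have hB1 : ∀ x ∈ insert a (A2 \ A1), x ∈ A2 := by
    rintro x (rfl | hx)
    · exact hA1 ha
    · exact hx.1
  obtain ⟨β2, p2, hβ2, s2⟩ := hs2 (β1 u) (hB1 _ (s1.mem u hu1))
  have hB12 : ∀ x, x ∈ insert a (A2 \ A1) → x ∈ insert (β1 u) (K \ A2) → x = β1 u := by
    rintro x hx (h | h)
    · exact h
    · exact absurd (hB1 x hx) h.2
  have hi1 : ∀ x ∈ insert a (A2 \ A1), x ∈ insert a (K \ A1) := by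
    rintro x (rfl | hx)
    · exact Or.inl rfl
    · exact Or.inr ⟨hA2 hx.1, hx.2⟩
  have hi2 : ∀ x ∈ insert (β1 u) (K \ A2), x ∈ insert a (K \ A1) := by
    rintro x (rfl | hx)
    · exact hi1 _ (s1.mem u hu1)
    · exact Or.inr ⟨hx.1, fun h => hx.2 (hA1 h)⟩
  set β : α → V := fun x => if x ∈ Y1 then β1 x else β2 x with hβ
  set p : α → α → List V := fun x y => if x ∈ Y1 ∧ y ∈ Y1 then p1 x y else p2 x y with hp
  have b1 : ∀ x ∈ Y1, β x = β1 x := fun x hx => if_pos hx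
  have b2 : ∀ x ∈ Y2, β x = β2 x := by
    intro x hx
    by_cases h : x ∈ Y1
    · rw [h12 x h hx, b1 u hu1, hβ2]
    · exact if_neg h
  have q1 : ∀ x ∈ Y1, ∀ y ∈ Y1, p x y = p1 x y := fun x hx y hy => if_pos ⟨hx, hy⟩
  have q2 : ∀ x ∈ Y2, ∀ y ∈ Y2, F x y → p x y = p2 x y := by
    intro x hx y hy hxy
    refine if_neg ?_
    rintro ⟨h1, h2⟩
    rw [h12 x h1 hx, h12 y h2 hy] at hxy
    exact hF _ _ hxy hxy
  have d12 : ∀ x ∈ Y1, ∀ y ∈ Y1, F x y → ∀ x' ∈ Y2, ∀ y' ∈ Y2, F x' y' →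
      ∀ z ∈ p x y, z ∉ p x' y' := by
    intro x hx y hy hxy x' hx' y' hy' hxy' z hz hz'
    rw [q1 x hx y hy] at hz
    rw [q2 x' hx' y' hy' hxy'] at hz'
    have := hB12 z (s1.pmem x hx y hy hxy z hz) (s2.pmem x' hx' y' hy' hxy' z hz')
    exact s1.pint x hx y hy hxy z hz u hu1 this
  refine ⟨β, p, ?_, ?_⟩
  · rw [b1 v hv, hβ1]
  refine ⟨?_, ?_, ?_, ?_, ?_, ?_⟩
  · have hx12 : ∀ x ∈ Y1, ∀ y ∈ Y2, β x = β y → x = y := by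
      intro x hx y hy hxy
      rw [b1 x hx, b2 y hy] at hxy
      have h5 := hB12 (β1 x) (s1.mem x hx) (by rw [hxy]; exact s2.mem y hy)
      have h6 := s1.inj hx hu1 h5
      have h7 : β2 y = β2 u := by rw [← hxy, h5, hβ2]
      have h8 := s2.inj hy hu2 h7
      rw [h6, h8]
    rintro x (hx | hx) y (hy | hy) hxy
    · rw [b1 x hx, b1 y hy] at hxy
      exact s1.inj hx hy hxy
    · exact hx12 x hx y hy hxy
    · exact (hx12 y hy x hx hxy.symm).symm
    · rw [b2 x hx, b2 y hy] at hxy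
      exact s2.inj hx hy hxy
  · rintro x (hx | hx)
    · rw [b1 x hx]; exact hi1 _ (s1.mem x hx)
    · rw [b2 x hx]; exact hi2 _ (s2.mem x hx)
  · intro x hx y hy hxy
    rcases harc x hx y hy hxy with ⟨hx, hy⟩ | ⟨hx, hy⟩
    · rw [b1 x hx, b1 y hy, q1 x hx y hy]; exact s1.path x hx y hy hxy
    · rw [b2 x hx, b2 y hy, q2 x hx y hy hxy]; exact s2.path x hx y hy hxy
  · intro x hx y hy hxy z hz
    rcases harc x hx y hy hxy with ⟨hx, hy⟩ | ⟨hx, hy⟩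
    · rw [q1 x hx y hy] at hz; exact hi1 _ (s1.pmem x hx y hy hxy z hz)
    · rw [q2 x hx y hy hxy] at hz; exact hi2 _ (s2.pmem x hx y hy hxy z hz)
  · intro x hx y hy hxy z hz t ht hzt
    rcases harc x hx y hy hxy with ⟨hx, hy⟩ | ⟨hx, hy⟩
    · rw [q1 x hx y hy] at hz
      rcases ht with ht | ht
      · rw [b1 t ht] at hzt
        exact s1.pint x hx y hy hxy z hz t ht hzt
      · rw [b2 t ht] at hzt
        have := hB12 z (s1.pmem x hx y hy hxy z hz) (by rw [hzt]; exact s2.mem t ht)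
        exact s1.pint x hx y hy hxy z hz u hu1 this
    · rw [q2 x hx y hy hxy] at hz
      rcases ht with ht | ht
      · rw [b1 t ht] at hzt
        have := hB12 z (by rw [hzt]; exact s1.mem t ht) (s2.pmem x hx y hy hxy z hz)
        exact s2.pint x hx y hy hxy z hz u hu2 (by rw [hβ2]; exact this)
      · rw [b2 t ht] at hzt
        exact s2.pint x hx y hy hxy z hz t ht hzt
  · intro x hx y hy hxy x' hx' y' hy' hxy' hne z hz hz'
    rcases harc x hx y hy hxy with ⟨hx, hy⟩ | ⟨hx, hy⟩ <;>
      rcases harc x' hx' y' hy' hxy' with ⟨hx', hy'⟩ | ⟨hx', hy'⟩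
    · rw [q1 x hx y hy] at hz
      rw [q1 x' hx' y' hy'] at hz'
      exact s1.dis x hx y hy hxy x' hx' y' hy' hxy' hne z hz hz'
    · exact d12 x hx y hy hxy x' hx' y' hy' hxy' z hz hz'
    · exact d12 x' hx' y' hy' hxy' x hx y hy hxy z hz' hz
    · rw [q2 x hx y hy hxy] at hz
      rw [q2 x' hx' y' hy' hxy'] at hz'
      exact s2.dis x hx y hy hxy x' hx' y' hy' hxy' hne z hz hz'

theorem rp_cycle {F : α → α → Prop} (hF : ∀ a b, F a b → ¬ F b a) {Y : Set α} {k : ℕ}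
    (hk : 2 ≤ k) (v : ℕ → α) (hv0 : v (k + 1) = v 0) (hv0Y : v 0 ∈ Y)
    (hY : ∀ x ∈ Y, ∃ i, i ≤ k ∧ v i = x)
    (hinj : ∀ i j, i ≤ k → j ≤ k → v i = v j → i = j)
    (harc : ∀ x ∈ Y, ∀ y ∈ Y, F x y → ∃ i, i ≤ k ∧ ((x = v i ∧ y = v (i + 1)) ∨
      (x = v (i + 1) ∧ y = v i))) : RP F Y (v 0) k := by
  classical
  intro V _ r hl K
  set σ : List Bool := (List.range (k + 1)).map (fun i => decide (F (v i) (v (i + 1)))) with hσd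
  have hσ : σ.length = k + 1 := by simp [hσd]
  have hσi : ∀ i, i ≤ k → σ[i]? = some (decide (F (v i) (v (i + 1)))) := by
    intro i hi
    have : i < k + 1 := by omega
    simp [hσd, this]
  obtain ⟨A, hA, hcol, hroot⟩ := theoremR hl hk hσ K
  refine ⟨A, hA, hcol, ?_⟩
  intro a ha
  obtain ⟨X, hX, hsp⟩ := hroot a ha
  obtain ⟨b, l, h0, h1, h2, h3⟩ := sp_conv hsp
  rw [hσ] at h1 h3
  have hseg := fun i hi => h2 i _ (hσi i hi)
  have hdis : ∀ i j, i ≤ k → j ≤ k → ∀ x ∈ l i ++ [b (i + 1)], x ∈ l j ++ [b (j + 1)] →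
      i = j := by
    intro i j hi hj x hx hx'
    by_contra hij
    rcases Nat.lt_or_gt_of_ne hij with h | h
    · exact h3 i j h (by omega) x hx hx'
    · exact h3 j i h (by omega) x hx' hx
  have hlast : ∀ i, b (i + 1) ∈ l i ++ [b (i + 1)] := by simp
  -- predecessor index
  have hpre : ∀ i, i ≤ k → ∃ j, j ≤ k ∧ b i = b (j + 1) ∧ (i = j + 1 ∨ (i = 0 ∧ j = k)) := by
    intro i hi
    cases i with
    | zero => exact ⟨k, le_rfl, by rw [h0, h1], Or.inr ⟨rfl, rfl⟩⟩
    | succ i => exact ⟨i, by omega, rfl, Or.inl rfl⟩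
  have hnotl : ∀ i j, i ≤ k → j ≤ k → b i ∉ l j := by
    intro i j hi hj hmem
    obtain ⟨t, ht, hbt, _⟩ := hpre i hi
    have hm : b i ∈ l j ++ [b (j + 1)] := List.mem_append_left _ hmem
    have hm' : b i ∈ l t ++ [b (t + 1)] := by rw [hbt]; exact hlast t
    have e := hdis j t hj ht _ hm hm'
    subst e
    have := (hseg j hj).2.1
    rw [List.nodup_append] at this
    exact this.2.2 _ hmem _ (List.mem_singleton.2 rfl) hbt
  have hbinj : ∀ i j, i ≤ k → j ≤ k → b i = b j → i = j := by
    intro i j hi hj hij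
    obtain ⟨t, ht, hbt, ht'⟩ := hpre i hi
    obtain ⟨s, hs, hbs, hs'⟩ := hpre j hj
    have e := hdis t s ht hs (b i) (by rw [hbt]; exact hlast t)
      (by rw [hij, hbs]; exact hlast s)
    omega
  choose! idx hidx1 hidx2 using hY
  choose! I hI1 hI2 using harc
  have hβ : ∀ i, i ≤ k → v i ∈ Y → b (idx (v i)) = b i := by
    intro i hi hiY
    rw [hinj _ _ (hidx1 _ hiY) hi (hidx2 _ hiY)]
  have hβ' : ∀ i, i ≤ k + 1 → v i ∈ Y → b (idx (v i)) = b i := by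
    intro i hi hiY
    by_cases h : i = k + 1
    · subst h
      rw [hv0] at hiY
      rw [hv0, hβ 0 (by omega) hiY, h0, h1]
    · exact hβ i (by omega) hiY
  have hdp : ∀ i, i ≤ k → DPath (Arc r (decide (F (v i) (v (i + 1))))) (b i) (l i) (b (i + 1)) := by
    intro i hi
    obtain ⟨a1, a2, a3⟩ := hseg i hi
    refine ⟨a1, List.nodup_cons.2 ⟨?_, a2⟩⟩
    intro hmem
    obtain ⟨t, ht, hbt, ht'⟩ := hpre i hi
    have e := hdis i t hi ht _ hmem (by rw [hbt]; exact hlast t)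
    omega
  refine ⟨fun x => b (idx x), fun x y => if F (v (I x y)) (v (I x y + 1)) then l (I x y) else
    (l (I x y)).reverse, ?_, ?_⟩
  · exact (hβ 0 (by omega) hv0Y).trans h0
  have hmemp : ∀ x y z, z ∈ (if F (v (I x y)) (v (I x y + 1)) then l (I x y) else
    (l (I x y)).reverse) → z ∈ l (I x y) := by
    intro x y z hz
    split_ifs at hz
    · exact hz
    · exact List.mem_reverse.1 hz
  refine ⟨?_, ?_, ?_, ?_, ?_, ?_⟩
  · intro x hx y hy hxy
    have := hbinj _ _ (hidx1 x hx) (hidx1 y hy) hxy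
    rw [← hidx2 x hx, ← hidx2 y hy, this]
  · intro x hx
    obtain ⟨t, ht, hbt, ht'⟩ := hpre (idx x) (hidx1 x hx)
    rw [hbt]
    exact hX ((hseg t ht).2.2 _ (hlast t))
  · intro x hx y hy hxy
    have hi := hI1 x hx y hy hxy
    have hd := hdp _ hi
    rcases hI2 x hx y hy hxy with ⟨e1, e2⟩ | ⟨e1, e2⟩
    · have hf : F (v (I x y)) (v (I x y + 1)) := by rw [← e1, ← e2]; exact hxy
      rw [if_pos hf]
      rw [decide_eq_true hf] at hd
      have c1 : b (idx x) = b (I x y) := by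
        have := hβ' (I x y) (by omega) (by rw [← e1]; exact hx)
        rwa [← e1] at this
      have c2 : b (idx y) = b (I x y + 1) := by
        have := hβ' (I x y + 1) (by omega) (by rw [← e2]; exact hy)
        rwa [← e2] at this
      rw [c1, c2]
      exact hd
    · have hf : ¬ F (v (I x y)) (v (I x y + 1)) := by rw [← e1, ← e2]; exact hF _ _ hxy
      rw [if_neg hf]
      rw [decide_eq_false hf] at hd
      have c1 : b (idx y) = b (I x y) := by
        have := hβ' (I x y) (by omega) (by rw [← e2]; exact hy)
        rwa [← e2] at this
      have c2 : b (idx x) = b (I x y + 1) := by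
        have := hβ' (I x y + 1) (by omega) (by rw [← e1]; exact hx)
        rwa [← e1] at this
      rw [c1, c2]
      exact dpath_rev hd
  · intro x hx y hy hxy z hz
    exact hX ((hseg _ (hI1 x hx y hy hxy)).2.2 z (List.mem_append_left _ (hmemp x y z hz)))
  · intro x hx y hy hxy z hz t ht hzt
    refine hnotl (idx t) (I x y) (hidx1 t ht) (hI1 x hx y hy hxy) ?_
    rw [← hzt]; exact hmemp x y z hz
  · intro x hx y hy hxy x' hx' y' hy' hxy' hne z hz hz'
    have e := hdis _ _ (hI1 x hx y hy hxy) (hI1 x' hx' y' hy' hxy') z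
      (List.mem_append_left _ (hmemp x y z hz)) (List.mem_append_left _ (hmemp x' y' z hz'))
    rcases hI2 x hx y hy hxy with ⟨e1, e2⟩ | ⟨e1, e2⟩ <;>
      rcases hI2 x' hx' y' hy' hxy' with ⟨e3, e4⟩ | ⟨e3, e4⟩ <;> rw [← e] at e3 e4
    · exact hne (Prod.ext (e1.trans e3.symm) (e2.trans e4.symm))
    · have : F y x := by rw [e2.trans e3.symm, e1.trans e4.symm]; exact hxy'
      exact hF _ _ hxy this
    · have : F y x := by rw [e2.trans e3.symm, e1.trans e4.symm]; exact hxy'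
      exact hF _ _ hxy this
    · exact hne (Prod.ext (e1.trans e3.symm) (e2.trans e4.symm))



theorem rtg_walk {G : SimpleGraph α} {T : Set α} {b z : α} (hb : b ∈ T)
    (h : ReflTransGen (InR G.Adj T) b z) : ∃ p : G.Walk b z, ∀ x ∈ p.support, x ∈ T := by
  induction h with
  | refl => exact ⟨SimpleGraph.Walk.nil, by simpa using hb⟩
  | tail _ hbc ih =>
    obtain ⟨p, hp⟩ := ih
    refine ⟨p.concat hbc.2.2, ?_⟩
    intro x hx
    rw [SimpleGraph.Walk.support_concat] at hx
    simp only [List.mem_append, List.mem_singleton] at hx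
    rcases hx with hx | hx
    · exact hp x hx
    · rw [hx]; exact hbc.2.1

theorem cyc_exists [DecidableEq α] {G : SimpleGraph α} {Y : Set α} {a b z : α} (ha : a ∈ Y)
    (hb : b ∈ Y) (hab : G.Adj a b) (haz : G.Adj a z) (hbz : b ≠ z)
    (h : ReflTransGen (InR G.Adj (Y \ {a})) b z) :
    ∃ c : G.Walk a a, c.IsCycle ∧ s(a, b) ∈ c.edges ∧ z ∈ c.support ∧ ∀ x ∈ c.support, x ∈ Y := by
  obtain ⟨p0, hp0⟩ := rtg_walk (T := Y \ {a}) ⟨hb, hab.ne'⟩ h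
  have hp1 : ∀ x ∈ p0.bypass.support, x ∈ Y \ {a} := fun x hx =>
    hp0 x (p0.support_bypass_subset_support hx)
  have hpath := p0.bypass_isPath
  generalize p0.bypass = p at hp1 hpath
  have hap : a ∉ p.support := fun h => (hp1 a h).2 rfl
  refine ⟨SimpleGraph.Walk.cons hab (p.concat haz.symm), ?_, ?_, ?_, ?_⟩
  · rw [SimpleGraph.Walk.cons_isCycle_iff]
    refine ⟨hpath.concat hap haz.symm, ?_⟩
    rw [SimpleGraph.Walk.edges_concat]
    simp only [List.concat_eq_append, List.mem_append, List.mem_singleton, not_or]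
    refine ⟨fun h => hap (p.fst_mem_support_of_mem_edges h), ?_⟩
    intro h
    rw [Sym2.eq_iff] at h
    rcases h with ⟨h1, h2⟩ | ⟨h1, h2⟩
    · exact haz.ne h1
    · exact hbz h2
  · simp
  · simp [SimpleGraph.Walk.support_concat]
  · intro x hx
    rw [SimpleGraph.Walk.support_cons, SimpleGraph.Walk.support_concat] at hx
    simp only [List.mem_cons, List.mem_append,
      List.not_mem_nil, or_false] at hx
    rcases hx with rfl | hx | rfl
    · exact ha
    · exact (hp1 x hx).1
    · exact ha

theorem cyc_cover [Finite α] [DecidableEq α] {G : SimpleGraph α}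
    (hG : ∀ (u v : α) (c₁ : G.Walk u u) (c₂ : G.Walk v v), c₁.IsCycle → c₂.IsCycle →
      ∀ x y, x ≠ y → x ∈ c₁.support → x ∈ c₂.support → y ∈ c₁.support → y ∈ c₂.support →
      ∀ e, e ∈ c₁.edges → e ∈ c₂.edges) {Y : Set α} (h3 : 3 ≤ Y.ncard)
    (hconn : ∀ u ∈ Y, ∀ a ∈ Y \ {u}, ∀ b ∈ Y \ {u}, ReflTransGen (InR G.Adj (Y \ {u})) a b)
    {a : α} (ha : a ∈ Y) : ∃ c : G.Walk a a, c.IsCycle ∧ (∀ x, x ∈ c.support ↔ x ∈ Y) ∧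
      ∀ x ∈ Y, ∀ y ∈ Y, G.Adj x y → s(x, y) ∈ c.edges := by
  have hthird : ∀ u w, ∃ z ∈ Y, z ≠ u ∧ z ≠ w := by
    intro u w
    by_contra hcon
    push Not at hcon
    have hsub : Y ⊆ {u, w} := by
      intro z hz
      by_cases h : z = u
      · exact Or.inl h
      · exact Or.inr (hcon z hz h)
    have h1 := Set.ncard_le_ncard hsub (Set.toFinite _)
    have h2 := Set.ncard_insert_le u {w}
    rw [Set.ncard_singleton] at h2
    omega
  have hnbr : ∀ u ∈ Y, u ≠ a → ∃ b ∈ Y, b ≠ u ∧ G.Adj a b := by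
    intro u hu hua
    obtain ⟨z, hz, hzu, hza⟩ := hthird u a
    rcases (hconn u hu a ⟨ha, Ne.symm hua⟩ z ⟨hz, hzu⟩).cases_head with h | ⟨b, h, _⟩
    · exact absurd h.symm hza
    · exact ⟨b, h.2.1.1, h.2.1.2, h.2.2⟩
  obtain ⟨u, hu, hua, _⟩ := hthird a a
  obtain ⟨b, hb, _, hab⟩ := hnbr u hu hua
  obtain ⟨z, hz, hzb, haz⟩ := hnbr b hb hab.ne'
  obtain ⟨c, hc, _, _, hcY⟩ := cyc_exists ha hb hab haz (Ne.symm hzb)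
    (hconn a ha b ⟨hb, hab.ne'⟩ z ⟨hz, haz.ne'⟩)
  have hcl : ∀ x ∈ c.support, ∀ y ∈ Y, G.Adj x y → s(x, y) ∈ c.edges := by
    intro x hx y hy hxy
    have hnx : ∃ z, s(x, z) ∈ c.edges := by
      obtain ⟨i, hi, hil⟩ := SimpleGraph.Walk.mem_support_iff_exists_getVert.1 hx
      have h3 := hc.three_le_length
      by_cases hi' : i < c.length
      · refine ⟨c.getVert (i + 1), ?_⟩
        rw [SimpleGraph.Walk.mk_mem_edges_iff_exists]
        exact ⟨i, hi', by rw [hi]⟩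
      · refine ⟨c.getVert 1, ?_⟩
        rw [SimpleGraph.Walk.mk_mem_edges_iff_exists]
        have : i = c.length := by omega
        rw [this, SimpleGraph.Walk.getVert_length] at hi
        exact ⟨0, by omega, by rw [SimpleGraph.Walk.getVert_zero, ← hi]⟩
    obtain ⟨z, hz⟩ := hnx
    have hxz := c.adj_of_mem_edges hz
    have hzs := c.snd_mem_support_of_mem_edges hz
    by_cases hyz : y = z
    · rw [hyz]; exact hz
    have hxY := hcY x hx
    obtain ⟨c', hc', he, hzc', _⟩ := cyc_exists hxY hy hxy hxz hyz
      (hconn x hxY y ⟨hy, hxy.ne'⟩ z ⟨hcY z hzs, hxz.ne'⟩)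
    exact hG x a c' c hc' hc x z hxz.ne (SimpleGraph.Walk.start_mem_support _) hx hzc' hzs _ he
  have hsup : ∀ y ∈ Y, y ∈ c.support := by
    intro y hy
    obtain ⟨u, hu, hua, huy⟩ := hthird a y
    have := hconn u hu a ⟨ha, Ne.symm hua⟩ y ⟨hy, Ne.symm huy⟩
    clear huy hy
    induction this with
    | refl => exact SimpleGraph.Walk.start_mem_support _
    | tail _ hbc ih =>
      exact c.snd_mem_support_of_mem_edges (hcl _ ih _ hbc.2.1.1 hbc.2.2)
  exact ⟨c, hc, fun x => ⟨hcY x, hsup x⟩, fun x hx y hy hxy => hcl x (hsup x hx) y hy hxy⟩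

theorem rp_block [Finite α] [DecidableEq α] {G : SimpleGraph α} {F : α → α → Prop}
    (hF : ∀ a b, F a b → ¬ F b a) (hFG : ∀ a b, F a b → G.Adj a b)
    (hG : ∀ (u v : α) (c₁ : G.Walk u u) (c₂ : G.Walk v v), c₁.IsCycle → c₂.IsCycle →
      ∀ x y, x ≠ y → x ∈ c₁.support → x ∈ c₂.support → y ∈ c₁.support → y ∈ c₂.support →
      ∀ e, e ∈ c₁.edges → e ∈ c₂.edges) {Y : Set α} {k : ℕ} (h2 : 2 ≤ k) (hk : Y.ncard = k + 1)
    (hconn : ∀ u ∈ Y, ∀ a ∈ Y \ {u}, ∀ b ∈ Y \ {u}, ReflTransGen (InR G.Adj (Y \ {u})) a b)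
    {a : α} (ha : a ∈ Y) : RP F Y a k := by
  obtain ⟨c, hc, hsup, hed⟩ := cyc_cover hG (by omega) hconn ha
  have h3 := hc.three_le_length
  have hinj := hc.getVert_injOn'
  have hidx : ∀ x ∈ Y, ∃ i, i ≤ c.length - 1 ∧ c.getVert i = x := by
    intro x hx
    obtain ⟨i, hi, hil⟩ := SimpleGraph.Walk.mem_support_iff_exists_getVert.1 ((hsup x).2 hx)
    by_cases h : i = c.length
    · rw [h, SimpleGraph.Walk.getVert_length] at hi
      exact ⟨0, by omega, by simpa using hi⟩
    · exact ⟨i, by omega, hi⟩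
  have hYe : Y = c.getVert '' {i | i ≤ c.length - 1} := by
    ext x
    constructor
    · intro hx
      obtain ⟨i, h1, h2⟩ := hidx x hx
      exact ⟨i, h1, h2⟩
    · rintro ⟨i, hi, rfl⟩
      exact (hsup _).1 (c.getVert_mem_support i)
  have hlen : c.length = k + 1 := by
    have : Y.ncard = c.length := by
      rw [hYe, Set.InjOn.ncard_image hinj]
      have : {i | i ≤ c.length - 1} = ((Finset.range c.length : Finset ℕ) : Set ℕ) := by
        ext i
        simp
        omega
      rw [this, Set.ncard_coe_finset, Finset.card_range]
    omega
  have hlen' : c.length - 1 = k := by omega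
  rw [hlen'] at hinj hidx
  have := rp_cycle hF (Y := Y) h2 c.getVert
    (by rw [← hlen, SimpleGraph.Walk.getVert_length, SimpleGraph.Walk.getVert_zero])
    (by rw [SimpleGraph.Walk.getVert_zero]; exact ha) hidx
    (fun i j hi hj hij => hinj hi hj hij) (by
      intro x hx y hy hxy
      have h5 := hed x hx y hy (hFG x y hxy)
      rw [SimpleGraph.Walk.mk_mem_edges_iff_exists] at h5
      obtain ⟨i, hil, hi⟩ := h5
      refine ⟨i, by omega, ?_⟩
      rw [Sym2.eq_iff] at hi
      rcases hi with ⟨h6, h7⟩ | ⟨h6, h7⟩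
      · exact Or.inl ⟨h6.symm, h7.symm⟩
      · exact Or.inr ⟨h7.symm, h6.symm⟩)
  rwa [SimpleGraph.Walk.getVert_zero] at this

theorem rp_all [Finite α] [DecidableEq α] {G : SimpleGraph α} {F : α → α → Prop}
    (hF : ∀ a b, F a b → ¬ F b a) (hFG : ∀ a b, F a b → G.Adj a b)
    (hG : ∀ (u v : α) (c₁ : G.Walk u u) (c₂ : G.Walk v v), c₁.IsCycle → c₂.IsCycle →
      ∀ x y, x ≠ y → x ∈ c₁.support → x ∈ c₂.support → y ∈ c₁.support → y ∈ c₂.support →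
      ∀ e, e ∈ c₁.edges → e ∈ c₂.edges) :
    ∀ (n : ℕ) (Y : Set α), Y.ncard = n + 1 → ∀ v ∈ Y, RP F Y v n := by
  intro n
  induction n using Nat.strong_induction_on with
  | _ n ih =>
  intro Y hY v hv
  by_cases hn0 : n = 0
  · subst hn0
    obtain ⟨w, rfl⟩ := Set.ncard_eq_one.1 hY
    rw [Set.mem_singleton_iff] at hv
    subst hv
    exact rp_single hF v
  by_cases hn1 : n = 1
  · subst hn1
    obtain ⟨x, y, hxy, rfl⟩ := Set.ncard_eq_two.1 hY
    rcases hv with rfl | hv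
    · exact rp_pair hF v y hxy
    · rw [Set.mem_singleton_iff] at hv
      subst hv
      rw [Set.pair_comm]
      exact rp_pair hF v x hxy.symm
  by_cases hconn : ∀ u ∈ Y, ∀ a ∈ Y \ {u}, ∀ b ∈ Y \ {u},
      ReflTransGen (InR G.Adj (Y \ {u})) a b
  · exact rp_block hF hFG hG (by omega) hY hconn hv
  push Not at hconn
  obtain ⟨u, hu, a, ha, b, hb, hnab⟩ := hconn
  have hsplit : ∀ P Q : Set α, P ∪ Q = Y \ {u} → Disjoint P Q → P.Nonempty → Q.Nonempty →
      (∀ x ∈ P, ∀ y ∈ Q, ¬ G.Adj x y) → v ∈ insert u P → RP F Y v n := by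
    intro P Q hPQ hdis hP hQ hno hvP
    have huP : u ∉ P := fun h => (hPQ.subset (Or.inl h)).2 rfl
    have huQ : u ∉ Q := fun h => (hPQ.subset (Or.inr h)).2 rfl
    have hcard : P.ncard + Q.ncard = n := by
      rw [← Set.ncard_union_eq hdis (Set.toFinite _) (Set.toFinite _), hPQ,
        Set.ncard_sdiff_singleton_of_mem hu, hY]
      omega
    have hP1 := (Set.ncard_pos (Set.toFinite _)).2 hP
    have hQ1 := (Set.ncard_pos (Set.toFinite _)).2 hQ
    have hYe : Y = insert u P ∪ insert u Q := by
      ext x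
      have := Set.ext_iff.1 hPQ x
      simp only [Set.mem_union, Set.mem_sdiff, Set.mem_singleton_iff, Set.mem_insert_iff] at this ⊢
      by_cases hxu : x = u
      · simp [hxu, hu]
      · tauto
    have H1 := ih P.ncard (by omega) (insert u P)
      (Set.ncard_insert_of_notMem huP (Set.toFinite _)) v hvP
    have H2 := ih Q.ncard (by omega) (insert u Q)
      (Set.ncard_insert_of_notMem huQ (Set.toFinite _)) u (Set.mem_insert _ _)
    rw [hYe, ← hcard]
    refine rp_glue hF (u := u) (Set.mem_insert _ _) (Set.mem_insert _ _) ?_ hvP ?_ H1 H2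
    · rintro x (hx | hx) (hx' | hx')
      · exact hx
      · exact hx
      · exact hx'
      · exact absurd hx' (Set.disjoint_left.1 hdis hx)
    · rintro x ((hx | hx) | (hx | hx)) y ((hy | hy) | (hy | hy)) hxy
      · exact Or.inl ⟨Or.inl hx, Or.inl hy⟩
      · exact Or.inl ⟨Or.inl hx, Or.inr hy⟩
      · exact Or.inl ⟨Or.inl hx, Or.inl hy⟩
      · exact Or.inr ⟨Or.inl hx, Or.inr hy⟩
      · exact Or.inl ⟨Or.inr hx, Or.inl hy⟩
      · exact Or.inl ⟨Or.inr hx, Or.inr hy⟩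
      · exact Or.inl ⟨Or.inr hx, Or.inl hy⟩
      · exact absurd (hFG _ _ hxy) (hno x hx y hy)
      · exact Or.inl ⟨Or.inl hx, Or.inl hy⟩
      · exact Or.inl ⟨Or.inl hx, Or.inr hy⟩
      · exact Or.inl ⟨Or.inl hx, Or.inl hy⟩
      · exact Or.inr ⟨Or.inl hx, Or.inr hy⟩
      · exact Or.inr ⟨Or.inr hx, Or.inl hy⟩
      · exact absurd (hFG _ _ hxy).symm (hno y hy x hx)
      · exact Or.inr ⟨Or.inr hx, Or.inl hy⟩
      · exact Or.inr ⟨Or.inr hx, Or.inr hy⟩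
  let P : Set α := {x | x ∈ Y \ {u} ∧ ReflTransGen (InR G.Adj (Y \ {u})) a x}
  let Q : Set α := {x | x ∈ Y \ {u} ∧ ¬ ReflTransGen (InR G.Adj (Y \ {u})) a x}
  have hPQ : P ∪ Q = Y \ {u} := by
    ext x
    constructor
    · rintro (h | h) <;> exact h.1
    · intro h
      by_cases h' : ReflTransGen (InR G.Adj (Y \ {u})) a x
      · exact Or.inl ⟨h, h'⟩
      · exact Or.inr ⟨h, h'⟩
  have hdis : Disjoint P Q := Set.disjoint_left.2 (fun x hx hx' => hx'.2 hx.2)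
  have hPn : P.Nonempty := ⟨a, ha, ReflTransGen.refl⟩
  have hQn : Q.Nonempty := ⟨b, hb, hnab⟩
  have hno : ∀ x ∈ P, ∀ y ∈ Q, ¬ G.Adj x y := fun x hx y hy hxy =>
    hy.2 (hx.2.tail ⟨hx.1, hy.1, hxy⟩)
  by_cases hvP : v ∈ insert u P
  · exact hsplit P Q hPQ hdis hPn hQn hno hvP
  · refine hsplit Q P (by rw [Set.union_comm]; exact hPQ) hdis.symm hQn hPn
      (fun x hx y hy hxy => hno y hy x hx hxy.symm) ?_
    have hvu : v ≠ u := fun h => hvP (Or.inl h)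
    rcases hPQ.symm.subset ⟨hv, hvu⟩ with h | h
    · exact absurd (Or.inr h) hvP
    · exact Or.inr h

end CM

theorem mader_upper {m : ℕ} (hm : 0 < m) (G : SimpleGraph (Fin m))
    (hG : IsCactus G) (D : Digraph' (Fin m)) (hD : IsOrientationOf D G) :
    Digraph'.MaderBound D m := by
  intro n D' hl hdi
  have hrp := CM.rp_all (G := G) (F := D.Adj)
    (fun a b h h' => (hD.2 a b (hD.1 a b h)).2 ⟨h, h'⟩) hD.1
    (by
      intro u v c₁ c₂ h₁ h₂ x y hxy hx1 hx2 hy1 hy2 e he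
      have := hG u v c₁ c₂ h₁ h₂ x y hxy hx1 hx2 hy1 hy2
      rw [← List.mem_toFinset, ← this, List.mem_toFinset]
      exact he) (m - 1) Set.univ (by
      rw [Set.ncard_univ, Nat.card_fin]; omega) ⟨0, hm⟩ (Set.mem_univ _)
  obtain ⟨A, -, hcol, hA⟩ := hrp (Fin n) D'.Adj hl Set.univ
  rcases Set.eq_empty_or_nonempty A with rfl | ⟨a, ha⟩
  · exfalso
    obtain ⟨φ, hφ, hval⟩ := hcol
    have hmem : ∀ v, v ∈ (Set.univ \ ∅ : Set (Fin n)) := fun v => by simp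
    have hle : D'.dichromaticNumber ≤ m - 1 := by
      refine Nat.sInf_le ⟨fun v => ⟨φ v, hφ v (hmem v)⟩, ?_⟩
      intro i v hv
      refine hval i.1 v (Relation.TransGen.mono ?_ _ _ hv)
      rintro x y ⟨hx, hy, hxy⟩
      refine ⟨⟨hmem x, ?_⟩, ⟨hmem y, ?_⟩, hxy⟩
      · exact congrArg Fin.val hx
      · exact congrArg Fin.val hy
    omega
  · obtain ⟨β, p, -, hs⟩ := hA a ha
    refine ⟨β, fun a b _ => p a b, ?_, ?_, ?_, ?_⟩
    · intro x y hxy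
      exact hs.inj (Set.mem_univ _) (Set.mem_univ _) hxy
    · intro a b h
      exact hs.path a (Set.mem_univ _) b (Set.mem_univ _) h
    · rintro a b h x hx ⟨c, rfl⟩
      exact hs.pint a (Set.mem_univ _) b (Set.mem_univ _) h _ hx c (Set.mem_univ _) rfl
    · intro a b h a' b' h' hne x hx
      exact hs.dis a (Set.mem_univ _) b (Set.mem_univ _) h a' (Set.mem_univ _) b'
        (Set.mem_univ _) h' hne x hx

theorem complete_dichromatic (n : ℕ) :
    n ≤ (⟨fun a b => a ≠ b⟩ : Digraph' (Fin n)).dichromaticNumber := by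
  refine le_csInf ⟨n, id, ?_⟩ ?_
  · intro i v hv
    obtain ⟨w, hvw⟩ := Relation.TransGen.head'_iff.1 hv
    obtain ⟨⟨h1, h2, h3⟩, -⟩ := hvw
    exact h3 (Eq.trans h1 (Eq.symm h2))
  · rintro k ⟨c, hc⟩
    have hinj : Function.Injective c := by
      intro x y hxy
      by_contra hne
      exact hc (c x) x (.tail (.single ⟨rfl, hxy.symm, hne⟩) ⟨hxy.symm, rfl, Ne.symm hne⟩)
    simpa using Fintype.card_le_of_injective c hinj

/-- For every orientation `F` of a cactus graph,
`mader(F) = v(F)`. -/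
theorem cactus_orientation_mader {m : ℕ} (hm : 0 < m) (G : SimpleGraph (Fin m))
    (hG : IsCactus G) (D : Digraph' (Fin m)) (hD : IsOrientationOf D G) :
    Digraph'.mader D = m := by
  have hub : m ∈ {k : ℕ | 1 ≤ k ∧ Digraph'.MaderBound D k} := ⟨hm, mader_upper hm G hG D hD⟩
  refine le_antisymm (Nat.sInf_le hub) (le_csInf ⟨m, hub⟩ ?_)
  rintro k ⟨-, hk⟩
  by_contra hlt
  have hle : k ≤ m - 1 := by omega
  obtain ⟨β, p, hβ, -⟩ := hk (m - 1) ⟨fun a b => a ≠ b⟩ (fun v h => h rfl)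
    (hle.trans (complete_dichromatic (m - 1)))
  have := Fintype.card_le_of_injective β hβ
  simp only [Fintype.card_fin] at this
  omega
end

section
/- If C is any orientation of the undirected cycle C_ℓ of length ℓ ≥ 3, then mader_χ⃗(C) = ℓ; in particular, every digraph with dichromatic number at least ℓ contains a subdivision of C. (This settles the conjecture of Aboulker, Cohen, Havet, Lochet, Moura and Thomassé.) -/
namespace CycMader

open Digraph' Relation

variable {V : Type}

/-- Arcs of `D` inside `S`. -/
def RIn (D : Digraph' V) (S : Set V) : V → V → Prop := fun x y => x ∈ S ∧ y ∈ S ∧ D.Adj x y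

def Strong (D : Digraph' V) (S : Set V) : Prop :=
  ∀ x ∈ S, ∀ y ∈ S, ReflTransGen (RIn D S) x y

/-- Strong component of `v` in `D[T]`. -/
def Comp (D : Digraph' V) (T : Set V) (v : V) : Set V :=
  {u | u ∈ T ∧ ReflTransGen (RIn D T) v u ∧ ReflTransGen (RIn D T) u v}

def Leg (D : Digraph' V) (dir : Prop) (x : V) (l : List V) (y : V) : Prop :=
  (dir ∧ D.IsDipath x l y) ∨ (¬ dir ∧ D.IsDipath y l x)

/-- A subdivided oriented path in `S` from `r` to `z` whose `j`-th segment (`d ≤ j < e`)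
has direction `w j`. -/
def PP (D : Digraph' V) (w : ℕ → Prop) (S : Set V) (d e : ℕ) (r z : V) : Prop :=
  ∃ (b : ℕ → V) (q : ℕ → List V), b d = r ∧ b e = z ∧
    (∀ j, d ≤ j → j ≤ e → b j ∈ S) ∧
    (∀ i j, d ≤ i → i ≤ e → d ≤ j → j ≤ e → b i = b j → i = j) ∧
    (∀ j, d ≤ j → j < e → Leg D (w j) (b j) (q j) (b (j+1))) ∧
    (∀ j, d ≤ j → j < e → ∀ x ∈ q j, x ∈ S) ∧
    (∀ j, d ≤ j → j < e → ∀ x ∈ q j, ∀ i, d ≤ i → i ≤ e → x ≠ b i) ∧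
    (∀ i j, d ≤ i → i < e → d ≤ j → j < e → ∀ x, x ∈ q i → x ∈ q j → i = j)

def Acyc (D : Digraph' V) (m : ℕ) (T : Set V) (h : V → ℕ) : Prop :=
  ∀ i, D.AcyclicOn {v | v ∈ T ∧ h v % m = i}

theorem comp_strong (D : Digraph' V) (T : Set V) (v : V) : Strong D (Comp D T v) := by
  intro x hx y hy
  have hxy : ReflTransGen (RIn D T) x y := hx.2.2.trans hy.2.1
  revert hx
  induction hxy using ReflTransGen.head_induction_on with
  | refl => intro _; exact .refl
  | head h1 h2 ih =>
    intro hx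
    have h3 : _ ∈ Comp D T v := ⟨h1.2.1, hx.2.1.tail h1, h2.trans hy.2.2⟩
    exact (ih h3).head ⟨hx, h3, h1.2.2⟩

theorem comp_self {D : Digraph' V} {T : Set V} {v : V} (hv : v ∈ T) : v ∈ Comp D T v :=
  ⟨hv, .refl, .refl⟩

theorem comp_eq {D : Digraph' V} {T : Set V} {u v : V} (hu : u ∈ Comp D T v) :
    Comp D T u = Comp D T v := by
  ext x
  constructor
  · rintro ⟨a, b, c⟩
    exact ⟨a, hu.2.1.trans b, c.trans hu.2.2⟩
  · rintro ⟨a, b, c⟩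
    exact ⟨a, hu.2.2.trans b, c.trans hu.2.1⟩

theorem path_to (R : V → V → Prop) (K : Set V) {x y : V} (hxy : ReflTransGen R x y)
    (hx : x ∉ K) (hy : y ∈ K) :
    ∃ y' ∈ K, ∃ l : List V, (x :: l ++ [y']).IsChain R ∧ (x :: l ++ [y']).Nodup ∧
      ∀ v ∈ l, v ∉ K := by
  induction hxy using ReflTransGen.head_induction_on with
  | refl => exact absurd hy hx
  | @head a c h1 h2 ih =>
    by_cases hc : c ∈ K
    · refine ⟨c, hc, [], ?_, ?_, by simp⟩
      · simpa using h1
      · have : a ≠ c := fun h => hx (h ▸ hc)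
        simpa using this
    · obtain ⟨y', hy', l, hl1, hl2, hl3⟩ := ih hc
      by_cases hal : a ∈ c :: l
      · obtain ⟨s, t, hst⟩ := List.append_of_mem hal
        have e : c :: l ++ [y'] = s ++ (a :: t ++ [y']) := by rw [hst]; simp
        rw [e] at hl1 hl2
        refine ⟨y', hy', t, hl1.right_of_append, (List.nodup_append.1 hl2).2.1, ?_⟩
        intro v hv
        have : v ∈ c :: l := by rw [hst]; simp [hv]
        rcases List.mem_cons.1 this with rfl | h
        · exact hc
        · exact hl3 v h
      · refine ⟨y', hy', c :: l, ?_, ?_, ?_⟩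
        · simp only [List.cons_append] at hl1 ⊢
          exact List.isChain_cons_cons.2 ⟨h1, hl1⟩
        · rw [List.cons_append, List.nodup_cons]
          refine ⟨?_, hl2⟩
          have : a ≠ y' := fun h => hx (h ▸ hy')
          simp only [List.mem_append, List.mem_singleton, not_or]
          exact ⟨hal, this⟩
        · intro v hv
          rcases List.mem_cons.1 hv with rfl | h
          · exact hc
          · exact hl3 v h

theorem chain_mem {R : V → V → Prop} {S : Set V} (hR : ∀ a b, R a b → b ∈ S) (x : V)
    (l : List V) (h : (x :: l).IsChain R) : ∀ v ∈ l, v ∈ S := by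
  induction l generalizing x with
  | nil => simp
  | cons a l ih =>
    rw [List.isChain_cons_cons] at h
    intro v hv
    rcases List.mem_cons.1 hv with rfl | h'
    · exact hR _ _ h.1
    · exact ih a h.2 v h'

theorem leg_to (D : Digraph' V) {S : Set V} (hS : Strong D S) (K : Set V) (dir : Prop) {x y : V}
    (hxS : x ∈ S) (hyS : y ∈ S) (hx : x ∉ K) (hy : y ∈ K) :
    ∃ y' ∈ K, ∃ l : List V, Leg D dir x l y' ∧ x ∉ l ∧ ∀ v ∈ l, v ∈ S ∧ v ∉ K := by
  by_cases hd : dir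
  · obtain ⟨y', hy', l, h1, h2, h3⟩ := path_to _ K (hS x hxS y hyS) hx hy
    refine ⟨y', hy', l, .inl ⟨hd, h1.imp fun a b h => h.2.2, h2⟩, ?_, ?_⟩
    · intro hh
      simp [hh] at h2
    · intro v hv
      exact ⟨chain_mem (S := S) (fun a b h => h.2.1) x (l ++ [y']) h1 v (by simp [hv]), h3 v hv⟩
  · obtain ⟨y', hy', l, h1, h2, h3⟩ :=
      path_to (Function.swap (RIn D S)) K (reflTransGen_swap.2 (hS y hyS x hxS)) hx hy
    have e : y' :: l.reverse ++ [x] = (x :: l ++ [y']).reverse := by simp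
    refine ⟨y', hy', l.reverse, .inr ⟨hd, ?_, ?_⟩, ?_, ?_⟩
    · rw [e]
      exact List.isChain_reverse.2 (h1.imp fun a b h => h.2.2)
    · rw [e]
      exact List.nodup_reverse.2 h2
    · intro hh
      simp at hh
      simp [hh] at h2
    · intro v hv
      have hv : v ∈ l := by simpa using hv
      exact ⟨chain_mem (S := S) (fun a b h => h.1) x (l ++ [y']) h1 v (by simp [hv]), h3 v hv⟩

theorem pp_one {D : Digraph' V} {w : ℕ → Prop} {S : Set V} {d : ℕ} {r z : V} {l : List V}
    (hr : r ∈ S) (hz : z ∈ S) (hrz : r ≠ z) (hl : Leg D (w d) r l z) (hrl : r ∉ l)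
    (hlS : ∀ v ∈ l, v ∈ S ∧ v ≠ z) : PP D w S d (d+1) r z := by
  refine ⟨fun j => if j = d then r else z, fun _ => l, by simp, by simp, ?_, ?_, ?_, ?_, ?_, ?_⟩
  · intro j _ _
    dsimp only
    split_ifs <;> assumption
  · intro i j h1 h2 h3 h4 h
    dsimp only at h
    split_ifs at h with h5 h6 h6
    · omega
    · exact absurd h hrz
    · exact absurd h.symm hrz
    · omega
  · intro j h1 h2
    have : j = d := by omega
    subst this
    simpa using hl
  · intro j _ _ x hx
    exact (hlS x hx).1
  · intro j _ _ x hx i _ _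
    dsimp only
    split_ifs
    · rintro rfl
      exact hrl hx
    · exact (hlS x hx).2
  · intros
    omega

theorem pp_cons {D : Digraph' V} {w : ℕ → Prop} {S K : Set V} {d e : ℕ} {r r' z : V} {l : List V}
    (hKS : K ⊆ S) (hr : r ∈ S) (hrK : r ∉ K) (hl : Leg D (w d) r l r') (hrl : r ∉ l)
    (hlS : ∀ v ∈ l, v ∈ S ∧ v ∉ K) (hde : d + 1 ≤ e) (hp : PP D w K (d+1) e r' z) :
    PP D w S d e r z := by
  obtain ⟨b, q, h1, h2, h3, h4, h5, h6, h7, h8⟩ := hp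
  refine ⟨fun j => if j = d then r else b j, fun j => if j = d then l else q j,
    by simp, ?_, ?_, ?_, ?_, ?_, ?_, ?_⟩
  · have : e ≠ d := by omega
    simpa [this] using h2
  · intro j hj hj'
    dsimp only
    split_ifs with h
    · exact hr
    · exact hKS (h3 j (by omega) hj')
  · intro i j i1 i2 j1 j2 h
    dsimp only at h
    split_ifs at h with h5 h6 h6
    · omega
    · exact absurd (h ▸ h3 j (by omega) j2) hrK
    · exact absurd (h ▸ h3 i (by omega) i2) hrK
    · exact h4 i j (by omega) i2 (by omega) j2 h
  · intro j j1 j2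
    by_cases h : j = d
    · subst h
      simpa [h1] using hl
    · have h' : j + 1 ≠ d := by omega
      simpa [h, h'] using h5 j (by omega) j2
  · intro j j1 j2 x hx
    dsimp only at hx
    split_ifs at hx with h
    · exact (hlS x hx).1
    · exact hKS (h6 j (by omega) j2 x hx)
  · intro j j1 j2 x hx i i1 i2
    dsimp only at hx ⊢
    split_ifs at hx ⊢ with h h' h'
    · rintro rfl
      exact hrl hx
    · rintro rfl
      exact hrK (h6 j (by omega) j2 _ hx)
    · rintro rfl
      exact (hlS _ hx).2 (h3 i (by omega) i2)
    · exact h7 j (by omega) j2 x hx i (by omega) i2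
  · intro i j i1 i2 j1 j2 x hi hj
    dsimp only at hi hj
    split_ifs at hi hj with h h' h'
    · omega
    · exact absurd (h6 j (by omega) j2 x hj) (hlS x hi).2
    · exact absurd (h6 i (by omega) i2 x hi) (hlS x hj).2
    · exact h8 i j (by omega) i2 (by omega) j2 x hi hj

theorem acyc_of_comp (D : Digraph' V) (m : ℕ) (T : Set V) (h : V → ℕ)
    (H : ∀ v ∈ T, Acyc D m (Comp D T v) h) : Acyc D m T h := by
  intro i v hv
  have hvT : v ∈ T := by
    obtain ⟨c, hc, -⟩ := TransGen.head'_iff.1 hv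
    exact hc.1.1
  refine H v hvT i v ?_
  have mono : ∀ {x y}, TransGen (fun x y => x ∈ {v | v ∈ T ∧ h v % m = i} ∧
      y ∈ {v | v ∈ T ∧ h v % m = i} ∧ D.Adj x y) x y → ReflTransGen (RIn D T) x y := by
    intro x y hxy
    exact (TransGen.lift (p := RIn D T) id
      (fun a b hab => ⟨hab.1.1, hab.2.1.1, hab.2.2⟩) _ _ hxy).to_reflTransGen
  have key : ∀ x, TransGen (fun x y => x ∈ {v | v ∈ T ∧ h v % m = i} ∧
      y ∈ {v | v ∈ T ∧ h v % m = i} ∧ D.Adj x y) x v → x ∈ Comp D T v →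
      TransGen (fun x y => x ∈ {u | u ∈ Comp D T v ∧ h u % m = i} ∧
      y ∈ {u | u ∈ Comp D T v ∧ h u % m = i} ∧ D.Adj x y) x v := by
    intro x hx
    induction hx using TransGen.head_induction_on with
    | single h1 =>
      intro hx
      exact .single ⟨⟨hx, h1.1.2⟩, ⟨comp_self hvT, h1.2.1.2⟩, h1.2.2⟩
    | head h1 h2 ih =>
      intro hx
      have hc : _ ∈ Comp D T v :=
        ⟨h1.2.1.1, hx.2.1.tail ⟨h1.1.1, h1.2.1.1, h1.2.2⟩, mono h2⟩
      exact TransGen.head ⟨⟨hx, h1.1.2⟩, ⟨hc, h1.2.1.2⟩, h1.2.2⟩ (ih hc)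
  exact key v hv (comp_self hvT)

theorem acyc_congr {D : Digraph' V} {m : ℕ} {T : Set V} {h h' : V → ℕ}
    (e : ∀ u ∈ T, h u = h' u) (H : Acyc D m T h') : Acyc D m T h := by
  intro i
  have : {v | v ∈ T ∧ h v % m = i} = {v | v ∈ T ∧ h' v % m = i} := by
    ext u
    constructor
    · rintro ⟨a, b⟩
      exact ⟨a, by rw [← e u a]; exact b⟩
    · rintro ⟨a, b⟩
      exact ⟨a, by rw [e u a]; exact b⟩
  rw [this]
  exact H i

theorem glue (D : Digraph' V) (m : ℕ) (T : Set V) (Q : Set V → (V → ℕ) → Prop)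
    (H : ∀ v ∈ T, ∃ h, Q (Comp D T v) h ∧ Acyc D m (Comp D T v) h) :
    ∃ h, (∀ v ∈ T, ∃ h', Q (Comp D T v) h' ∧ ∀ u ∈ Comp D T v, h u = h' u) ∧ Acyc D m T h := by
  classical
  have H' : ∀ K : Set V, ∃ h : V → ℕ, (∃ v ∈ T, K = Comp D T v) → Q K h ∧ Acyc D m K h := by
    intro K
    by_cases hK : ∃ v ∈ T, K = Comp D T v
    · obtain ⟨v, hv, rfl⟩ := hK
      obtain ⟨h, hh⟩ := H v hv
      exact ⟨h, fun _ => hh⟩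
    · exact ⟨fun _ => 0, fun h => absurd h hK⟩
  choose g hg using H'
  have e : ∀ v ∈ T, ∀ u ∈ Comp D T v, g (Comp D T u) u = g (Comp D T v) u := by
    intro v _ u hu
    rw [comp_eq hu]
  refine ⟨fun u => g (Comp D T u) u, ?_, ?_⟩
  · intro v hv
    exact ⟨g (Comp D T v), (hg _ ⟨v, hv, rfl⟩).1, e v hv⟩
  · apply acyc_of_comp
    intro v hv
    exact acyc_congr (e v hv) (hg _ ⟨v, hv, rfl⟩).2

theorem main_lemma [Finite V] (D : Digraph' V) (hD : D.Loopless) (w : ℕ → Prop) (m : ℕ)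
    (hm : 1 ≤ m)
    (hno : ∀ d r z z', PP D w Set.univ d (d+m) r z → PP D w Set.univ d (d+m) r z' →
      D.Adj r z → D.Adj z' r → False)
    (S : Set V) : ∀ (r : V) (d : ℕ), r ∈ S → Strong D S →
    ∃ h : V → ℕ, (h r = d ∧ (∀ z ∈ S, z ≠ r → d < h z) ∧
      (∀ z ∈ S, ∀ e, d < e → e ≤ h z → PP D w S d e r z)) ∧ Acyc D m S h := by
  classical
  induction S using WellFoundedLT.induction with
  | ind S ih =>
  intro r d hr hS
  obtain ⟨h, h1, h2⟩ := glue D m (S \ {r}) (fun K h => ∃ r' ∈ K, ∃ l, Leg D (w d) r l r' ∧ r ∉ l ∧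
      (∀ v ∈ l, v ∈ S ∧ v ∉ K) ∧ (∀ z ∈ K, d < h z) ∧
      (∀ z ∈ K, ∀ e, d + 1 < e → e ≤ h z → PP D w K (d+1) e r' z)) (by
    intro v hv
    have hvK := comp_self (D := D) hv
    have hrK : r ∉ Comp D (S \ {r}) v := fun h => h.1.2 rfl
    obtain ⟨r', hr', l, a1, a2, a3⟩ := leg_to D hS (Comp D (S \ {r}) v) (w d) hr hv.1 hrK hvK
    have hlt : Comp D (S \ {r}) v < S :=
      lt_of_le_not_ge (fun x hx => hx.1.1) (fun hle => hrK (hle hr))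
    obtain ⟨h, ⟨b1, b2, b3⟩, b4⟩ := ih _ hlt r' (d+1) hr' (comp_strong D _ v)
    refine ⟨h, ⟨r', hr', l, a1, a2, a3, ?_, b3⟩, b4⟩
    intro z hz
    by_cases hzr : z = r'
    · subst hzr
      omega
    · have := b2 z hz hzr
      omega)
  have hgt : ∀ z ∈ S, z ≠ r → d < h z := by
    intro z hz hzr
    obtain ⟨h', ⟨r', hr', l, a1, a2, a3, a4, a5⟩, a6⟩ := h1 z ⟨hz, hzr⟩
    rw [a6 z (comp_self ⟨hz, hzr⟩)]
    exact a4 z (comp_self ⟨hz, hzr⟩)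
  have hpp : ∀ z ∈ S, z ≠ r → ∀ e, d < e → e ≤ h z → PP D w S d e r z := by
    intro z hz hzr e e1 e2
    obtain ⟨h', ⟨r', hr', l, a1, a2, a3, a4, a5⟩, a6⟩ := h1 z ⟨hz, hzr⟩
    have hzK := comp_self (D := D) (T := S \ {r}) ⟨hz, hzr⟩
    rw [a6 z hzK] at e2
    rcases Nat.lt_or_ge (d+1) e with he | he
    · exact pp_cons (fun x hx => hx.1.1) hr (fun h => h.1.2 rfl) a1 a2 a3 (by omega)
        (a5 z hzK e he e2)
    · have : e = d + 1 := by omega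
      subst this
      obtain ⟨z', hz', l, c1, c2, c3⟩ := leg_to D hS {z} (w d) hr hz (fun h => hzr h.symm) rfl
      have hz' : z' = z := hz'
      subst hz'
      exact pp_one hr hz (Ne.symm hzr) c1 c2 c3
  have upd : ∀ z, z ≠ r → Function.update h r d z = h z := fun z hz => by simp [hz]
  refine ⟨Function.update h r d, ⟨by simp, ?_, ?_⟩, ?_⟩
  · intro z hz hzr
    rw [upd z hzr]
    exact hgt z hz hzr
  · intro z hz e e1 e2
    by_cases hzr : z = r
    · subst hzr
      simp at e2
      omega
    · rw [upd z hzr] at e2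
      exact hpp z hz hzr e e1 e2
  · have h2' : Acyc D m (S \ {r}) (Function.update h r d) :=
      acyc_congr (fun u hu => upd u hu.2) h2
    set g := Function.update h r d with hgdef
    have hgr : g r = d := by simp [hgdef]
    intro i v hv
    -- the cycle must go through `r`
    by_cases hcyc : TransGen (fun x y => x ∈ {v | v ∈ S ∧ g v % m = i} ∧
        y ∈ {v | v ∈ S ∧ g v % m = i} ∧ D.Adj x y) r r
    · obtain ⟨z, hz, -⟩ := TransGen.head'_iff.1 hcyc
      obtain ⟨z', -, hz'⟩ := TransGen.tail'_iff.1 hcyc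
      have far : ∀ u, u ∈ S → u ≠ r → g u % m = i → PP D w Set.univ d (d+m) r u := by
        intro u hu hur hui
        have l1 : d < h u := hgt u hu hur
        have l2 : d % m = h u % m := by
          rw [← upd u hur, hui, ← hgr]
          exact hz.1.2
        have l3 : d + m ≤ h u := by
          have := (Nat.modEq_iff_dvd' l1.le).1 l2
          have := Nat.le_of_dvd (by omega) this
          omega
        obtain ⟨b, q, p1, p2, p3, p4, p5, p6, p7, p8⟩ := hpp u hu hur (d+m) (by omega) l3
        exact ⟨b, q, p1, p2, fun _ _ _ => trivial, p4, p5, fun _ _ _ _ _ => trivial, p7, p8⟩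
      have n1 : z ≠ r := by
        rintro rfl
        exact hD _ hz.2.2
      have n2 : z' ≠ r := by
        rintro rfl
        exact hD _ hz'.2.2
      exact hno d r z z' (far z hz.2.1.1 n1 hz.2.1.2) (far z' hz'.1.1 n2 hz'.1.2) hz.2.2 hz'.2.2
    · refine h2' i v ?_
      have key : ∀ x, ReflTransGen (fun x y => x ∈ {v | v ∈ S ∧ g v % m = i} ∧
          y ∈ {v | v ∈ S ∧ g v % m = i} ∧ D.Adj x y) v x → TransGen (fun x y => x ∈ {v | v ∈ S ∧ g v % m = i} ∧
          y ∈ {v | v ∈ S ∧ g v % m = i} ∧ D.Adj x y) x v → x ≠ r := by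
        rintro x hx1 hx2 rfl
        exact hcyc (hx2.trans_left hx1)
      have hvr : v ≠ r := key v .refl hv
      have key2 : ∀ x, TransGen (fun x y => x ∈ {v | v ∈ S ∧ g v % m = i} ∧
          y ∈ {v | v ∈ S ∧ g v % m = i} ∧ D.Adj x y) x v →
          ReflTransGen (fun x y => x ∈ {v | v ∈ S ∧ g v % m = i} ∧
          y ∈ {v | v ∈ S ∧ g v % m = i} ∧ D.Adj x y) v x →
          TransGen (fun x y => x ∈ {v | v ∈ S \ {r} ∧ g v % m = i} ∧
          y ∈ {v | v ∈ S \ {r} ∧ g v % m = i} ∧ D.Adj x y) x v := by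
        intro x hx
        induction hx using TransGen.head_induction_on with
        | single a =>
          intro hx
          exact .single ⟨⟨⟨a.1.1, key _ hx (.single a)⟩, a.1.2⟩,
            ⟨⟨a.2.1.1, hvr⟩, a.2.1.2⟩, a.2.2⟩
        | head a b ih =>
          intro hx
          have hc := hx.tail a
          exact TransGen.head ⟨⟨⟨a.1.1, key _ hx (b.head a)⟩, a.1.2⟩,
            ⟨⟨a.2.1.1, key _ hc b⟩, a.2.1.2⟩, a.2.2⟩ (ih hc)
      exact key2 v hv .refl

theorem close_cycle {m : ℕ} (C : Digraph' (Fin (m+3)))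
    (hC : IsOrientationOf C (SimpleGraph.cycleGraph (m+3))) (D : Digraph' V) (hD : D.Loopless)
    (d : ℕ) (r z z' : V)
    (h1 : PP D (fun j => C.Adj (Fin.ofNat (m+3) j) (Fin.ofNat (m+3) (j+1))) Set.univ d (d+(m+2)) r z)
    (h2 : PP D (fun j => C.Adj (Fin.ofNat (m+3) j) (Fin.ofNat (m+3) (j+1))) Set.univ d (d+(m+2)) r z')
    (a1 : D.Adj r z) (a2 : D.Adj z' r) : D.ContainsSubdivision C := by
  classical
  set w : ℕ → Prop := fun j => C.Adj (Fin.ofNat (m+3) j) (Fin.ofNat (m+3) (j+1)) with hw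
  -- choose the endpoint according to the direction of the closing arc
  obtain ⟨y, hy, hly⟩ : ∃ y, PP D w Set.univ d (d+(m+2)) r y ∧ Leg D (w (d+(m+2))) y [] r := by
    by_cases hd : w (d+(m+2))
    · refine ⟨z', h2, .inl ⟨hd, by simpa [IsDipath, List.Chain'] using a2, ?_⟩⟩
      have : z' ≠ r := by
        rintro rfl
        exact hD _ a2
      simpa using this
    · refine ⟨z, h1, .inr ⟨hd, by simpa [IsDipath, List.Chain'] using a1, ?_⟩⟩
      have : r ≠ z := by
        rintro rfl
        exact hD _ a1
      simpa using this
  obtain ⟨b, q, p1, p2, -, p4, p5, -, p7, p8⟩ := hy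
  have hE : ∀ a : Fin (m+3), ∃ j, d ≤ j ∧ j ≤ d+(m+2) ∧ j % (m+3) = a.1 := by
    intro a
    refine ⟨d + (a.1 + (m+2) * d) % (m+3), by omega, ?_, ?_⟩
    · have := Nat.mod_lt (a.1 + (m+2) * d) (show 0 < m+3 by omega)
      omega
    · rw [Nat.add_mod_mod]
      have : d + (a.1 + (m+2) * d) = a.1 + (m+3) * d := by ring
      rw [this, Nat.add_mul_mod_self_left, Nat.mod_eq_of_lt a.2]
  choose E E1 E2 E3 using hE
  have Einj : ∀ a a', E a = E a' → a = a' := by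
    intro a a' h
    apply Fin.ext
    rw [← E3 a, ← E3 a', h]
  have Euniq : ∀ i j, d ≤ i → i ≤ d+(m+2) → d ≤ j → j ≤ d+(m+2) → i % (m+3) = j % (m+3) →
      i = j := by
    have aux : ∀ i j, d ≤ i → j ≤ d+(m+2) → i ≤ j → i % (m+3) = j % (m+3) → i = j := by
      intro i j hi hj hij h
      have h3 := (Nat.modEq_iff_dvd' hij).1 h
      have := Nat.eq_zero_of_dvd_of_lt h3 (by omega)
      omega
    intro i j i1 i2 j1 j2 h
    rcases le_total i j with hij | hij
    · exact aux i j i1 j2 hij h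
    · exact (aux j i j1 i2 hij h.symm).symm
  let q' : ℕ → List V := fun j => if j = d + (m+2) then [] else q j
  have Eof : ∀ a : Fin (m+3), Fin.ofNat (m+3) (E a) = a := by
    intro a
    apply Fin.ext
    simpa using E3 a
  have Eof1 : ∀ a : Fin (m+3), Fin.ofNat (m+3) (E a + 1) = a + 1 := by
    intro a
    apply Fin.ext
    rw [Fin.val_add]
    simp [Nat.add_mod, E3 a]
  -- segments
  have seg : ∀ a : Fin (m+3), Leg D (C.Adj a (a+1)) (b (E a)) (q' (E a)) (b (E (a+1))) := by
    intro a
    have hwa : w (E a) = C.Adj a (a+1) := by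
      simp only [hw]
      rw [Eof, Eof1]
    rw [← hwa]
    have hv : (a+1).1 = (E a + 1) % (m+3) := by
      rw [← Eof1 a]
      simp
    by_cases hl : E a = d + (m+2)
    · have : E (a+1) = d := by
        apply Euniq _ _ (E1 _) (E2 _) le_rfl (by omega)
        rw [E3, hv, hl]
        have : d + (m+2) + 1 = d + (m+3) := by ring
        rw [this, Nat.add_mod_right]
      rw [this, hl, p1, p2]
      simpa [q'] using hly
    · have h9 := E2 a
      have h10 := E1 a
      have : E (a+1) = E a + 1 := by
        apply Euniq _ _ (E1 _) (E2 _) (by omega) (by omega)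
        rw [E3, hv]
      rw [this]
      simpa [q', hl] using p5 (E a) (E1 a) (by omega)
  have qav : ∀ a, ∀ x ∈ q' (E a), ∀ a', x ≠ b (E a') := by
    intro a x hx a'
    simp only [q'] at hx
    split_ifs at hx with hl
    · simp at hx
    · have := E2 a
      exact p7 _ (E1 a) (by omega) x hx _ (E1 a') (E2 a')
  have qdis : ∀ a a', ∀ x, x ∈ q' (E a) → x ∈ q' (E a') → a = a' := by
    intro a a' x hx hx'
    simp only [q'] at hx hx'
    split_ifs at hx hx' with hl hl' hl'
    · simp at hx
    · simp at hx
    · simp at hx'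
    · have := E2 a
      have := E2 a'
      exact Einj _ _ (p8 _ _ (E1 a) (by omega) (E1 a') (by omega) x hx hx')
  have adj : ∀ a a', C.Adj a a' → a' = a + 1 ∨ a = a' + 1 := by
    intro a a' h
    have := SimpleGraph.cycleGraph_adj.1 (hC.1 _ _ h)
    rcases this with h | h
    · right
      rw [← h]; abel
    · left
      rw [← h]; abel
  have anti : ∀ a a', C.Adj a a' → ¬ C.Adj a' a := fun a a' h h' =>
    (hC.2 _ _ (hC.1 _ _ h)).2 ⟨h, h'⟩
  refine ⟨fun a => b (E a), fun a a' _ => if a' = a + 1 then q' (E a) else q' (E a'),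
    ?_, ?_, ?_, ?_⟩
  · intro a a' h
    exact Einj _ _ (p4 _ _ (E1 _) (E2 _) (E1 _) (E2 _) h)
  · intro a a' h
    by_cases hs : a' = a + 1
    · subst hs
      rcases seg a with h' | h'
      · simpa using h'.2
      · exact absurd h h'.1
    · have ha : a = a' + 1 := (adj a a' h).resolve_left hs
      simp only [hs, if_false]
      subst ha
      rcases seg a' with h' | h'
      · exact absurd h (anti _ _ h'.1)
      · exact h'.2
  · rintro a a' h x hx ⟨c, hc⟩
    dsimp only at hx hc
    split_ifs at hx
    · exact qav _ x hx c hc.symm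
    · exact qav _ x hx c hc.symm
  · intro a a' h c c' h' hne x hx hx'
    dsimp only at hx hx'
    split_ifs at hx hx' with s s' s'
    · have := qdis _ _ x hx hx'
      subst this
      exact hne (by rw [s, s'])
    · have := qdis _ _ x hx hx'
      have t := (adj c c' h').resolve_left s'
      subst this
      subst t
      subst s
      exact anti _ _ h h'
    · have := qdis _ _ x hx hx'
      have t := (adj a a' h).resolve_left s
      subst this
      subst t
      subst s'
      exact anti _ _ h h'
    · have := qdis _ _ x hx hx'
      have t := (adj a a' h).resolve_left s
      have t' := (adj c c' h').resolve_left s'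
      subst this
      exact hne (by rw [t, t'])

theorem upper {m : ℕ} (C : Digraph' (Fin (m+3)))
    (hC : IsOrientationOf C (SimpleGraph.cycleGraph (m+3))) : MaderBound C (m+3) := by
  intro n D hD hk
  by_contra hcon
  obtain ⟨h, -, hh⟩ := glue D (m+2) Set.univ (fun _ _ => True) (by
    intro v hv
    obtain ⟨h, -, hh⟩ := main_lemma D hD
      (fun j => C.Adj (Fin.ofNat (m+3) j) (Fin.ofNat (m+3) (j+1))) (m+2) (by omega)
      (fun d r z z' h1 h2 a1 a2 => hcon (close_cycle C hC D hD d r z z' h1 h2 a1 a2))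
      (Comp D Set.univ v) v 0 (comp_self hv) (comp_strong D _ v)
    exact ⟨h, trivial, hh⟩)
  have : D.dichromaticNumber ≤ m + 2 := by
    apply Nat.sInf_le
    refine ⟨fun v => ⟨h v % (m+2), Nat.mod_lt _ (by omega)⟩, ?_⟩
    intro i
    have e : {v : Fin n | (⟨h v % (m+2), Nat.mod_lt _ (by omega)⟩ : Fin (m+2)) = i} =
        {v | v ∈ Set.univ ∧ h v % (m+2) = i.1} := by
      ext v
      simp [Fin.ext_iff]
    rw [e]
    exact hh i.1
  omega

theorem lower {m k : ℕ} (C : Digraph' (Fin (m+3))) (hk : MaderBound C k) : m + 3 ≤ k := by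
  by_contra hlt
  have hn : m + 2 ≤ (⟨fun a b => a ≠ b⟩ : Digraph' (Fin (m+2))).dichromaticNumber := by
    have inj : ∀ k, ∀ c : Fin (m+2) → Fin k,
        (⟨fun a b => a ≠ b⟩ : Digraph' (Fin (m+2))).IsAcyclicColoring c → m + 2 ≤ k := by
      intro k c hc
      have : Function.Injective c := by
        intro u v huv
        by_contra hne
        exact hc (c u) u (TransGen.head (b := v) ⟨rfl, huv.symm, hne⟩
          (.single ⟨huv.symm, rfl, Ne.symm hne⟩))
      simpa using Fintype.card_le_of_injective c this
    apply le_csInf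
    · refine ⟨m+2, id, ?_⟩
      intro i v hv
      obtain ⟨c, hc, -⟩ := TransGen.head'_iff.1 hv
      have e1 : v = i := hc.1
      have e2 : c = i := hc.2.1
      exact hc.2.2 (e1.trans e2.symm)
    · rintro k ⟨c, hc⟩
      exact inj k c hc
  obtain ⟨β, p, hβ, -⟩ := hk (m+2) ⟨fun a b => a ≠ b⟩ (fun v h => h rfl) (by omega)
  have := Fintype.card_le_of_injective β hβ
  simp at this

end CycMader

/-- If `C` is any orientation of the undirected cycle of
length `ℓ ≥ 3`, then `mader(C) = ℓ`. -/
theorem cycle_orientation_mader {ℓ : ℕ} (hℓ : 3 ≤ ℓ) (C : Digraph' (Fin ℓ))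
    (hC : IsOrientationOf C (SimpleGraph.cycleGraph ℓ)) :
    Digraph'.mader C = ℓ := by
  obtain ⟨m, rfl⟩ : ∃ m, ℓ = m + 3 := ⟨ℓ - 3, by omega⟩
  apply le_antisymm
  · exact Nat.sInf_le ⟨by omega, CycMader.upper C hC⟩
  · apply le_csInf
    · exact ⟨m + 3, by omega, CycMader.upper C hC⟩
    · rintro k ⟨-, hk⟩
      exact CycMader.lower C hk
end

section
/- If T is an undirected forest, then mader_χ⃗(T↔) = v(T), where T↔ is the biorientation of T; that is, every digraph with dichromatic number at least v(T) contains a subdivision of the bioriented forest T↔. -/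
namespace ForestMader

open Digraph'

/-- A finite nontrivial acyclic graph has a vertex with at most one neighbour. -/
theorem exists_leaf {α : Type} [Finite α] [Nontrivial α] (G : SimpleGraph α)
    (hG : G.IsAcyclic) : ∃ l u : α, u ≠ l ∧ ∀ a, G.Adj l a → a = u := by
  classical
  have := Fintype.ofFinite α
  obtain ⟨T, hT⟩ := (SimpleGraph.connected_top (V := α)).exists_isTree_le_of_le_of_isAcyclic
    (le_top : G ≤ ⊤) hG
  obtain ⟨hGT, -, hT⟩ : G ≤ T ∧ T ≤ ⊤ ∧ T.IsTree := by tauto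
  obtain ⟨l, hl⟩ := hT.exists_vert_degree_one_of_nontrivial
  obtain ⟨u, hu, huniq⟩ := SimpleGraph.degree_eq_one_iff_existsUnique_adj.mp hl
  exact ⟨l, u, hu.ne', fun a ha => huniq a (hGT ha)⟩

theorem exists_leaf_finset {α : Type} (G : SimpleGraph α) (hG : G.IsAcyclic) (W : Finset α)
    (hW : 1 < W.card) :
    ∃ l ∈ W, ∃ u ∈ W, u ≠ l ∧ ∀ a ∈ W, G.Adj l a → a = u := by
  have : Nontrivial (W : Set α) := by
    rw [Set.nontrivial_coe_sort]
    exact Finset.one_lt_card_iff_nontrivial.mp hW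
  have : Finite (W : Set α) := W.finite_toSet
  obtain ⟨l, u, hne, h⟩ := exists_leaf (G.induce (W : Set α)) (hG.induce _)
  refine ⟨l, l.2, u, u.2, fun h => hne (Subtype.ext h), fun a ha hadj => ?_⟩
  exact congrArg Subtype.val (h ⟨a, ha⟩ hadj)

variable {V : Type}

theorem acyclicOn_mono {D : Digraph' V} {S S' : Set V} (h : S ⊆ S') (hS : D.AcyclicOn S') :
    D.AcyclicOn S := fun v hv =>
  hS v (Relation.TransGen.mono (fun _ _ ⟨a, b, c⟩ => ⟨h a, h b, c⟩) _ _ hv)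

/-- A walk inside `S` can be shortened to a path. -/
theorem exists_path {D : Digraph' V} {S : Set V} {y x : V}
    (h : Relation.ReflTransGen (fun x y => x ∈ S ∧ y ∈ S ∧ D.Adj x y) y x) :
    y ≠ x → ∃ l : List V, (y :: l ++ [x]).IsChain D.Adj ∧ (y :: l ++ [x]).Nodup ∧
      ∀ z ∈ y :: l, z ∈ S := by
  induction h using Relation.ReflTransGen.head_induction_on with
  | refl => intro h; exact absurd rfl h
  | head hab hrest ih =>
    rename_i a b
    clear hrest
    intro hne
    by_cases hbx : b = x
    · subst hbx
      refine ⟨[], ?_, ?_, ?_⟩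
      · simpa using hab.2.2
      · simpa using hne
      · simpa using hab.1
    · obtain ⟨l, h1, h2, h3⟩ := ih hbx
      by_cases hal : a ∈ b :: l
      · obtain ⟨s, t, hst⟩ := List.append_of_mem hal
        rw [hst] at h1 h2 h3
        refine ⟨t, ?_, ?_, ?_⟩
        · rw [List.append_assoc] at h1
          exact h1.right_of_append
        · rw [List.append_assoc] at h2
          exact h2.of_append_right
        · intro z hz
          exact h3 z (by simp only [List.mem_append]; exact Or.inr hz)
      · refine ⟨b :: l, ?_, ?_, ?_⟩
        · exact List.isChain_cons_cons.mpr ⟨hab.2.2, h1⟩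
        · refine List.nodup_cons.mpr ⟨?_, h2⟩
          intro hm
          rcases List.mem_append.mp hm with hm | hm
          · exact hal hm
          · exact hne (by simpa using hm)
        · intro z hz
          rcases List.mem_cons.mp hz with rfl | hz
          · exact hab.1
          · exact h3 z hz

theorem transGen_split {D : Digraph' V} {A : Set V} {x a b : V}
    (h : Relation.TransGen (fun p q => p ∈ insert x A ∧ q ∈ insert x A ∧ D.Adj p q) a b) :
    Relation.TransGen (fun p q => p ∈ A ∧ q ∈ A ∧ D.Adj p q) a b ∨
    (Relation.ReflTransGen (fun p q => p ∈ insert x A ∧ q ∈ insert x A ∧ D.Adj p q) a x ∧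
     Relation.ReflTransGen (fun p q => p ∈ insert x A ∧ q ∈ insert x A ∧ D.Adj p q) x b) := by
  induction h with
  | single h =>
    rename_i b
    by_cases ha : a = x
    · subst ha; exact Or.inr ⟨.refl, .single h⟩
    by_cases hb : b = x
    · subst hb; exact Or.inr ⟨.single h, .refl⟩
    · exact Or.inl (.single ⟨h.1.resolve_left ha, h.2.1.resolve_left hb, h.2.2⟩)
  | tail hab h ih =>
    rename_i b c
    rcases ih with ih | ⟨h1, h2⟩
    · by_cases hb : b = x
      · subst hb; exact Or.inr ⟨hab.to_reflTransGen, .single h⟩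
      by_cases hc : c = x
      · subst hc; exact Or.inr ⟨(hab.tail h).to_reflTransGen, .refl⟩
      · exact Or.inl (ih.tail ⟨h.1.resolve_left hb, h.2.1.resolve_left hc, h.2.2⟩)
    · exact Or.inr ⟨h1, h2.tail h⟩

/-- If `A` is acyclic and `A ∪ {x}` is not, there is a directed cycle through `x` in `A ∪ {x}`. -/
theorem exists_cycle {D : Digraph' V} (hD : D.Loopless) {A : Set V} {x : V}
    (hA : D.AcyclicOn A) (hxA : ¬ D.AcyclicOn (insert x A)) :
    ∃ (y : V) (l : List V), y ∈ A ∧ (∀ z ∈ l, z ∈ A) ∧ D.Adj x y ∧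
      (y :: l ++ [x]).IsChain D.Adj ∧ (y :: l ++ [x]).Nodup := by
  unfold AcyclicOn at hxA
  push Not at hxA
  obtain ⟨v, hv⟩ := hxA
  have hxx : Relation.TransGen
      (fun p q => p ∈ insert x A ∧ q ∈ insert x A ∧ D.Adj p q) x x := by
    rcases transGen_split hv with h | ⟨h1, h2⟩
    · exact absurd h (hA v)
    · by_cases hvx : v = x
      · subst hvx; exact hv
      · rcases Relation.reflTransGen_iff_eq_or_transGen.mp h1 with h | h
        · exact absurd h.symm hvx
        · exact Relation.TransGen.trans_right h2 h
  obtain ⟨y, hxy, hyx⟩ := Relation.TransGen.head'_iff.mp hxx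
  have hne : y ≠ x := by rintro rfl; exact hD _ hxy.2.2
  obtain ⟨l, h1, h2, h3⟩ := exists_path hyx hne
  have hx : x ∉ y :: l := by
    intro hm
    exact (List.nodup_append.mp h2).2.2 x hm x (by simp) rfl
  have h4 : ∀ z ∈ y :: l, z ∈ A := fun z hz =>
    (h3 z hz).resolve_left (by rintro rfl; exact hx hz)
  exact ⟨y, l, h4 y (by simp), fun z hz => h4 z (by simp [hz]), hxy.2.2, h1, h2⟩

/-- `S` can be partitioned into `k` acyclic sets. -/
def Col (D : Digraph' V) (S : Set V) (k : ℕ) : Prop :=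
  ∃ c : V → ℕ, (∀ v ∈ S, c v < k) ∧ ∀ i, D.AcyclicOn {v | v ∈ S ∧ c v = i}

theorem col_succ {D : Digraph' V} {S A : Set V} {k : ℕ} (hA : D.AcyclicOn A)
    (h : Col D (S \ A) k) : Col D S (k + 1) := by
  classical
  obtain ⟨c, hc, hac⟩ := h
  refine ⟨fun v => if v ∈ A then k else c v, ?_, ?_⟩
  · intro v hv
    by_cases hvA : v ∈ A
    · simp [hvA]
    · have := hc v ⟨hv, hvA⟩
      simp only [hvA, if_false]; omega
  · intro i
    by_cases hi : i = k
    · refine acyclicOn_mono ?_ hA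
      rintro v ⟨hv, hvi⟩
      by_contra hvA
      have := hc v ⟨hv, hvA⟩
      simp only [hvA, if_false] at hvi; omega
    · refine acyclicOn_mono ?_ (hac i)
      rintro v ⟨hv, hvi⟩
      by_cases hvA : v ∈ A
      · simp only [hvA, if_true] at hvi; omega
      · simp only [hvA, if_false] at hvi
        exact ⟨⟨hv, hvA⟩, hvi⟩

theorem exists_maximal_acyclic [Finite V] (D : Digraph' V) (S : Set V) :
    ∃ A ⊆ S, D.AcyclicOn A ∧ ∀ x ∈ S, x ∉ A → ¬ D.AcyclicOn (insert x A) := by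
  have hne : ({A : Set V | A ⊆ S ∧ D.AcyclicOn A}).Nonempty := by
    refine ⟨∅, Set.empty_subset _, fun v hv => ?_⟩
    obtain ⟨y, h, -⟩ := Relation.TransGen.head'_iff.mp hv
    exact h.1
  obtain ⟨A, hA⟩ := (Set.toFinite {A : Set V | A ⊆ S ∧ D.AcyclicOn A}).exists_maximal hne
  refine ⟨A, hA.prop.1, hA.prop.2, fun x hx hxA h => hxA ?_⟩
  exact hA.le_of_ge (y := insert x A) ⟨Set.insert_subset hx hA.prop.1, h⟩
    (Set.subset_insert x A) (Set.mem_insert x A)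

/-- The subdivision of the part of `T` induced by `W` inside `S`. -/
theorem main_induction [Finite V] (D : Digraph' V) (hD : D.Loopless) {α : Type}
    (T : SimpleGraph α) (hT : T.IsAcyclic) (k : ℕ) :
    ∀ (S : Set V) (W : Finset α), W.card = k + 1 → ¬ Col D S k →
    ∃ (β : α → V) (p : α → α → List V),
      Set.InjOn β W ∧ (∀ a ∈ W, β a ∈ S) ∧
      (∀ a ∈ W, ∀ b ∈ W, T.Adj a b → (β a :: p a b ++ [β b]).IsChain D.Adj ∧
        (β a :: p a b ++ [β b]).Nodup) ∧
      (∀ a ∈ W, ∀ b ∈ W, T.Adj a b → ∀ x ∈ p a b, x ∈ S ∧ ∀ c ∈ W, x ≠ β c) ∧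
      (∀ a ∈ W, ∀ b ∈ W, T.Adj a b → ∀ a' ∈ W, ∀ b' ∈ W, T.Adj a' b' →
        (a, b) ≠ (a', b') → ∀ x ∈ p a b, x ∉ p a' b') := by
  classical
  induction k with
  | zero =>
    intro S W hW hS
    obtain ⟨w, rfl⟩ := Finset.card_eq_one.mp hW
    have : S.Nonempty := by
      by_contra h
      rw [Set.not_nonempty_iff_eq_empty] at h
      subst h
      refine hS ⟨fun _ => 0, by simp, fun i v hv => ?_⟩
      obtain ⟨y, h, -⟩ := Relation.TransGen.head'_iff.mp hv
      exact h.1.1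
    obtain ⟨s, hs⟩ := this
    refine ⟨fun _ => s, fun _ _ => [], by simp, by simp [hs], ?_, by simp, by simp⟩
    intro a ha b hb hab
    rw [Finset.mem_singleton] at ha hb
    subst ha; subst hb
    exact absurd hab (T.irrefl)
  | succ k ih =>
    intro S W hW hS
    obtain ⟨l, hl, u, hu, hul, hleaf⟩ := exists_leaf_finset T hT W (by omega)
    obtain ⟨A, hAS, hA, hmax⟩ := exists_maximal_acyclic D S
    obtain ⟨β, p, hinj, hβ, hpath, hint, hdisj⟩ := ih (S \ A) (W.erase l)
      (by rw [Finset.card_erase_of_mem hl]; omega) (fun h => hS (col_succ hA h))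
    have hu' : u ∈ W.erase l := Finset.mem_erase.mpr ⟨hul, hu⟩
    obtain ⟨y, q, hy, hq, hxy, hch, hnd⟩ :=
      exists_cycle hD hA (hmax (β u) (hβ u hu').1 (hβ u hu').2)
    have hyu : β u ≠ y := fun h => (hβ u hu').2 (h ▸ hy)
    -- the new branch map and paths
    let β' : α → V := fun a => if a = l then y else β a
    let p' : α → α → List V := fun a b =>
      if a = l then q else if b = l then [] else p a b
    have hβl : β' l = y := by simp [β']
    have hβo : ∀ a, a ≠ l → β' a = β a := fun a ha => by simp [β', ha]
    have hpl : ∀ b, p' l b = q := fun b => by simp [p']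
    have hpr : ∀ a, a ≠ l → p' a l = [] := fun a ha => by simp [p', ha]
    have hpo : ∀ a b, a ≠ l → b ≠ l → p' a b = p a b := fun a b ha hb => by simp [p', ha, hb]
    have hW' : ∀ a ∈ W, a ≠ l → a ∈ W.erase l := fun a ha h => Finset.mem_erase.mpr ⟨h, ha⟩
    have hyq : y ∉ q := fun h => (List.nodup_cons.mp hnd).1 (by simp [h])
    clear_value β' p'
    refine ⟨β', p', ?_, ?_, ?_, ?_, ?_⟩
    · intro a ha b hb hab
      by_cases hal : a = l <;> by_cases hbl : b = l
      · rw [hal, hbl]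
      · rw [hal, hβl, hβo b hbl] at hab
        exact absurd (hab ▸ hy) (hβ b (hW' b hb hbl)).2
      · rw [hbl, hβl, hβo a hal] at hab
        exact absurd (hab ▸ hy) (hβ a (hW' a ha hal)).2
      · rw [hβo a hal, hβo b hbl] at hab
        exact hinj (hW' a ha hal) (hW' b hb hbl) hab
    · intro a ha
      by_cases hal : a = l
      · rw [hal, hβl]; exact hAS hy
      · rw [hβo a hal]; exact (hβ a (hW' a ha hal)).1
    · intro a ha b hb hab
      by_cases hal : a = l
      · subst hal
        have := hleaf b hb hab
        subst this
        rw [hβl, hβo b hul, hpl]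
        exact ⟨hch, hnd⟩
      · by_cases hbl : b = l
        · subst hbl
          have := hleaf a ha hab.symm
          subst this
          rw [hβl, hβo a hul, hpr a hul]
          exact ⟨by simpa using hxy, by simpa using hyu⟩
        · rw [hβo a hal, hβo b hbl, hpo a b hal hbl]
          exact hpath a (hW' a ha hal) b (hW' b hb hbl) hab
    · intro a ha b hb hab x hx
      by_cases hal : a = l
      · subst hal
        rw [hpl] at hx
        refine ⟨hAS (hq x hx), fun c hc => ?_⟩
        by_cases hcl : c = a
        · rw [hcl, hβl]; rintro rfl; exact hyq hx
        · rw [hβo c hcl]; rintro rfl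
          exact (hβ c (hW' c hc hcl)).2 (hq _ hx)
      · by_cases hbl : b = l
        · subst hbl
          rw [hpr a hal] at hx
          simp at hx
        · rw [hpo a b hal hbl] at hx
          obtain ⟨h1, h2⟩ := hint a (hW' a ha hal) b (hW' b hb hbl) hab x hx
          refine ⟨h1.1, fun c hc => ?_⟩
          by_cases hcl : c = l
          · rw [hcl, hβl]; rintro rfl; exact h1.2 hy
          · rw [hβo c hcl]; exact h2 c (hW' c hc hcl)
    · have key : ∀ a ∈ W, ∀ b ∈ W, T.Adj a b → a ≠ l → ∀ x ∈ p' a b, x ∉ A := by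
        intro a ha b hb hab hal x hx
        by_cases hbl : b = l
        · subst hbl
          rw [hpr a hal] at hx
          simp at hx
        · rw [hpo a b hal hbl] at hx
          exact (hint a (hW' a ha hal) b (hW' b hb hbl) hab x hx).1.2
      intro a ha b hb hab a' ha' b' hb' hab' hne x hx hx'
      by_cases hal : a = l <;> by_cases hal' : a' = l
      · subst hal
        subst hal'
        exact hne (by rw [hleaf b hb hab, hleaf b' hb' hab'])
      · rw [hal, hpl] at hx
        exact key a' ha' b' hb' hab' hal' x hx' (hq x hx)
      · rw [hal', hpl] at hx'
        exact key a ha b hb hab hal x hx (hq x hx')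
      · by_cases hbl : b = l
        · rw [hbl, hpr a hal] at hx
          simp at hx
        by_cases hbl' : b' = l
        · rw [hbl', hpr a' hal'] at hx'
          simp at hx'
        rw [hpo a b hal hbl] at hx
        rw [hpo a' b' hal' hbl'] at hx'
        exact hdisj a (hW' a ha hal) b (hW' b hb hbl) hab a' (hW' a' ha' hal') b'
          (hW' b' hb' hbl') hab' hne x hx hx'

theorem upper {m : ℕ} (hm : 0 < m) (T : SimpleGraph (Fin m)) (hT : T.IsAcyclic) :
    MaderBound (⟨T.Adj⟩ : Digraph' (Fin m)) m := by
  intro n D hD hk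
  have hcol : ¬ Col D Set.univ (m - 1) := by
    rintro ⟨c, hc, hac⟩
    have : D.dichromaticNumber ≤ m - 1 := by
      refine Nat.sInf_le ⟨fun v => ⟨c v, hc v trivial⟩, fun i => ?_⟩
      refine acyclicOn_mono ?_ (hac i)
      intro v hv
      exact ⟨trivial, congrArg Fin.val hv⟩
    omega
  obtain ⟨β, p, hinj, -, hpath, hint, hdisj⟩ := main_induction D hD T hT (m - 1) Set.univ
    Finset.univ (by simp; omega) hcol
  refine ⟨β, fun a b _ => p a b, fun a b h => hinj (by simp) (by simp) h, ?_, ?_, ?_⟩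
  · intro a b h
    exact hpath a (by simp) b (by simp) h
  · rintro a b h x hx ⟨c, rfl⟩
    exact (hint a (by simp) b (by simp) h _ hx).2 c (by simp) rfl
  · intro a b h a' b' h' hne x hx
    exact hdisj a (by simp) b (by simp) h a' (by simp) b' (by simp) h' hne x hx

theorem lower {m k : ℕ} (F : Digraph' (Fin m)) (h : MaderBound F k) : m ≤ k := by
  by_contra hlt
  let D : Digraph' (Fin k) := ⟨fun a b => a ≠ b⟩
  have hdi : k ≤ D.dichromaticNumber := by
    refine le_csInf ⟨k, id, fun i v hv => ?_⟩ ?_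
    · obtain ⟨y, ⟨h1, h2, h3⟩, -⟩ := Relation.TransGen.head'_iff.mp hv
      exact h3 (h1.trans h2.symm)
    · rintro j ⟨c, hc⟩
      have hinj : Function.Injective c := by
        intro a b hab
        by_contra hne
        refine hc (c b) a (.tail (.single (b := b) ⟨hab, rfl, hne⟩) ⟨rfl, hab, Ne.symm hne⟩)
      simpa using Fintype.card_le_of_injective c hinj
  obtain ⟨β, -, hβ, -⟩ := h k D (fun v hv => hv rfl) hdi
  have := Fintype.card_le_of_injective β hβ
  simp at this
  omega

end ForestMader

/-- If `T` is an undirected forest, then the biorientation of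
`T` (replace each edge by both arcs) has Mader number `v(T)`. -/
theorem bioriented_forest_mader {m : ℕ} (hm : 0 < m) (T : SimpleGraph (Fin m))
    (hT : T.IsAcyclic) :
    Digraph'.mader (⟨T.Adj⟩ : Digraph' (Fin m)) = m := by
  have hmem : m ∈ {k : ℕ | 1 ≤ k ∧ Digraph'.MaderBound (⟨T.Adj⟩ : Digraph' (Fin m)) k} :=
    ⟨hm, ForestMader.upper hm T hT⟩
  apply le_antisymm
  · exact Nat.sInf_le hmem
  · exact le_csInf ⟨m, hmem⟩ fun k hk => ForestMader.lower _ hk.2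
end

section
/- mader_χ⃗(K₃↔ − e) = 3, where K₃↔ − e is the bioriented triangle with one arc removed; equivalently, every digraph with dichromatic number at least 3 contains a subdivision of K₃↔ − e, and this is sharp. -/
/-- The bioriented triangle minus one arc: vertices `0,1,2` and arcs
`(0,1),(1,0),(1,2),(2,1),(0,2)`. -/
def K3e : Digraph' (Fin 3) :=
  ⟨fun a b => ((a : ℕ), (b : ℕ)) ∈ ([(0,1),(1,0),(1,2),(2,1),(0,2)] : List (ℕ × ℕ))⟩

namespace Digraph'

variable {V : Type}

theorem AcyclicOn.mono {D : Digraph' V} {A B : Set V} (h : D.AcyclicOn B) (hAB : A ⊆ B) :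
    D.AcyclicOn A := fun v hv =>
  h v (Relation.TransGen.mono (fun _ _ ⟨h1, h2, h3⟩ => ⟨hAB h1, hAB h2, h3⟩) _ _ hv)

/-- Acyclicity can be checked separately on an out-closed part and its complement. -/
theorem acyclicOn_of_split {D : Digraph' V} {A H : Set V}
    (hH : ∀ x ∈ A, ∀ y ∈ A, x ∈ H → D.Adj x y → y ∈ H)
    (h1 : D.AcyclicOn (A ∩ H)) (h2 : D.AcyclicOn (A \ H)) : D.AcyclicOn A := by
  intro w hw
  have key : ∀ y, Relation.TransGen (fun x y => x ∈ A ∧ y ∈ A ∧ D.Adj x y) w y →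
      (w ∈ H → y ∈ H ∧ Relation.TransGen
        (fun x y => x ∈ A ∩ H ∧ y ∈ A ∩ H ∧ D.Adj x y) w y) ∧
      (y ∉ H → w ∉ H ∧ Relation.TransGen
        (fun x y => x ∈ A \ H ∧ y ∈ A \ H ∧ D.Adj x y) w y) := by
    intro y hy
    induction hy with
    | single h =>
      obtain ⟨ha, hb, hab⟩ := h
      refine ⟨fun hw => ?_, fun hy => ?_⟩
      · have := hH _ ha _ hb hw hab
        exact ⟨this, .single ⟨⟨ha, hw⟩, ⟨hb, this⟩, hab⟩⟩
      · have hw : w ∉ H := fun hw => hy (hH _ ha _ hb hw hab)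
        exact ⟨hw, .single ⟨⟨ha, hw⟩, ⟨hb, hy⟩, hab⟩⟩
    | tail _ h ih =>
      obtain ⟨ha, hb, hab⟩ := h
      refine ⟨fun hw => ?_, fun hy => ?_⟩
      · obtain ⟨hm, hp⟩ := ih.1 hw
        have := hH _ ha _ hb hm hab
        exact ⟨this, hp.tail ⟨⟨ha, hm⟩, ⟨hb, this⟩, hab⟩⟩
      · have hm := fun hm => hy (hH _ ha _ hb hm hab)
        obtain ⟨hw, hp⟩ := ih.2 hm
        exact ⟨hw, hp.tail ⟨⟨ha, hm⟩, ⟨hb, hy⟩, hab⟩⟩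
  by_cases hwH : w ∈ H
  · exact h1 w ((key w hw).1 hwH).2
  · exact h2 w ((key w hw).2 hwH).2

/-- Extraction of a simple path from a walk. -/
theorem exists_path {r : V → V → Prop} {a b : V} (h : Relation.ReflTransGen r a b) :
    a = b ∨ ∃ l, (a :: l ++ [b]).IsChain r ∧ (a :: l ++ [b]).Nodup := by
  induction h using Relation.ReflTransGen.head_induction_on with
  | refl => exact Or.inl rfl
  | @head a c hac _ ih =>
    by_cases hab : a = b
    · exact Or.inl hab
    right
    rcases ih with rfl | ⟨l, hl, hn⟩
    · exact ⟨[], by simpa using hac, by simpa using hab⟩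
    · by_cases hm : a ∈ c :: l
      · obtain ⟨s, t, hst⟩ := List.append_of_mem hm
        rw [hst] at hl hn
        refine ⟨t, ?_, ?_⟩
        · exact hl.suffix ⟨s, by simp⟩
        · exact hn.sublist (by simp)
      · refine ⟨c :: l, ?_, ?_⟩
        · simpa [hac] using hl
        · simp only [List.cons_append] at hn ⊢
          rw [List.nodup_cons]
          refine ⟨?_, hn⟩
          simp only [List.mem_cons, List.mem_append, List.mem_nil_iff] at hm ⊢
          tauto

theorem interior {r : V → V → Prop} {a b : V} {l : List V}
    (h : (a :: l ++ [b]).IsChain r) {z : V} (hz : z ∈ l) : (∃ w, r w z) ∧ ∃ w, r z w := by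
  obtain ⟨s, t, rfl⟩ := List.append_of_mem hz
  constructor
  · have : ((a :: s) ++ (z :: t ++ [b])).IsChain r := by simpa using h
    rw [List.isChain_append] at this
    exact ⟨_, this.2.2 _ (List.getLast_mem_getLast? (by simp)) z (by simp)⟩
  · have : ((a :: s ++ [z]) ++ (t ++ [b])).IsChain r := by simpa using h
    rw [List.isChain_append] at this
    obtain ⟨y, hy⟩ : ∃ y, y ∈ (t ++ [b]).head? := by cases t <;> simp
    exact ⟨y, this.2.2 z (by rw [List.getLast?_append]; simp) y hy⟩

/-- A simple cycle through `v` whose other vertices `P` lie in `X`. -/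
def Cyc (D : Digraph' V) (v : V) (X : Set V) (P : List V) : Prop :=
  (v :: P ++ [v]).IsChain D.Adj ∧ P.Nodup ∧ ∀ z ∈ P, z ∈ X

theorem exists_cyc {D : Digraph' V} (hD : D.Loopless) {v : V} {X : Set V}
    (hX : D.AcyclicOn X) (h : ¬ D.AcyclicOn (insert v X)) : ∃ P, D.Cyc v X P := by
  have key : ∀ x y, x ∈ X →
      Relation.TransGen (fun x y => x ∈ insert v X ∧ y ∈ insert v X ∧ D.Adj x y) x y →
      (y = v ∧ ∃ b, b ∈ X ∧ Relation.ReflTransGen (fun x y => x ∈ X ∧ y ∈ X ∧ D.Adj x y) x b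
        ∧ D.Adj b v) ∨
      (y ∈ X ∧ (Relation.TransGen (fun x y => x ∈ X ∧ y ∈ X ∧ D.Adj x y) x y ∨
        ∃ b a, a ∈ X ∧ b ∈ X ∧
          Relation.ReflTransGen (fun x y => x ∈ X ∧ y ∈ X ∧ D.Adj x y) x b ∧ D.Adj b v ∧
          D.Adj v a ∧ Relation.ReflTransGen (fun x y => x ∈ X ∧ y ∈ X ∧ D.Adj x y) a y)) := by
    intro x y hx hxy
    induction hxy with
    | single h =>
      obtain ⟨ha, hb, hab⟩ := h
      rcases hb with rfl | hb
      · exact Or.inl ⟨rfl, x, hx, .refl, hab⟩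
      · exact Or.inr ⟨hb, Or.inl (.single ⟨hx, hb, hab⟩)⟩
    | tail _ h ih =>
      obtain ⟨ha, hb, hab⟩ := h
      rcases ih with ⟨rfl, b, hbX, hxb, hbv⟩ | ⟨hm, ih⟩
      · rcases hb with rfl | hb
        · exact absurd hab (hD _)
        · exact Or.inr ⟨hb, Or.inr ⟨b, _, hb, hbX, hxb, hbv, hab, .refl⟩⟩
      · rcases hb with rfl | hb
        · left
          refine ⟨rfl, ?_⟩
          rcases ih with ih | ⟨b, a, _, hbX, h1, h2, _⟩
          · exact ⟨_, hm, ih.to_reflTransGen, hab⟩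
          · exact ⟨b, hbX, h1, h2⟩
        · refine Or.inr ⟨hb, ?_⟩
          rcases ih with ih | ⟨b, a, haX, hbX, h1, h2, h3, h4⟩
          · exact Or.inl (ih.tail ⟨hm, hb, hab⟩)
          · exact Or.inr ⟨b, a, haX, hbX, h1, h2, h3, h4.tail ⟨hm, hb, hab⟩⟩
  have main : ∃ a b, a ∈ X ∧ b ∈ X ∧ D.Adj v a ∧ D.Adj b v ∧
      Relation.ReflTransGen (fun x y => x ∈ X ∧ y ∈ X ∧ D.Adj x y) a b := by
    simp only [AcyclicOn, not_forall, not_not] at h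
    obtain ⟨w, hw⟩ := h
    have hwi : w ∈ insert v X := by
      obtain ⟨_, h, _⟩ := Relation.TransGen.head'_iff.1 hw
      exact h.1
    have caseX : ∀ w ∈ X, Relation.TransGen
        (fun x y => x ∈ insert v X ∧ y ∈ insert v X ∧ D.Adj x y) w v →
        ∃ b, b ∈ X ∧ Relation.ReflTransGen (fun x y => x ∈ X ∧ y ∈ X ∧ D.Adj x y) w b
        ∧ D.Adj b v := by
      intro w hwX hwv
      rcases key w v hwX hwv with ⟨_, h⟩ | ⟨_, h | ⟨b, a, haX, hbX, h1, h2, _⟩⟩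
      · exact h
      · obtain ⟨c, hc, hcv⟩ := Relation.TransGen.tail'_iff.1 h
        exact ⟨c, hcv.1, hc, hcv.2.2⟩
      · exact ⟨b, hbX, h1, h2⟩
    by_cases hwv : w = v
    · subst hwv
      obtain ⟨a, ⟨_, ha, hwa⟩, haw⟩ := Relation.TransGen.head'_iff.1 hw
      rcases ha with rfl | ha
      · exact absurd hwa (hD _)
      rcases Relation.reflTransGen_iff_eq_or_transGen.1 haw with rfl | haw
      · exact absurd hwa (hD _)
      · obtain ⟨b, hb, hab, hbw⟩ := caseX a ha haw
        exact ⟨a, b, ha, hb, hwa, hbw, hab⟩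
    · have hwX : w ∈ X := hwi.resolve_left hwv
      rcases key w w hwX hw with ⟨h, _⟩ | ⟨_, h | ⟨b, a, haX, hbX, h1, h2, h3, h4⟩⟩
      · exact absurd h hwv
      · exact absurd h (hX w)
      · exact ⟨a, b, haX, hbX, h3, h2, h4.trans h1⟩
  obtain ⟨a, b, ha, hb, hva, hbv, hab⟩ := main
  rcases exists_path hab with rfl | ⟨l, hl, hn⟩
  · exact ⟨[a], by simp [hva, hbv], by simp, by simpa using ha⟩
  · refine ⟨a :: l ++ [b], ?_, hn, ?_⟩
    · have h1 : (a :: l ++ [b]).IsChain D.Adj := hl.imp (fun _ _ h => h.2.2)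
      have h2 : ((a :: l ++ [b]) ++ [v]).IsChain D.Adj := by
        rw [List.isChain_append]
        refine ⟨h1, by simp, ?_⟩
        simpa [List.getLast?_cons] using hbv
      simpa [hva] using h2
    · intro z hz
      simp only [List.cons_append, List.mem_cons, List.mem_append, List.mem_nil_iff, or_false] at hz
      rcases hz with rfl | hz | rfl
      · exact ha
      · obtain ⟨⟨_, h⟩, _⟩ := interior hl hz
        exact h.2.1
      · exact hb

/-- Minimal connecting path between two sets. -/
theorem exists_connect {r : V → V → Prop} {A B : Set V} {x y : V}
    (hx : x ∈ A) (hy : y ∈ B) (h : Relation.ReflTransGen r x y) :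
    ∃ x' ∈ A, ∃ y' ∈ B,
      Relation.ReflTransGen (fun a b => r a b ∧ b ∉ A ∧ a ∉ B) x' y' := by
  have h1 : ∃ x' ∈ A, Relation.ReflTransGen (fun a b => r a b ∧ b ∉ A) x' y := by
    clear hy
    induction h with
    | refl => exact ⟨x, hx, .refl⟩
    | @tail b c _ hbc ih =>
      by_cases hc : c ∈ A
      · exact ⟨c, hc, .refl⟩
      · obtain ⟨x', hx', ih⟩ := ih
        exact ⟨x', hx', ih.tail ⟨hbc, hc⟩⟩
  obtain ⟨x', hx', h1⟩ := h1
  refine ⟨x', hx', ?_⟩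
  clear hx'
  induction h1 using Relation.ReflTransGen.head_induction_on with
  | refl => exact ⟨y, hy, .refl⟩
  | @head a c hac _ ih =>
    by_cases ha : a ∈ B
    · exact ⟨a, ha, .refl⟩
    · obtain ⟨y', hy', ih⟩ := ih
      exact ⟨y', hy', ih.head ⟨hac.1, hac.2, ha⟩⟩

set_option maxHeartbeats 2000000 in
theorem subdiv_of_cycles {D : Digraph' V} {v : V} {X Y T : Set V} {P Q : List V}
    (hP : D.Cyc v X P) (hQ : D.Cyc v Y Q) (hXY : Disjoint X Y) (hvX : v ∉ X) (hvY : v ∉ Y)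
    (hvT : v ∉ T) {x y : V} (hx : x ∈ P) (hy : y ∈ Q)
    (hxy : Relation.ReflTransGen (fun a b => a ∈ T ∧ b ∈ T ∧ D.Adj a b) x y) :
    D.ContainsSubdivision K3e := by
  obtain ⟨x, hx, y, hy, h⟩ := exists_connect (A := {z | z ∈ P}) (B := {z | z ∈ Q}) hx hy hxy
  clear hxy
  obtain ⟨hPc, hPn, hPX⟩ := hP
  obtain ⟨hQc, hQn, hQY⟩ := hQ
  have hPQ : ∀ z ∈ P, z ∉ Q := fun z h1 h2 => Set.disjoint_left.1 hXY (hPX z h1) (hQY z h2)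
  have hvP : v ∉ P := fun h => hvX (hPX v h)
  have hvQ : v ∉ Q := fun h => hvY (hQY v h)
  simp only [Set.mem_setOf_eq] at hx hy h
  rcases exists_path h with rfl | ⟨R, hR, hRn⟩
  · exact absurd hy (hPQ _ hx)
  have hRP : ∀ z ∈ R, z ∉ P := fun z hz => by
    obtain ⟨⟨_, h⟩, _⟩ := interior hR hz
    exact h.2.1
  have hRQ : ∀ z ∈ R, z ∉ Q := fun z hz => by
    obtain ⟨_, ⟨_, h⟩⟩ := interior hR hz
    exact h.2.2
  have hRv : v ∉ R := fun hz => by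
    obtain ⟨_, ⟨_, h⟩⟩ := interior hR hz
    exact hvT h.1.1
  have hRc : (x :: R ++ [y]).IsChain D.Adj := hR.imp (fun _ _ h => h.1.2.2)
  clear hR h hXY hvX hvY hvT hPX hQY
  obtain ⟨P1, P2, rfl⟩ := List.append_of_mem hx
  obtain ⟨Q1, Q2, rfl⟩ := List.append_of_mem hy
  have c1 : (v :: P1 ++ [x]).IsChain D.Adj := hPc.prefix ⟨P2 ++ [v], by simp⟩
  have c2 : (x :: P2 ++ [v]).IsChain D.Adj := hPc.suffix ⟨v :: P1, by simp⟩
  have c3 : (v :: Q1 ++ [y]).IsChain D.Adj := hQc.prefix ⟨Q2 ++ [v], by simp⟩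
  have c4 : (y :: Q2 ++ [v]).IsChain D.Adj := hQc.suffix ⟨v :: Q1, by simp⟩
  have n1 : (v :: P1 ++ [x]).Nodup := by grind
  have n2 : (x :: P2 ++ [v]).Nodup := by grind
  have n3 : (v :: Q1 ++ [y]).Nodup := by grind
  have n4 : (y :: Q2 ++ [v]).Nodup := by grind
  have hvx : v ≠ x := by grind
  have hvy : v ≠ y := by grind
  have hxy : x ≠ y := by grind
  have m1 : ∀ z ∈ P1, z ≠ x ∧ z ≠ v ∧ z ≠ y ∧ z ∉ P2 ∧ z ∉ Q1 ∧ z ∉ Q2 ∧ z ∉ R := by grind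
  have m2 : ∀ z ∈ P2, z ≠ x ∧ z ≠ v ∧ z ≠ y ∧ z ∉ P1 ∧ z ∉ Q1 ∧ z ∉ Q2 ∧ z ∉ R := by grind
  have m3 : ∀ z ∈ Q1, z ≠ x ∧ z ≠ v ∧ z ≠ y ∧ z ∉ P1 ∧ z ∉ P2 ∧ z ∉ Q2 ∧ z ∉ R := by grind
  have m4 : ∀ z ∈ Q2, z ≠ x ∧ z ≠ v ∧ z ≠ y ∧ z ∉ P1 ∧ z ∉ P2 ∧ z ∉ Q1 ∧ z ∉ R := by grind
  have m5 : ∀ z ∈ R, z ≠ x ∧ z ≠ v ∧ z ≠ y ∧ z ∉ P1 ∧ z ∉ P2 ∧ z ∉ Q1 ∧ z ∉ Q2 := by grind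
  clear hPc hQc hPn hQn hPQ hvP hvQ hRP hRQ hRv hx hy
  let p : Fin 3 → Fin 3 → List V := ![![[], P2, R], ![P1, [], Q1], ![[], Q2, []]]
  refine ⟨![x, v, y], fun a b _ => p a b, ?_, ?_, ?_, ?_⟩
  · intro a b hab
    clear m1 m2 m3 m4 m5 c1 c2 c3 c4 n1 n2 n3 n4 hRc hRn
    fin_cases a <;> fin_cases b <;>
      simp [hvx, hvy, hxy, hvx.symm, hvy.symm, hxy.symm] at hab ⊢
  · intro a b hab
    fin_cases a <;> fin_cases b <;> first
      | exact ⟨c1, n1⟩ | exact ⟨c2, n2⟩ | exact ⟨c3, n3⟩ | exact ⟨c4, n4⟩ | exact ⟨hRc, hRn⟩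
      | simp [K3e] at hab
  · intro a b _ z hz
    have hz' : z ≠ x ∧ z ≠ v ∧ z ≠ y := by
      fin_cases a <;> fin_cases b <;> simp [p] at hz <;> grind
    rintro ⟨i, rfl⟩
    fin_cases i <;> simp at hz'
  · intro a b _ a' b' _ hne z hz hz'
    fin_cases a <;> fin_cases b <;> simp [p] at hz <;>
      fin_cases a' <;> fin_cases b' <;> simp [p] at hz' hne <;> grind

def Two (D : Digraph' V) (S : Set V) : Prop :=
  ∃ X : Set V, D.AcyclicOn (S ∩ X) ∧ D.AcyclicOn (S \ X)

theorem subdiv_of_not_two [Finite V] {D : Digraph' V} (hD : D.Loopless)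
    (h : ¬ D.Two Set.univ) : D.ContainsSubdivision K3e := by
  obtain ⟨S, hS⟩ := exists_minimal_of_wellFoundedLT (fun S : Set V => ¬ D.Two S) ⟨_, h⟩
  have hne : S.Nonempty := by
    rw [Set.nonempty_iff_ne_empty]
    rintro rfl
    apply hS.prop
    refine ⟨∅, ?_, ?_⟩ <;>
    · intro v hv
      obtain ⟨_, h, _⟩ := Relation.TransGen.head'_iff.1 hv
      simpa using h.1
  obtain ⟨v, hv⟩ := hne
  set T := S \ {v} with hT
  have hvT : v ∉ T := by simp [hT]
  have hTwo : D.Two T := by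
    by_contra hc
    exact hvT (hS.le_of_le hc Set.diff_subset hv)
  obtain ⟨X, hX1, hX2⟩ := hTwo
  let U : Set V := {z | ∃ P, D.Cyc v (T ∩ X) P ∧ z ∈ P}
  let H : Set V := {z | ∃ u ∈ U,
    Relation.ReflTransGen (fun a b => a ∈ T ∧ b ∈ T ∧ D.Adj a b) u z}
  have hUH : ∀ z ∈ U, z ∈ H := fun z hz => ⟨z, hz, .refl⟩
  have hH : ∀ x ∈ T, ∀ y ∈ T, x ∈ H → D.Adj x y → y ∈ H := by
    rintro x hx y hy ⟨u, hu, hux⟩ hxy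
    exact ⟨u, hu, hux.tail ⟨hx, hy, hxy⟩⟩
  let X' : Set V := {z | (z ∈ X ∧ z ∉ H) ∨ (z ∉ X ∧ z ∈ H)}
  have a1 : D.AcyclicOn (T ∩ X') := by
    refine acyclicOn_of_split (H := H) (fun x hx y hy => hH x hx.1 y hy.1)
      (hX2.mono ?_) (hX1.mono ?_)
    · rintro z ⟨⟨h1, h2⟩, h3⟩
      exact ⟨h1, by rcases h2 with h2 | h2; exacts [absurd h3 h2.2, h2.1]⟩
    · rintro z ⟨⟨h1, h2⟩, h3⟩
      exact ⟨h1, by rcases h2 with h2 | h2; exacts [h2.1, absurd h2.2 h3]⟩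
  have a2 : D.AcyclicOn (T \ X') := by
    refine acyclicOn_of_split (H := H) (fun x hx y hy => hH x hx.1 y hy.1)
      (hX1.mono ?_) (hX2.mono ?_)
    · rintro z ⟨⟨h1, h2⟩, h3⟩
      exact ⟨h1, by by_contra h4; exact h2 (Or.inr ⟨h4, h3⟩)⟩
    · rintro z ⟨⟨h1, h2⟩, h3⟩
      exact ⟨h1, fun h4 => h2 (Or.inl ⟨h4, h3⟩)⟩
  have a3 : ¬ D.AcyclicOn (insert v (T ∩ X')) := by
    intro hc
    apply hS.prop
    refine ⟨insert v X', hc.mono ?_, a2.mono ?_⟩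
    · rintro z ⟨h1, h2⟩
      by_cases hz : z = v
      · exact Or.inl hz
      · exact Or.inr ⟨⟨h1, hz⟩, h2.resolve_left hz⟩
    · rintro z ⟨h1, h2⟩
      exact ⟨⟨h1, fun hz => h2 (Or.inl hz)⟩, fun hz => h2 (Or.inr hz)⟩
  obtain ⟨Q, hQ⟩ := exists_cyc hD a1 a3
  have hit : ∃ y ∈ Q, y ∈ H := by
    by_contra! hc
    have hQ' : D.Cyc v (T ∩ X) Q := by
      refine ⟨hQ.1, hQ.2.1, fun z hz => ?_⟩
      obtain ⟨h1, h2⟩ := hQ.2.2 z hz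
      exact ⟨h1, by rcases h2 with h2 | h2; exacts [h2.1, absurd h2.2 (hc z hz)]⟩
    cases Q with
    | nil =>
      have := hQ.1
      simp at this
      exact hD v this
    | cons q Q => exact hc q (by simp) (hUH q ⟨_, hQ', by simp⟩)
  obtain ⟨y, hyQ, u, ⟨P, hP, huP⟩, huy⟩ := hit
  have hP' : D.Cyc v (T \ X') P := by
    refine ⟨hP.1, hP.2.1, fun z hz => ?_⟩
    obtain ⟨h1, h2⟩ := hP.2.2 z hz
    have h3 : z ∈ H := hUH z ⟨P, hP, hz⟩
    exact ⟨h1, by rintro (h4 | h4); exacts [h4.2 h3, h4.1 h2]⟩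
  refine subdiv_of_cycles hP' hQ ?_ (fun h => hvT h.1) (fun h => hvT h.1) hvT huP hyQ huy
  rw [Set.disjoint_left]
  exact fun z h1 h2 => h1.2 h2.2

theorem maderBound_three : MaderBound K3e 3 := by
  classical
  intro n D hD h3
  apply subdiv_of_not_two hD
  rintro ⟨X, h1, h2⟩
  have : D.dichromaticNumber ≤ 2 := by
    refine Nat.sInf_le ⟨fun v => if v ∈ X then 0 else 1, fun i => ?_⟩
    fin_cases i
    · refine h1.mono ?_
      intro z hz
      by_cases hzX : z ∈ X <;> simp_all
    · refine h2.mono ?_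
      intro z hz
      by_cases hzX : z ∈ X <;> simp_all
  omega

theorem not_maderBound {k : ℕ} (hk : k ≤ 2) : ¬ MaderBound K3e k := by
  intro h
  let D : Digraph' (Fin 2) := ⟨fun a b => a ≠ b⟩
  have hD : D.Loopless := fun v hv => hv rfl
  have h2 : 2 ≤ D.dichromaticNumber := by
    apply le_csInf
    · refine ⟨2, id, fun i v hv => ?_⟩
      obtain ⟨a, ⟨h1, h2, h3⟩, _⟩ := Relation.TransGen.head'_iff.1 hv
      simp at h1 h2
      exact h3 (h1.trans h2.symm)
    · rintro m ⟨c, hc⟩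
      by_contra hm
      have e : c 0 = c 1 := by
        have := (c 0).2
        have := (c 1).2
        apply Fin.ext
        omega
      refine hc (c 0) 0 (.tail (b := 1) (.single ⟨rfl, e.symm, ?_⟩) ⟨e.symm, rfl, ?_⟩) <;>
        simp [D]
  obtain ⟨β, _, hβ, _⟩ := h 2 D hD (hk.trans h2)
  simpa using Fintype.card_le_of_injective β hβ

end Digraph'

/-- `mader(K₃↔ − e) = 3`. -/
theorem mader_K3e : Digraph'.mader K3e = 3 := by
  apply le_antisymm
  · exact Nat.sInf_le ⟨by norm_num, Digraph'.maderBound_three⟩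
  · have hne : {k : ℕ | 1 ≤ k ∧ Digraph'.MaderBound K3e k}.Nonempty :=
      ⟨3, by norm_num, Digraph'.maderBound_three⟩
    apply le_csInf hne
    rintro k ⟨_, hk⟩
    by_contra hc
    exact Digraph'.not_maderBound (by omega) hk
end
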